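/- arXiv:0806.2922 — 4 statements merged into one kernel-verified Lean document; each statement's English description precedes it below -/
import Mathlib

section
/- For every x ∈ [0,1), the set N(x) := {(α,β) ∈ [0,1)×(1,∞) : the orbit of x under T_{α,β} is μ_{α,β}-normal} has full two-dimensional Lebesgue measure, i.e., ([0,1)×(1,∞)) \ N(x) is a λ²-null set. -/
open MeasureTheory Filter

/-- The map `x ↦ β·x + α mod 1` (fractional part of `β·x + α`). -/
noncomputable def Tab (α β : ℝ) (x : ℝ) : ℝ := Int.fract (β * x + α)

/-- The coding sequence of `x` under `T_{α,β}`: `i^{α,β}_n(x) = ⌊β·T^n(x) + α⌋`. -/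
noncomputable def code (α β : ℝ) (x : ℝ) : ℕ → ℕ :=
  fun n => (⌊β * (Tab α β)^[n] x + α⌋).toNat

/-- Unnormalized Parry density. -/
noncomputable def parryG (α β : ℝ) (x : ℝ) : ℝ :=
  ∑' n : ℕ, ((if x < (Tab α β)^[n] 1 then (1 : ℝ) else 0)
    - (if x < (Tab α β)^[n] 0 then (1 : ℝ) else 0)) / β ^ (n + 1)

/-- Normalization constant. -/
noncomputable def parryN (α β : ℝ) : ℝ := ∫ x in Set.Icc (0 : ℝ) 1, parryG α β x

/-- The Parry measure `μ_{α,β}`, absolutely continuous w.r.t. Lebesgue on `[0,1]`. -/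
noncomputable def parryMeasure (α β : ℝ) : Measure ℝ :=
  (volume.restrict (Set.Icc (0 : ℝ) 1)).withDensity
    (fun x => ENNReal.ofReal (parryG α β x / parryN α β))

/-- The orbit of `x` under `T` is `μ`-normal. -/
def IsNormalOrbit (T : ℝ → ℝ) (μ : Measure ℝ) (x : ℝ) : Prop :=
  ∀ f : ℝ → ℝ, ContinuousOn f (Set.Icc 0 1) →
    Tendsto (fun n : ℕ => (n : ℝ)⁻¹ * ∑ m ∈ Finset.range n, f (T^[m] x)) atTop
      (nhds (∫ y, f y ∂μ))

/-- Left shift on `ℕ^ℕ`. -/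
def shiftN (y : ℕ → ℕ) : ℕ → ℕ := fun n => y (n + 1)

noncomputable def dg (α β y : ℝ) (n : ℕ) : ℤ := ⌊β * (Tab α β)^[n] y + α⌋

noncomputable def sg (β : ℝ) (n : ℕ) : ℝ := ∑ i ∈ Finset.range n, β ^ i

lemma sg_succ (β : ℝ) (n : ℕ) : sg β (n+1) = β * sg β n + 1 := by
  unfold sg
  rw [Finset.sum_range_succ', Finset.mul_sum]
  simp [pow_succ, mul_comm]

lemma sg_nonneg {β : ℝ} (hβ : 1 < β) (n : ℕ) : 0 ≤ sg β n :=
  Finset.sum_nonneg fun i _ => by positivity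

lemma sg_ge_one {β : ℝ} (hβ : 1 < β) (n : ℕ) : 1 ≤ sg β (n+1) := by
  rw [sg_succ]; have := sg_nonneg hβ n; nlinarith

lemma sg_pos {β : ℝ} (hβ : 1 < β) {n : ℕ} (hn : 1 ≤ n) : 0 < sg β n := by
  obtain ⟨m, rfl⟩ : ∃ m, n = m + 1 := ⟨n - 1, by omega⟩
  linarith [sg_ge_one hβ m]

lemma sg_add_ge {β : ℝ} (hβ : 1 < β) (n m : ℕ) : β ^ m * sg β n ≤ sg β (n+m) := by
  induction m with
  | zero => simp
  | succ m ih => rw [← add_assoc, sg_succ, pow_succ]; nlinarith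

lemma T_succ (α β y : ℝ) (n : ℕ) :
    (Tab α β)^[n+1] y = β * (Tab α β)^[n] y + α - dg α β y n := by
  rw [Function.iterate_succ_apply']; unfold Tab dg; exact (Int.self_sub_floor _).symm

lemma T_mem (α β y : ℝ) (n : ℕ) (hy : y ∈ Set.Icc (0:ℝ) 1) :
    (Tab α β)^[n] y ∈ Set.Icc (0:ℝ) 1 := by
  cases n with
  | zero => exact hy
  | succ n =>
    rw [Function.iterate_succ_apply']
    exact ⟨Int.fract_nonneg _, (Int.fract_lt_one _).le⟩

lemma T_mem' (α β y : ℝ) (n : ℕ) (hy : y ∈ Set.Ico (0:ℝ) 1) :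
    (Tab α β)^[n] y ∈ Set.Ico (0:ℝ) 1 := by
  cases n with
  | zero => exact hy
  | succ n =>
    rw [Function.iterate_succ_apply']
    exact ⟨Int.fract_nonneg _, (Int.fract_lt_one _)⟩

lemma T_diff {α α' β y y' : ℝ} {n : ℕ} (h : ∀ i < n, dg α β y i = dg α' β y' i) :
    (Tab α β)^[n] y - (Tab α' β)^[n] y' = β ^ n * (y - y') + sg β n * (α - α') := by
  induction n with
  | zero => simp [sg]
  | succ n ih =>
    have h1 := ih fun i hi => h i (by omega)
    rw [T_succ, T_succ, h n (by omega), sg_succ, pow_succ]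
    linear_combination β * h1

lemma meas_T (n : ℕ) : Measurable (fun q : ℝ × ℝ × ℝ => (Tab q.1 q.2.1)^[n] q.2.2) := by
  induction n with
  | zero => exact measurable_snd.comp measurable_snd
  | succ n ih =>
    simp only [Function.iterate_succ_apply']
    unfold Tab at ih ⊢
    exact measurable_fract.comp (((measurable_fst.comp measurable_snd).mul ih).add measurable_fst)

lemma meas_Ty (α β : ℝ) (n : ℕ) : Measurable (fun y => (Tab α β)^[n] y) :=
  (meas_T n).comp (measurable_const.prodMk (measurable_const.prodMk measurable_id))

lemma cont_T {α₀ β y₀ : ℝ} {n : ℕ} (h : ∀ j < n, (Tab α₀ β)^[j+1] y₀ ≠ 0) :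
    ContinuousAt (fun q : ℝ × ℝ => (Tab q.1 β)^[n] q.2) (α₀, y₀) := by
  induction n with
  | zero => simpa using continuousAt_snd
  | succ n ih =>
    have h1 := ih fun i hi => h i (by omega)
    simp only [Function.iterate_succ_apply']
    have h2 : ContinuousAt (fun q : ℝ × ℝ => β * (Tab q.1 β)^[n] q.2 + q.1) (α₀, y₀) :=
      (continuousAt_const.mul h1).add continuousAt_fst
    have h3 := h n (by omega)
    rw [Function.iterate_succ_apply'] at h3
    have h4 : β * (Tab α₀ β)^[n] y₀ + α₀ ≠ ⌊β * (Tab α₀ β)^[n] y₀ + α₀⌋ := by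
      intro h5; apply h3; unfold Tab Int.fract at *; linarith
    exact ContinuousAt.comp (f := fun q : ℝ × ℝ => β * (Tab q.1 β)^[n] q.2 + q.1) (g := Int.fract)
      (x := (α₀, y₀)) (continuousAt_fract h4) h2

lemma dg_loc {α₀ β y₀ : ℝ} {n : ℕ} (h : ∀ j < n, (Tab α₀ β)^[j+1] y₀ ≠ 0) {i : ℕ} (hi : i < n) :
    ∀ᶠ q : ℝ × ℝ in nhds (α₀, y₀), dg q.1 β q.2 i = dg α₀ β y₀ i := by
  have h1 : ContinuousAt (fun q : ℝ × ℝ => (Tab q.1 β)^[i] q.2) (α₀, y₀) :=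
    cont_T fun j hj => h j (by omega)
  have h2 : ContinuousAt (fun q : ℝ × ℝ => β * (Tab q.1 β)^[i] q.2 + q.1) (α₀, y₀) :=
    (continuousAt_const.mul h1).add continuousAt_fst
  have h3 := h i hi
  rw [Function.iterate_succ_apply'] at h3
  have h4 : (⌊β * (Tab α₀ β)^[i] y₀ + α₀⌋ : ℝ) < β * (Tab α₀ β)^[i] y₀ + α₀ := by
    refine lt_of_le_of_ne (Int.floor_le _) ?_
    intro h5; apply h3; unfold Tab Int.fract at *; linarith
  filter_upwards [h2.eventually (Ioo_mem_nhds h4 (Int.lt_floor_add_one _))] with q hq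
  unfold dg
  rw [Int.floor_eq_iff]
  exact ⟨hq.1.le, hq.2⟩

lemma count_y {β : ℝ} (hβ : 1 < β) (α : ℝ) (n : ℕ) (z : ℝ) :
    {y : ℝ | (Tab α β)^[n] y = z}.Countable := by
  refine Set.MapsTo.countable_of_injOn (f := fun y => (fun i : Fin n => dg α β y i))
    (t := Set.univ) (fun _ _ => Set.mem_univ _) ?_ (Set.countable_univ)
  intro y hy y' hy' h
  have := T_diff (α := α) (α' := α) (β := β) (y := y) (y' := y') (n := n)
    fun i hi => congrFun h ⟨i, hi⟩
  rw [hy, hy'] at this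
  have h0 : 0 < β ^ n := by positivity
  have : β ^ n * (y - y') = 0 := by linarith
  rcases mul_eq_zero.1 this with h | h
  · exact absurd h h0.ne'
  · linarith

lemma count_a {β : ℝ} (hβ : 1 < β) (y : ℝ) (n : ℕ) (z : ℝ) :
    {α : ℝ | (Tab α β)^[n+1] y = z}.Countable := by
  refine Set.MapsTo.countable_of_injOn (f := fun α => (fun i : Fin (n+1) => dg α β y i))
    (t := Set.univ) (fun _ _ => Set.mem_univ _) ?_ (Set.countable_univ)
  intro α hy α' hy' h
  have := T_diff (α := α) (α' := α') (β := β) (y := y) (y' := y) (n := n+1)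
    fun i hi => congrFun h ⟨i, hi⟩
  rw [hy, hy'] at this
  have h0 : 0 < sg β (n+1) := by linarith [sg_ge_one hβ n]
  have : sg β (n+1) * (α - α') = 0 := by linarith
  rcases mul_eq_zero.1 this with h | h
  · exact absurd h h0.ne'
  · linarith

lemma iint {g : ℝ → ℝ} (hg : Measurable g) (hb : ∀ y, |g y| ≤ 1) (a b : ℝ) :
    IntervalIntegrable g volume a b := by
  refine (intervalIntegrable_const (c := (1:ℝ))).mono_fun hg.aestronglyMeasurable ?_
  exact Eventually.of_forall fun y => by simpa using hb y

lemma int_fract {g : ℝ → ℝ} (hg : Measurable g) (hb : ∀ y, |g y| ≤ 1) (s : ℝ) :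
    ∫ z in (0:ℝ)..s, g (Int.fract z) =
      ⌊s⌋ * (∫ z in (0:ℝ)..1, g z) + ∫ z in (0:ℝ)..Int.fract s, g z := by
  have hm : Measurable fun z => g (Int.fract z) := hg.comp measurable_fract
  have hi := iint hm (fun y => hb _)
  have hp : Function.Periodic (fun z => g (Int.fract z)) 1 := fun z => by simp
  have h1 := hp.intervalIntegral_add_zsmul_eq ⌊s⌋ 0 hi
  have h2 : ∫ z in (0:ℝ)..1, g (Int.fract z) = ∫ z in (0:ℝ)..1, g z := by
    rw [intervalIntegral.integral_of_le zero_le_one, intervalIntegral.integral_of_le zero_le_one,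
      integral_Ioc_eq_integral_Ioo, integral_Ioc_eq_integral_Ioo]
    refine setIntegral_congr_fun measurableSet_Ioo fun z hz => ?_
    rw [Int.fract_eq_self.2 ⟨hz.1.le, hz.2⟩]
  have h3 : ∫ z in (⌊s⌋:ℝ)..s, g (Int.fract z) = ∫ z in (0:ℝ)..Int.fract s, g z := by
    have h4 := intervalIntegral.integral_comp_add_right (a := 0) (b := Int.fract s)
      (fun z => g (Int.fract z)) (⌊s⌋:ℝ)
    rw [zero_add, Int.fract_add_floor] at h4
    rw [← h4]
    refine intervalIntegral.integral_congr fun z hz => ?_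
    rw [Set.uIcc_of_le (Int.fract_nonneg s)] at hz
    simp only [Int.fract_add_intCast]
    rw [Int.fract_eq_self.2 ⟨hz.1, hz.2.trans_lt (Int.fract_lt_one _)⟩]
  rw [← intervalIntegral.integral_add_adjacent_intervals (hi 0 ⌊s⌋) (hi ⌊s⌋ s), h3]
  simp only [zero_add, zsmul_eq_mul, mul_one] at h1
  rw [h1, h2]

noncomputable def II (α β : ℝ) (f : ℝ → ℝ) (j : ℕ) (t : ℝ) : ℝ :=
  ∫ y in (0:ℝ)..t, f ((Tab α β)^[j] y)

noncomputable def Dl (α β : ℝ) (f : ℝ → ℝ) (j : ℕ) (t : ℝ) : ℝ :=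
  II α β f j t - t * II α β f j 1

lemma II_succ {α β : ℝ} (hβ : 1 < β) {f : ℝ → ℝ} (hf : Measurable f) (hb : ∀ y, |f y| ≤ 1)
    (j : ℕ) (t : ℝ) : II α β f (j+1) t = t * II α β f j 1 +
      β⁻¹ * (Dl α β f j (Tab α β t) - Dl α β f j (Tab α β 0)) := by
  have hm : Measurable fun y => f ((Tab α β)^[j] y) := hf.comp (meas_Ty α β j)
  have hm' : Measurable fun y => f ((Tab α β)^[j] (Int.fract y)) := hm.comp measurable_fract
  have h1 := intervalIntegral.integral_comp_mul_add (a := 0) (b := t)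
    (fun z => f ((Tab α β)^[j] (Int.fract z))) (by positivity : β ≠ 0) α
  have h2 := int_fract hm (fun y => hb _) (β * t + α)
  have h3 := int_fract hm (fun y => hb _) (β * 0 + α)
  have h4 := intervalIntegral.integral_add_adjacent_intervals
    (iint hm' (fun y => hb _) 0 (β * 0 + α)) (iint hm' (fun y => hb _) (β * 0 + α) (β * t + α))
  have h5 : II α β f (j+1) t = ∫ (x : ℝ) in (0:ℝ)..t, f ((Tab α β)^[j] (Int.fract (β * x + α))) := by
    unfold II; simp only [Function.iterate_succ_apply]; rfl
  rw [h5, h1, smul_eq_mul]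
  have e1 : (⌊β * t + α⌋ : ℝ) = β * t + α - Tab α β t := by
    unfold Tab Int.fract; ring
  have e2 : (⌊β * 0 + α⌋ : ℝ) = β * 0 + α - Tab α β 0 := by
    unfold Tab Int.fract; ring
  have e3 : Int.fract (β * t + α) = Tab α β t := rfl
  have e4 : Int.fract (β * 0 + α) = Tab α β 0 := rfl
  rw [e1, e3] at h2
  rw [e2, e4] at h3
  unfold Dl II
  have hb0 : β ≠ 0 := by positivity
  rw [eq_sub_of_add_eq' h4, h2, h3]
  field_simp
  ring

lemma II_bd {α β : ℝ} {f : ℝ → ℝ} (hb : ∀ y, |f y| ≤ 1) (j : ℕ) (t : ℝ) : |II α β f j t| ≤ |t| := by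
  have := intervalIntegral.norm_integral_le_of_norm_le_const (a := 0) (b := t) (C := 1)
    (f := fun y => f ((Tab α β)^[j] y)) (fun x _ => hb _)
  simpa [II] using this

lemma II_bd2 {α β : ℝ} {f : ℝ → ℝ} (hf : Measurable f) (hb : ∀ y, |f y| ≤ 1) (j : ℕ) (s t : ℝ) :
    |II α β f j t - II α β f j s| ≤ |t - s| := by
  have hm : Measurable fun y => f ((Tab α β)^[j] y) := hf.comp (meas_Ty α β j)
  have h := intervalIntegral.integral_interval_sub_left (iint hm (fun y => hb _) 0 t)
    (iint hm (fun y => hb _) 0 s)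
  have := intervalIntegral.norm_integral_le_of_norm_le_const (a := s) (b := t) (C := 1)
    (f := fun y => f ((Tab α β)^[j] y)) (fun x _ => hb _)
  unfold II
  rw [h]
  simpa using this

noncomputable def Del (α β : ℝ) (f : ℝ → ℝ) (n : ℕ) (t : ℝ) : ℝ :=
  ∑ j ∈ Finset.range n, Dl α β f j t

lemma Del_succ {α β : ℝ} (hβ : 1 < β) {f : ℝ → ℝ} (hf : Measurable f) (hb : ∀ y, |f y| ≤ 1)
    (n : ℕ) (t : ℝ) : Del α β f (n+1) t = II α β f 0 t - t * II α β f n 1 +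
      β⁻¹ * (Del α β f n (Tab α β t) - Del α β f n (Tab α β 0)) := by
  unfold Del
  rw [Finset.sum_range_succ', ← Finset.sum_sub_distrib, Finset.mul_sum]
  have h : ∀ j, Dl α β f (j+1) t = -t * (II α β f (j+1) 1 - II α β f j 1) +
      β⁻¹ * (Dl α β f j (Tab α β t) - Dl α β f j (Tab α β 0)) := by
    intro j
    rw [Dl, II_succ hβ hf hb j t]; ring
  simp only [h]
  rw [Finset.sum_add_distrib, ← Finset.mul_sum, Finset.sum_range_sub (fun i => II α β f i 1)]
  unfold Dl
  ring

lemma Del_osc {α β : ℝ} (hβ : 1 < β) {f : ℝ → ℝ} (hf : Measurable f) (hb : ∀ y, |f y| ≤ 1)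
    (n : ℕ) : ∀ t ∈ Set.Icc (0:ℝ) 1, ∀ s ∈ Set.Icc (0:ℝ) 1,
      |Del α β f n t - Del α β f n s| ≤ 2 * β / (β - 1) := by
  have hβ1 : 0 < β - 1 := by linarith
  induction n with
  | zero =>
    intro t _ s _
    simp only [Del, Finset.range_zero, Finset.sum_empty, sub_zero, abs_zero]
    positivity
  | succ n ih =>
    intro t ht s hs
    have h1 := ih _ (T_mem α β t 1 ht) _ (T_mem α β s 1 hs)
    simp only [Function.iterate_one] at h1
    have h2 := II_bd2 (α := α) (β := β) hf hb 0 s t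
    have h3 := II_bd (α := α) (β := β) hb n 1
    have h4 : |t - s| ≤ 1 := by rw [abs_le]; constructor <;> linarith [ht.1, ht.2, hs.1, hs.2]
    have h5 : |(t - s) * II α β f n 1| ≤ 1 := by
      rw [abs_mul]; rw [abs_one] at h3; exact mul_le_one₀ h4 (abs_nonneg _) h3
    rw [Del_succ hβ hf hb, Del_succ hβ hf hb]
    have h6 : |β⁻¹ * (Del α β f n (Tab α β t) - Del α β f n (Tab α β s))| ≤ 2 / (β - 1) := by
      rw [abs_mul, abs_of_pos (by positivity : 0 < β⁻¹)]
      calc _ ≤ β⁻¹ * (2 * β / (β - 1)) := by gcongr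
        _ = 2 / (β - 1) := by field_simp
    have h7 : 2 * β / (β - 1) = 2 + 2 / (β - 1) := by field_simp; ring
    rw [h7]
    have h8 : |II α β f 0 t - II α β f 0 s| ≤ 1 := h2.trans h4
    rw [abs_le] at h5 h6 h8 ⊢
    constructor <;> nlinarith

lemma Del_bd {α β : ℝ} (hβ : 1 < β) {f : ℝ → ℝ} (hf : Measurable f) (hb : ∀ y, |f y| ≤ 1)
    (n : ℕ) (t : ℝ) (ht : t ∈ Set.Icc (0:ℝ) 1) : |Del α β f n t| ≤ 2 * β / (β - 1) := by
  have := Del_osc (α := α) hβ hf hb n t ht 0 ⟨le_refl _, zero_le_one⟩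
  have h0 : Del α β f n 0 = 0 := by simp [Del, Dl, II]
  rwa [h0, sub_zero] at this

noncomputable def Lam (α β : ℝ) (g : ℝ → ℝ) : ℝ :=
  ∑' i : ℕ, (g ((Tab α β)^[i] 1) - g ((Tab α β)^[i] 0)) / β ^ (i+1)

lemma hs_geo {β : ℝ} (hβ : 1 < β) : HasSum (fun i : ℕ => 1 / β ^ (i+1)) (1 / (β - 1)) := by
  have h := (hasSum_geometric_of_lt_one (r := β⁻¹) (by positivity) (inv_lt_one_of_one_lt₀ hβ)).mul_left β⁻¹
  have hβ1 : β - 1 ≠ 0 := by linarith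
  have hβ0 : β ≠ 0 := by linarith
  have e1 : (fun i : ℕ => 1 / β ^ (i+1)) = fun i => β⁻¹ * β⁻¹ ^ i := by
    ext i; rw [one_div, ← inv_pow, pow_succ, mul_comm]
  have e2 : 1 / (β - 1) = β⁻¹ * (1 - β⁻¹)⁻¹ := by
    rw [← mul_inv, mul_sub, mul_inv_cancel₀ hβ0, mul_one, one_div]
  rw [e1, e2]; exact h

lemma i1 : (1:ℝ) ∈ Set.Icc (0:ℝ) 1 := ⟨zero_le_one, le_refl _⟩
lemma i0 : (0:ℝ) ∈ Set.Icc (0:ℝ) 1 := ⟨le_refl _, zero_le_one⟩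

lemma Lam_term {α β : ℝ} (hβ : 1 < β) {g : ℝ → ℝ} {C : ℝ}
    (hg : ∀ t ∈ Set.Icc (0:ℝ) 1, ∀ s ∈ Set.Icc (0:ℝ) 1, |g t - g s| ≤ C) (i : ℕ) :
    ‖(g ((Tab α β)^[i] 1) - g ((Tab α β)^[i] 0)) / β ^ (i+1)‖ ≤ C * (1 / β ^ (i+1)) := by
  have h := hg _ (T_mem α β 1 i i1) _ (T_mem α β 0 i i0)
  have : 0 < β ^ (i+1) := by positivity
  rw [Real.norm_eq_abs, abs_div, abs_of_pos this, div_eq_mul_one_div]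
  gcongr

lemma Lam_summable {α β : ℝ} (hβ : 1 < β) {g : ℝ → ℝ} {C : ℝ}
    (hg : ∀ t ∈ Set.Icc (0:ℝ) 1, ∀ s ∈ Set.Icc (0:ℝ) 1, |g t - g s| ≤ C) :
    Summable fun i : ℕ => (g ((Tab α β)^[i] 1) - g ((Tab α β)^[i] 0)) / β ^ (i+1) :=
  Summable.of_norm_bounded ((hs_geo hβ).summable.mul_left C) (Lam_term hβ hg)

lemma Lam_bd {α β : ℝ} (hβ : 1 < β) {g : ℝ → ℝ} {C : ℝ}
    (hg : ∀ t ∈ Set.Icc (0:ℝ) 1, ∀ s ∈ Set.Icc (0:ℝ) 1, |g t - g s| ≤ C) :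
    |Lam α β g| ≤ C * (1 / (β - 1)) :=
  tsum_of_norm_bounded ((hs_geo hβ).mul_left C) (Lam_term hβ hg)

lemma II_osc {α β : ℝ} {f : ℝ → ℝ} (hf : Measurable f) (hb : ∀ y, |f y| ≤ 1) (j : ℕ) :
    ∀ t ∈ Set.Icc (0:ℝ) 1, ∀ s ∈ Set.Icc (0:ℝ) 1, |II α β f j t - II α β f j s| ≤ 1 := by
  intro t ht s hs
  refine (II_bd2 hf hb j s t).trans ?_
  rw [abs_le]; constructor <;> linarith [ht.1, ht.2, hs.1, hs.2]

lemma id_osc : ∀ t ∈ Set.Icc (0:ℝ) 1, ∀ s ∈ Set.Icc (0:ℝ) 1, |(fun x : ℝ => x) t - (fun x : ℝ => x) s| ≤ 1 := by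
  intro t ht s hs
  simp only [abs_le]; constructor <;> linarith [ht.1, ht.2, hs.1, hs.2]

lemma Dl_osc {α β : ℝ} {f : ℝ → ℝ} (hf : Measurable f) (hb : ∀ y, |f y| ≤ 1) (j : ℕ) :
    ∀ t ∈ Set.Icc (0:ℝ) 1, ∀ s ∈ Set.Icc (0:ℝ) 1, |Dl α β f j t - Dl α β f j s| ≤ 2 := by
  intro t ht s hs
  have h1 := II_osc (α := α) (β := β) hf hb j t ht s hs
  have h2 := id_osc t ht s hs
  have h3 := II_bd (α := α) (β := β) hb j 1
  rw [abs_one] at h3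
  have h4 : |(t - s) * II α β f j 1| ≤ 1 := by
    rw [abs_mul]; exact mul_le_one₀ h2 (abs_nonneg _) h3
  unfold Dl
  rw [abs_le] at h1 h4 ⊢
  constructor <;> nlinarith

lemma Lam_II {α β : ℝ} (hβ : 1 < β) {f : ℝ → ℝ} (hf : Measurable f) (hb : ∀ y, |f y| ≤ 1) (j : ℕ) :
    Lam α β (II α β f j) = II α β f j 1 * Lam α β (fun x => x) + Lam α β (Dl α β f j) := by
  unfold Lam
  rw [← tsum_mul_left, ← Summable.tsum_add ((Lam_summable hβ id_osc).mul_left _)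
    (Lam_summable hβ (Dl_osc hf hb j))]
  refine tsum_congr fun i => ?_
  unfold Dl; ring

lemma Lam_inv {α β : ℝ} (hβ : 1 < β) {f : ℝ → ℝ} (hf : Measurable f) (hb : ∀ y, |f y| ≤ 1) (j : ℕ) :
    Lam α β (II α β f (j+1)) = Lam α β (II α β f j) := by
  rw [Lam_II hβ hf hb j]
  have hs := Lam_summable (α := α) hβ (Dl_osc (α := α) (β := β) hf hb j)
  have hd := Lam_summable (α := α) hβ id_osc
  unfold Lam
  rw [hs.tsum_eq_zero_add]
  have h0 : (Dl α β f j ((Tab α β)^[0] 1) - Dl α β f j ((Tab α β)^[0] 0)) / β ^ (0+1) = 0 := by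
    simp [Dl, II]
  rw [h0, zero_add, ← tsum_mul_left, ← Summable.tsum_add (hd.mul_left _)
    ((summable_nat_add_iff 1).2 hs)]
  refine tsum_congr fun i => ?_
  rw [II_succ hβ hf hb, II_succ hβ hf hb]
  simp only [Function.iterate_succ_apply', pow_succ]
  have : β ≠ 0 := by positivity
  field_simp
  ring

lemma Lam_inv0 {α β : ℝ} (hβ : 1 < β) {f : ℝ → ℝ} (hf : Measurable f) (hb : ∀ y, |f y| ≤ 1) (j : ℕ) :
    Lam α β (II α β f j) = Lam α β (II α β f 0) := by
  induction j with
  | zero => rfl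
  | succ j ih => rw [Lam_inv hβ hf hb, ih]

lemma Lam_sum {α β : ℝ} (hβ : 1 < β) {f : ℝ → ℝ} (hf : Measurable f) (hb : ∀ y, |f y| ≤ 1) (n : ℕ) :
    |n * Lam α β (II α β f 0) - Lam α β (fun x => x) * ∑ j ∈ Finset.range n, II α β f j 1|
      ≤ 2 * β / (β - 1) * (1 / (β - 1)) := by
  have h1 : Lam α β (Del α β f n) = ∑ j ∈ Finset.range n, Lam α β (Dl α β f j) := by
    unfold Lam
    rw [← Summable.tsum_finsetSum fun j _ => Lam_summable hβ (Dl_osc hf hb j)]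
    refine tsum_congr fun i => ?_
    rw [← Finset.sum_div, Finset.sum_sub_distrib]; rfl
  have h2 : ∀ j, Lam α β (Dl α β f j) = Lam α β (II α β f 0) - Lam α β (fun x => x) * II α β f j 1 := by
    intro j
    have := Lam_II (α := α) hβ hf hb j
    rw [Lam_inv0 hβ hf hb] at this
    linarith
  have h3 := Lam_bd (α := α) hβ (Del_osc (α := α) hβ hf hb n)
  rw [h1] at h3
  simp only [h2] at h3
  rw [Finset.sum_sub_distrib, ← Finset.mul_sum] at h3
  simpa using h3

/-- density terms -/
noncomputable def phi (α β : ℝ) (n : ℕ) (x : ℝ) : ℝ := ((if x < (Tab α β)^[n] 1 then (1 : ℝ) else 0)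
    - (if x < (Tab α β)^[n] 0 then (1 : ℝ) else 0)) / β ^ (n + 1)

lemma phi_bd {α β : ℝ} (hβ : 1 < β) (n : ℕ) (x : ℝ) : |phi α β n x| ≤ 1 / β ^ (n+1) := by
  have : 0 < β ^ (n+1) := by positivity
  unfold phi
  rw [abs_div, abs_of_pos this]
  gcongr
  split_ifs <;> norm_num

lemma phi_meas (α β : ℝ) (n : ℕ) : Measurable (phi α β n) := by
  unfold phi
  refine Measurable.div_const (Measurable.sub ?_ ?_) _ <;>
  exact Measurable.ite measurableSet_Iio measurable_const measurable_const

lemma phi_summable {α β : ℝ} (hβ : 1 < β) (x : ℝ) : Summable fun n => phi α β n x :=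
  Summable.of_norm_bounded (hs_geo hβ).summable fun n => phi_bd hβ n x

lemma parryG_meas {α β : ℝ} (hβ : 1 < β) : Measurable (parryG α β) := by
  refine measurable_of_tendsto_metrizable (f := fun n x => ∑ i ∈ Finset.range n, phi α β i x)
    (fun n => Finset.measurable_sum _ fun i _ => phi_meas α β i) ?_
  rw [tendsto_pi_nhds]
  intro x
  exact (phi_summable hβ x).hasSum.tendsto_sum_nat

lemma parryG_bd {α β : ℝ} (hβ : 1 < β) (x : ℝ) : |parryG α β x| ≤ 1 / (β - 1) :=
  tsum_of_norm_bounded (f := fun n => phi α β n x) (hs_geo hβ) fun n => phi_bd hβ n x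

lemma int_ind (f : ℝ → ℝ) (α β : ℝ) {t : ℝ} (ht : t ∈ Set.Icc (0:ℝ) 1) :
    ∫ x in Set.Icc (0:ℝ) 1, f x * (if x < t then (1:ℝ) else 0) = II α β f 0 t := by
  have h1 : (fun x => f x * (if x < t then (1:ℝ) else 0)) = Set.indicator (Set.Iio t) f := by
    ext x; simp [Set.indicator]
  rw [h1, setIntegral_indicator measurableSet_Iio]
  have h2 : Set.Icc (0:ℝ) 1 ∩ Set.Iio t = Set.Ico 0 t := by
    ext x; simp only [Set.mem_inter_iff, Set.mem_Icc, Set.mem_Iio, Set.mem_Ico]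
    constructor
    · rintro ⟨⟨a, b⟩, c⟩; exact ⟨a, c⟩
    · rintro ⟨a, b⟩; exact ⟨⟨a, by linarith [ht.2]⟩, b⟩
  rw [h2, integral_Ico_eq_integral_Ioo, II, intervalIntegral.integral_of_le ht.1,
    integral_Ioc_eq_integral_Ioo]
  rfl

lemma integ_Icc {f : ℝ → ℝ} (hf : Measurable f) {C : ℝ} (hb : ∀ y, |f y| ≤ C) :
    Integrable f (volume.restrict (Set.Icc (0:ℝ) 1)) :=
  (integrable_const C).mono' hf.aestronglyMeasurable (Eventually.of_forall hb)

lemma int_parryG {α β : ℝ} (hβ : 1 < β) {f : ℝ → ℝ} (hf : Measurable f) (hb : ∀ y, |f y| ≤ 1) :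
    ∫ x in Set.Icc (0:ℝ) 1, f x * parryG α β x = Lam α β (II α β f 0) := by
  have hbd : ∀ i x, |f x * phi α β i x| ≤ 1 / β ^ (i+1) := by
    intro i x
    rw [abs_mul]
    have := phi_bd (α := α) hβ i x
    calc _ ≤ 1 * |phi α β i x| := by gcongr; exact hb x
      _ ≤ _ := by linarith
  have hint : ∀ i, Integrable (fun x => f x * phi α β i x) (volume.restrict (Set.Icc (0:ℝ) 1)) :=
    fun i => integ_Icc (hf.mul (phi_meas α β i)) (hbd i)
  have h1 : ∀ x, f x * parryG α β x = ∑' i, f x * phi α β i x := by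
    intro x; rw [tsum_mul_left]; rfl
  simp only [h1]
  rw [← integral_tsum_of_summable_integral_norm hint]
  · unfold Lam
    refine tsum_congr fun i => ?_
    rw [← int_ind f α β (T_mem α β 1 i i1), ← int_ind f α β (T_mem α β 0 i i0)]
    rw [← integral_sub, ← integral_div]
    · congr 1; ext x; unfold phi; ring
    all_goals
      refine integ_Icc (C := 1) (hf.mul (Measurable.ite measurableSet_Iio measurable_const measurable_const)) ?_
      intro y
      have := hb y
      split_ifs <;> simp [this]
  · refine Summable.of_nonneg_of_le (fun i => integral_nonneg fun x => norm_nonneg _) (fun i => ?_)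
      (hs_geo hβ).summable
    calc _ ≤ ∫ x in Set.Icc (0:ℝ) 1, 1 / β ^ (i+1) :=
          integral_mono (hint i).norm (integrable_const _) (hbd i)
      _ = _ := by simp

lemma parryN_eq {α β : ℝ} (hβ : 1 < β) : parryN α β = Lam α β (fun x => x) := by
  have := int_parryG (α := α) hβ (f := fun _ => 1) measurable_const (fun y => by simp)
  simp only [one_mul] at this
  rw [parryN, this]
  congr 1; ext t; simp [II]

lemma parryG_near {α β : ℝ} (hβ : 1 < β) : ∃ r, 0 ≤ r ∧ r < 1 ∧
    ∀ x ∈ Set.Ico r 1, 1 / (2 * β) ≤ parryG α β x := by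
  have hβ0 : 0 < β := by linarith
  obtain ⟨K, hK⟩ : ∃ K : ℕ, β⁻¹ ^ (K+1) * (1 / (β - 1)) < 1 / (2 * β) := by
    have h1 : Tendsto (fun K : ℕ => β⁻¹ ^ (K+1) * (1 / (β - 1))) atTop (nhds (0 * (1 / (β-1)))) :=
      ((tendsto_pow_atTop_nhds_zero_of_lt_one (by positivity)
        (inv_lt_one_of_one_lt₀ hβ)).comp (tendsto_add_atTop_nat 1)).mul_const _
    rw [zero_mul] at h1
    exact (h1.eventually (gt_mem_nhds (by positivity))).exists
  have hlt0 : ∀ n, (Tab α β)^[n] 0 < 1 := fun n => (T_mem' α β 0 n ⟨le_refl _, zero_lt_one⟩).2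
  have hlt1 : ∀ n, (Tab α β)^[n+1] 1 < 1 := fun n => by
    rw [Function.iterate_succ_apply']; exact Int.fract_lt_one _
  have hr : ∃ r, 0 ≤ r ∧ r < 1 ∧ (∀ n < K + 1, (Tab α β)^[n] 0 ≤ r) ∧ ∀ n < K, (Tab α β)^[n+1] 1 ≤ r := by
    have : ∀ K : ℕ, ∃ r, 0 ≤ r ∧ r < 1 ∧ (∀ n < K + 1, (Tab α β)^[n] 0 ≤ r) ∧
        ∀ n < K, (Tab α β)^[n+1] 1 ≤ r := by
      intro K
      induction K with
      | zero => exact ⟨0, le_refl _, zero_lt_one, fun n hn => by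
          have : n = 0 := by omega
          subst this; simp, fun n hn => by omega⟩
      | succ K ih =>
        obtain ⟨r, h0, h1, h2, h3⟩ := ih
        refine ⟨max r (max ((Tab α β)^[K+1] 0) ((Tab α β)^[K+1] 1)), le_max_of_le_left h0,
          max_lt h1 (max_lt (hlt0 _) (hlt1 _)), fun n hn => ?_, fun n hn => ?_⟩
        · rcases Nat.lt_succ_iff_lt_or_eq.1 hn with h | h
          · exact le_max_of_le_left (h2 n h)
          · subst h; exact le_max_of_le_right (le_max_left _ _)
        · rcases Nat.lt_succ_iff_lt_or_eq.1 hn with h | h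
          · exact le_max_of_le_left (h3 n h)
          · subst h; exact le_max_of_le_right (le_max_right _ _)
    exact this K
  obtain ⟨r, h0, h1, h2, h3⟩ := hr
  refine ⟨r, h0, h1, fun x hx => ?_⟩
  have hG : parryG α β x = ∑ i ∈ Finset.range (K+1), phi α β i x + ∑' i, phi α β (i + (K+1)) x :=
    ((phi_summable hβ x).sum_add_tsum_nat_add (K+1)).symm
  have hf : ∑ i ∈ Finset.range (K+1), phi α β i x = 1 / β := by
    rw [Finset.sum_range_succ']
    rw [Finset.sum_eq_zero]
    · have := h2 0 (by omega)
      simp only [Function.iterate_zero, id] at this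
      unfold phi
      simp [hx.2, (this.trans hx.1).not_gt]
    · intro i hi
      have hi := Finset.mem_range.1 hi
      unfold phi
      rw [if_neg ((h3 i hi).trans hx.1).not_gt, if_neg ((h2 (i+1) (by omega)).trans hx.1).not_gt]
      simp
  have ht : |∑' i, phi α β (i + (K+1)) x| ≤ β⁻¹ ^ (K+1) * (1 / (β - 1)) := by
    refine tsum_of_norm_bounded (f := fun i => phi α β (i + (K+1)) x) ((hs_geo hβ).mul_left (β⁻¹ ^ (K+1))) fun n => ?_
    refine (phi_bd hβ _ x).trans (le_of_eq ?_)
    rw [show n + (K+1) + 1 = (K+1) + (n+1) by ring, pow_add β, inv_pow]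
    field_simp
  rw [hG, hf]
  rw [abs_le] at ht
  have : 1 / β = 1 / (2 * β) + 1 / (2 * β) := by field_simp; norm_num
  linarith

lemma Lam_ne {α β : ℝ} (hβ : 1 < β) : Lam α β (fun x => x) ≠ 0 := by
  intro h0
  have hz : ∀ f : ℝ → ℝ, Measurable f → (∀ y, |f y| ≤ 1) → Lam α β (II α β f 0) = 0 := by
    intro f hf hb
    by_contra hne
    have h1 := fun n => Lam_sum (α := α) hβ hf hb n
    simp only [h0, zero_mul, sub_zero] at h1
    obtain ⟨n, hn⟩ := exists_nat_gt (2 * β / (β - 1) * (1 / (β - 1)) / |Lam α β (II α β f 0)|)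
    have h2 := h1 n
    rw [abs_mul, Nat.abs_cast] at h2
    rw [div_lt_iff₀ (abs_pos.2 hne)] at hn
    linarith
  obtain ⟨r, hr0, hr1, hr⟩ := parryG_near (α := α) hβ
  have hm : Measurable (Set.indicator (Set.Ico r 1) (fun _ => (1:ℝ))) :=
    measurable_const.indicator measurableSet_Ico
  have h1 := hz _ hm (fun y => by
    unfold Set.indicator; split_ifs <;> simp)
  rw [← int_parryG hβ hm (fun y => by
    unfold Set.indicator; split_ifs <;> simp)] at h1
  have h2 : ∀ x, Set.indicator (Set.Ico r 1) (fun _ => (1:ℝ)) x * parryG α β x =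
      Set.indicator (Set.Ico r 1) (parryG α β) x := by
    intro x; unfold Set.indicator; split_ifs <;> simp
  simp only [h2] at h1
  rw [setIntegral_indicator measurableSet_Ico] at h1
  have h3 : Set.Icc (0:ℝ) 1 ∩ Set.Ico r 1 = Set.Ico r 1 :=
    Set.inter_eq_right.2 fun x hx => ⟨hr0.trans hx.1, hx.2.le⟩
  rw [h3] at h1
  have h4 : ∫ x in Set.Ico r 1, 1 / (2 * β) ≤ ∫ x in Set.Ico r 1, parryG α β x := by
    refine setIntegral_mono_on (integrable_const _) ?_ measurableSet_Ico hr
    exact (integrable_const (1 / (β - 1))).mono' (parryG_meas hβ).aestronglyMeasurable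
      (Eventually.of_forall (parryG_bd hβ))
  rw [h1] at h4
  simp only [integral_const, smul_eq_mul] at h4
  have h5 : (volume.restrict (Set.Ico r 1)).real Set.univ = 1 - r := by
    simp [hr1.le]
  rw [h5] at h4
  have : 0 < (1 - r) * (1 / (2 * β)) := mul_pos (by linarith) (by positivity)
  linarith

/-- the limit value -/
noncomputable def cc (α β : ℝ) (f : ℝ → ℝ) : ℝ := Lam α β (II α β f 0) / Lam α β (fun x => x)

lemma cc_rate {α β : ℝ} (hβ : 1 < β) : ∃ C, ∀ f : ℝ → ℝ, Measurable f → (∀ y, |f y| ≤ 1) →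
    ∀ n : ℕ, |∑ j ∈ Finset.range n, II α β f j 1 - n * cc α β f| ≤ C := by
  refine ⟨2 * β / (β - 1) * (1 / (β - 1)) / |Lam α β (fun x => x)|, fun f hf hb n => ?_⟩
  have h := Lam_sum (α := α) hβ hf hb n
  have h0 := Lam_ne (α := α) hβ
  rw [le_div_iff₀ (abs_pos.2 h0), ← abs_mul]
  rw [abs_sub_comm] at h
  have e : (∑ j ∈ Finset.range n, II α β f j 1 - n * cc α β f) * Lam α β (fun x => x) =
    Lam α β (fun x => x) * ∑ j ∈ Finset.range n, II α β f j 1 - n * Lam α β (II α β f 0) := by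
    unfold cc
    field_simp
  rw [e]; exact h

lemma cc_rate' {α β : ℝ} (hβ : 1 < β) : ∃ C, 0 ≤ C ∧ ∀ f : ℝ → ℝ, Measurable f → (∀ y, |f y| ≤ 1) →
    ∀ n : ℕ, ∀ t ∈ Set.Icc (0:ℝ) 1,
      |∑ j ∈ Finset.range n, II α β f j t - t * (n * cc α β f)| ≤ C := by
  obtain ⟨C, hC⟩ := cc_rate (α := α) hβ
  have hC0 : 0 ≤ C := (abs_nonneg _).trans (hC (fun _ => 0) measurable_const (by simp) 0)
  have hβ1 : 0 < β - 1 := by linarith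
  refine ⟨C + 2 * β / (β - 1), by positivity, fun f hf hb n t ht => ?_⟩
  have h1 := hC f hf hb n
  have h2 := Del_bd (α := α) hβ hf hb n t ht
  have h3 : Del α β f n t = ∑ j ∈ Finset.range n, II α β f j t - t * ∑ j ∈ Finset.range n, II α β f j 1 := by
    unfold Del Dl; rw [Finset.sum_sub_distrib, Finset.mul_sum]
  have h4 : |t * (∑ j ∈ Finset.range n, II α β f j 1 - n * cc α β f)| ≤ C := by
    rw [abs_mul, abs_of_nonneg ht.1]
    nlinarith [ht.2, abs_nonneg (∑ j ∈ Finset.range n, II α β f j 1 - n * cc α β f)]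
  rw [h3] at h2
  have := abs_add_le (t * (∑ j ∈ Finset.range n, II α β f j 1 - n * cc α β f))
    (∑ j ∈ Finset.range n, II α β f j t - t * ∑ j ∈ Finset.range n, II α β f j 1)
  calc _ = |t * (∑ j ∈ Finset.range n, II α β f j 1 - n * cc α β f) +
    (∑ j ∈ Finset.range n, II α β f j t - t * ∑ j ∈ Finset.range n, II α β f j 1)| := by congr 1; ring
    _ ≤ _ := by linarith

lemma cc_lim {α β : ℝ} (hβ : 1 < β) {f : ℝ → ℝ} (hf : Measurable f) (hb : ∀ y, |f y| ≤ 1) :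
    Tendsto (fun n : ℕ => (n:ℝ)⁻¹ * ∑ j ∈ Finset.range n, II α β f j 1) atTop (nhds (cc α β f)) := by
  obtain ⟨C, hC⟩ := cc_rate (α := α) hβ
  rw [tendsto_iff_norm_sub_tendsto_zero]
  have h1 : Tendsto (fun n : ℕ => C * (n:ℝ)⁻¹) atTop (nhds (C * 0)) :=
    tendsto_const_nhds.mul tendsto_inv_atTop_nhds_zero_nat
  rw [mul_zero] at h1
  refine squeeze_zero' (Eventually.of_forall fun n => norm_nonneg _) ?_ h1
  filter_upwards [eventually_gt_atTop 0] with n hn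
  have hn' : (0:ℝ) < n := by exact_mod_cast hn
  have := hC f hf hb n
  have e : (n:ℝ)⁻¹ * ∑ j ∈ Finset.range n, II α β f j 1 - cc α β f =
    (∑ j ∈ Finset.range n, II α β f j 1 - n * cc α β f) * (n:ℝ)⁻¹ := by field_simp
  rw [e, norm_mul, Real.norm_eq_abs, norm_inv, Real.norm_natCast]
  gcongr

lemma cc_nonneg {α β : ℝ} (hβ : 1 < β) {f : ℝ → ℝ} (hf : Measurable f) (hb : ∀ y, |f y| ≤ 1)
    (h0 : ∀ y, 0 ≤ f y) : 0 ≤ cc α β f := by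
  refine ge_of_tendsto' (cc_lim hβ hf hb) fun n => ?_
  refine mul_nonneg (by positivity) (Finset.sum_nonneg fun j _ => ?_)
  exact intervalIntegral.integral_nonneg zero_le_one fun y _ => h0 _

lemma dens_nonneg {α β : ℝ} (hβ : 1 < β) :
    0 ≤ᵐ[volume.restrict (Set.Icc (0:ℝ) 1)] fun x => parryG α β x / parryN α β := by
  have hint : Integrable (fun x => parryG α β x) (volume.restrict (Set.Icc (0:ℝ) 1)) :=
    integ_Icc (parryG_meas hβ) (parryG_bd hβ)
  refine ae_nonneg_of_forall_setIntegral_nonneg (hint.div_const _) fun s hs _ => ?_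
  have hm : Measurable (Set.indicator s (fun _ => (1:ℝ))) := measurable_const.indicator hs
  have hbd : ∀ y, |Set.indicator s (fun _ => (1:ℝ)) y| ≤ 1 := fun y => by
    unfold Set.indicator; split_ifs <;> simp
  have h1 := cc_nonneg (α := α) hβ hm hbd (fun y => by unfold Set.indicator; split_ifs <;> simp)
  unfold cc at h1
  rw [← int_parryG hβ hm hbd, ← parryN_eq hβ] at h1
  have h2 : ∀ x, Set.indicator s (fun _ => (1:ℝ)) x * parryG α β x =
      Set.indicator s (parryG α β) x := by
    intro x; unfold Set.indicator; split_ifs <;> simp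
  simp only [h2] at h1
  rwa [integral_indicator hs, ← integral_div] at h1

lemma int_parry {α β : ℝ} (hβ : 1 < β) (g : ℝ → ℝ) : ∫ y, g y ∂(parryMeasure α β) =
    ∫ y in Set.Icc (0:ℝ) 1, (parryG α β y / parryN α β) * g y := by
  unfold parryMeasure
  rw [integral_withDensity_eq_integral_toReal_smul
    ((parryG_meas hβ).div_const _).ennreal_ofReal (Eventually.of_forall fun x => ENNReal.ofReal_lt_top)]
  refine integral_congr_ae ?_
  filter_upwards [dens_nonneg (α := α) hβ] with x hx
  rw [ENNReal.toReal_ofReal hx, smul_eq_mul]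

lemma int_parry_cc {α β : ℝ} (hβ : 1 < β) {f : ℝ → ℝ} (hf : Measurable f) (hb : ∀ y, |f y| ≤ 1)  :
    ∫ y, f y ∂(parryMeasure α β) = cc α β f := by
  rw [int_parry hβ, cc, ← int_parryG hβ hf hb, ← parryN_eq hβ, ← integral_div]
  congr 1; ext x; ring

lemma parry_prob {α β : ℝ} (hβ : 1 < β) : IsProbabilityMeasure (parryMeasure α β) := by
  constructor
  unfold parryMeasure
  rw [withDensity_apply _ MeasurableSet.univ, setLIntegral_univ, ← ofReal_integral_eq_lintegral_ofReal
    ((integ_Icc (parryG_meas hβ) (parryG_bd hβ)).div_const _) (dens_nonneg hβ), integral_div]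
  have : ∫ x in Set.Icc (0 : ℝ) 1, parryG α β x = parryN α β := rfl
  rw [this, div_self (by rw [parryN_eq hβ]; exact Lam_ne hβ), ENNReal.ofReal_one]

lemma parry_ae (α β : ℝ) : ∀ᵐ y ∂(parryMeasure α β), y ∈ Set.Icc (0:ℝ) 1 :=
  (withDensity_absolutelyContinuous _ _).ae_le (ae_restrict_mem measurableSet_Icc)


lemma Lam_cont {α₀ β : ℝ} (hβ : 1 < β) (h0 : ∀ j, (Tab α₀ β)^[j+1] 0 ≠ 0)
    (h1 : ∀ j, (Tab α₀ β)^[j+1] 1 ≠ 0) {g : ℝ → ℝ} (hc : Continuous g) {C : ℝ}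
    (hg : ∀ t ∈ Set.Icc (0:ℝ) 1, ∀ s ∈ Set.Icc (0:ℝ) 1, |g t - g s| ≤ C) :
    ContinuousAt (fun α => Lam α β g) α₀ := by
  have hT : ∀ (y : ℝ), (∀ j, (Tab α₀ β)^[j+1] y ≠ 0) → ∀ i,
      Tendsto (fun α => (Tab α β)^[i] y) (nhds α₀) (nhds ((Tab α₀ β)^[i] y)) := by
    intro y hy i
    have := cont_T (n := i) fun j _ => hy j
    exact ContinuousAt.comp (f := fun α : ℝ => (α, y))
      (g := fun q : ℝ × ℝ => (Tab q.1 β)^[i] q.2) (x := α₀) this (by fun_prop)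
  refine tendsto_tsum_of_dominated_convergence ((hs_geo hβ).summable.mul_left C) (fun i => ?_)
    (Eventually.of_forall fun α i => Lam_term hβ hg i)
  exact (((hc.tendsto _).comp (hT 1 h1 i)).sub ((hc.tendsto _).comp (hT 0 h0 i))).div_const _

lemma cc_cont {α₀ β : ℝ} (hβ : 1 < β) (h0 : ∀ j, (Tab α₀ β)^[j+1] 0 ≠ 0)
    (h1 : ∀ j, (Tab α₀ β)^[j+1] 1 ≠ 0) {f : ℝ → ℝ} (hf : Continuous f) (hb : ∀ y, |f y| ≤ 1) :
    ContinuousAt (fun α => cc α β f) α₀ := by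
  have hc : Continuous (II α₀ β f 0) := by
    have : II α₀ β f 0 = fun t => ∫ y in (0:ℝ)..t, f y := rfl
    rw [this]
    exact intervalIntegral.continuous_primitive (fun a b => hf.intervalIntegrable a b) 0
  have e : (fun α => cc α β f) = fun α => Lam α β (II α₀ β f 0) / Lam α β (fun x => x) := rfl
  rw [e]
  exact (Lam_cont hβ h0 h1 hc (II_osc hf.measurable hb 0)).div
    (Lam_cont hβ h0 h1 continuous_id id_osc) (Lam_ne hβ)

lemma cc_abs {α β : ℝ} (hβ : 1 < β) {f : ℝ → ℝ} (hf : Measurable f) (hb : ∀ y, |f y| ≤ 1) :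
    |cc α β f| ≤ 1 := by
  refine le_of_tendsto' (cc_lim hβ hf hb).abs fun n => ?_
  have h1 : |∑ j ∈ Finset.range n, II α β f j 1| ≤ n := by
    refine (Finset.abs_sum_le_sum_abs _ _).trans ?_
    calc _ ≤ ∑ j ∈ Finset.range n, (1:ℝ) := Finset.sum_le_sum fun j _ => by
          simpa using II_bd (α := α) (β := β) hb j 1
      _ = n := by simp
  rw [abs_mul, abs_inv, Nat.abs_cast]
  rcases Nat.eq_zero_or_pos n with rfl | hn
  · simp
  · have hn' : (0:ℝ) < n := by exact_mod_cast hn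
    rw [inv_mul_le_iff₀ hn', mul_one]; exact h1

lemma perturb {α₀ β : ℝ} (hβ : 1 < β) {f : ℝ → ℝ} (hf : Continuous f) (hb : ∀ y, |f y| ≤ 1)
    (M : ℕ) {η : ℝ} (hη : 0 < η) : ∃ ρ > 0, ∀ σ τ : ℝ, |σ| < ρ → |τ - α₀| < ρ → ∀ j < M,
      ∫ y in Set.Icc (0:ℝ) 1, |f ((Tab (σ * y + τ) β)^[j] y) - f ((Tab α₀ β)^[j] y)| < η := by
  have hj : ∀ j, ∀ᶠ p : ℝ × ℝ in nhds (0, α₀),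
      ∫ y in Set.Icc (0:ℝ) 1, |f ((Tab (p.1 * y + p.2) β)^[j] y) - f ((Tab α₀ β)^[j] y)| < η := by
    intro j
    have hm : ∀ p : ℝ × ℝ, Measurable fun y : ℝ => f ((Tab (p.1 * y + p.2) β)^[j] y) := fun p =>
      hf.measurable.comp ((meas_T j).comp (((measurable_id.const_mul _).add_const _).prodMk
        (measurable_const.prodMk measurable_id)))
    have hm0 : Measurable fun y : ℝ => f ((Tab α₀ β)^[j] y) := hf.measurable.comp (meas_Ty α₀ β j)
    have ht := tendsto_integral_filter_of_dominated_convergence (l := nhds ((0:ℝ), α₀))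
      (μ := volume.restrict (Set.Icc (0:ℝ) 1))
      (F := fun p y => |f ((Tab (p.1 * y + p.2) β)^[j] y) - f ((Tab α₀ β)^[j] y)|)
      (f := fun _ => (0:ℝ)) (fun _ => (2:ℝ))
      (Eventually.of_forall fun p => ((hm p).sub hm0).abs.aestronglyMeasurable)
      (Eventually.of_forall fun p => Eventually.of_forall fun y => by
        have h1 := hb ((Tab (p.1 * y + p.2) β)^[j] y)
        have h2 := hb ((Tab α₀ β)^[j] y)
        rw [Real.norm_eq_abs, abs_abs]
        rw [abs_le] at *
        constructor <;> linarith)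
      (integrable_const _)
      (by
        have hc : (⋃ i : ℕ, {y : ℝ | (Tab α₀ β)^[i] y = 0}).Countable :=
          Set.countable_iUnion fun i => count_y hβ α₀ i 0
        refine ae_restrict_of_ae ?_
        filter_upwards [hc.ae_notMem volume] with y hy
        simp only [Set.mem_iUnion, Set.mem_setOf_eq, not_exists] at hy
        have h1 := cont_T (n := j) fun i _ => hy (i+1)
        have h2 : ContinuousAt (fun p : ℝ × ℝ => (Tab (p.1 * y + p.2) β)^[j] y) (0, α₀) := by
          refine ContinuousAt.comp (f := fun p : ℝ × ℝ => (p.1 * y + p.2, y))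
            (g := fun q : ℝ × ℝ => (Tab q.1 β)^[j] q.2) (x := ((0:ℝ), α₀)) ?_ (by fun_prop)
          simpa using h1
        have h3 : ContinuousAt (fun p : ℝ × ℝ => |f ((Tab (p.1 * y + p.2) β)^[j] y) -
          f ((Tab α₀ β)^[j] y)|) (0, α₀) :=
          ((hf.continuousAt.comp h2).sub continuousAt_const).abs
        have h4 := h3.tendsto
        simpa using h4)
    simp only [integral_zero] at ht
    exact ht.eventually (gt_mem_nhds hη)
  have hall : ∀ᶠ p : ℝ × ℝ in nhds (0, α₀), ∀ j ∈ Finset.range M,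
      ∫ y in Set.Icc (0:ℝ) 1, |f ((Tab (p.1 * y + p.2) β)^[j] y) - f ((Tab α₀ β)^[j] y)| < η :=
    (Filter.eventually_all_finset _).2 fun j _ => hj j
  obtain ⟨ρ, hρ, h⟩ := Metric.eventually_nhds_iff.1 hall
  refine ⟨ρ, hρ, fun σ τ h1 h2 j hjM => ?_⟩
  refine h (y := (σ, τ)) ?_ j (Finset.mem_range.2 hjM)
  rw [Prod.dist_eq, Real.dist_eq, Real.dist_eq]
  simpa using ⟨h1, h2⟩

lemma block {α₀ β : ℝ} (hβ : 1 < β) : ∃ C, 0 ≤ C ∧ ∀ f : ℝ → ℝ, Continuous f → (∀ y, |f y| ≤ 1) →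
    ∀ (M : ℕ) (η : ℝ), 0 < η → ∃ ρ > 0, ∀ s a b e : ℝ, 0 < s → 1 / s < ρ → |a - α₀| < ρ → a ≤ b →
    0 ≤ s * a + e → s * b + e ≤ 1 →
    |(∫ α in a..b, ∑ j ∈ Finset.range M, f ((Tab α β)^[j] (s * α + e))) - (b - a) * (M * cc α₀ β f)|
      ≤ 1 / s * (M * η + C) := by
  obtain ⟨C, hC0, hC⟩ := cc_rate' (α := α₀) hβ
  refine ⟨2 * C, by positivity, fun f hf hb M η hη => ?_⟩
  obtain ⟨ρ, hρ, h⟩ := perturb (α₀ := α₀) hβ hf hb M hη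
  refine ⟨ρ / 2, by positivity, fun s a b e hs hsρ ha hab h0 h1 => ?_⟩
  set u := s * a + e with hu
  set v := s * b + e with hv
  have huv : u ≤ v := by rw [hu, hv]; gcongr
  have hss : s * (1 / s) = 1 := by field_simp
  have hs' : 0 < 1 / s := by positivity
  set σ := 1 / s with hσ
  set τ := -e * σ with hτ
  have hσ' : |σ| < ρ := by rw [abs_of_pos hs']; linarith
  have hτa : τ - a = - (u * σ) := by rw [hτ, hu]; linear_combination a * hss
  have hu1 : u ≤ 1 := huv.trans h1
  have hτ' : |τ - α₀| < ρ := by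
    have h2 : |u * σ| ≤ σ := by
      rw [abs_of_nonneg (mul_nonneg h0 hs'.le)]; nlinarith
    have h3 : τ - α₀ = (a - α₀) + (-(u * σ)) := by linarith
    rw [h3]
    refine (abs_add_le _ _).trans_lt ?_
    rw [abs_neg]; linarith
  have hj := h σ τ hσ' hτ'
  -- substitution
  have hmj : ∀ j, Measurable fun y : ℝ => f ((Tab (σ * y + τ) β)^[j] y) := fun j =>
      hf.measurable.comp ((meas_T j).comp (((measurable_id.const_mul _).add_const _).prodMk
        (measurable_const.prodMk measurable_id)))
  have hm0 : ∀ j, Measurable fun y : ℝ => f ((Tab α₀ β)^[j] y) := fun j =>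
    hf.measurable.comp (meas_Ty α₀ β j)
  have hsub : ∫ α in a..b, ∑ j ∈ Finset.range M, f ((Tab α β)^[j] (s * α + e)) =
      σ * ∑ j ∈ Finset.range M, ∫ y in u..v, f ((Tab (σ * y + τ) β)^[j] y) := by
    have h2 := intervalIntegral.integral_comp_mul_add (a := a) (b := b)
      (fun y => ∑ j ∈ Finset.range M, f ((Tab (σ * y + τ) β)^[j] y)) hs.ne' e
    have h3 : ∀ α, σ * (s * α + e) + τ = α := by
      intro α; rw [hτ]; linear_combination α * hss
    simp only [h3] at h2
    have h4 : s⁻¹ = σ := by rw [hσ, one_div]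
    rw [h2, smul_eq_mul, h4, ← hu, ← hv,
      intervalIntegral.integral_finsetSum fun j _ => iint (hmj j) (fun y => hb _) u v]
  have hII : ∀ j, ∫ y in u..v, f ((Tab α₀ β)^[j] y) = II α₀ β f j v - II α₀ β f j u := fun j =>
    (intervalIntegral.integral_interval_sub_left (iint (hm0 j) (fun y => hb _) 0 v)
      (iint (hm0 j) (fun y => hb _) 0 u)).symm
  have hd : ∀ j ∈ Finset.range M, |(∫ y in u..v, f ((Tab (σ * y + τ) β)^[j] y)) -
      (II α₀ β f j v - II α₀ β f j u)| ≤ η := by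
    intro j hjM
    rw [← hII, ← intervalIntegral.integral_sub (iint (hmj j) (fun y => hb _) u v)
      (iint (hm0 j) (fun y => hb _) u v)]
    refine (intervalIntegral.abs_integral_le_integral_abs huv).trans ?_
    rw [intervalIntegral.integral_of_le huv]
    refine le_trans ?_ (hj j (Finset.mem_range.1 hjM)).le
    refine setIntegral_mono_set ?_ (Eventually.of_forall fun y => abs_nonneg _) ?_
    · refine integ_Icc (C := 2) ((hmj j).sub (hm0 j)).abs fun y => ?_
      have h1 := hb ((Tab (σ * y + τ) β)^[j] y)
      have h2 := hb ((Tab α₀ β)^[j] y)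
      rw [abs_abs]
      rw [abs_le] at h1 h2 ⊢
      constructor <;> linarith
    · exact HasSubset.Subset.eventuallyLE fun y hy => ⟨h0.trans hy.1.le, hy.2.trans h1⟩
  have hsum : |(∑ j ∈ Finset.range M, ∫ y in u..v, f ((Tab (σ * y + τ) β)^[j] y)) -
      ∑ j ∈ Finset.range M, (II α₀ β f j v - II α₀ β f j u)| ≤ M * η := by
    rw [← Finset.sum_sub_distrib]
    refine (Finset.abs_sum_le_sum_abs _ _).trans ((Finset.sum_le_sum hd).trans ?_)
    simp
  have hv1 := hC f hf.measurable hb M v ⟨h0.trans huv, h1⟩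
  have hu1 := hC f hf.measurable hb M u ⟨h0, hu1⟩
  rw [Finset.sum_sub_distrib] at hsum
  rw [hsub]
  have hba : b - a = σ * (v - u) := by rw [hu, hv]; linear_combination -(b - a) * hss
  rw [hba, mul_assoc, ← mul_sub, abs_mul, abs_of_pos hs']
  refine mul_le_mul_of_nonneg_left ?_ hs'.le
  rw [abs_le] at hsum hv1 hu1 ⊢
  constructor <;> linarith


noncomputable def wd (β x : ℝ) (n : ℕ) (α : ℝ) : Fin n → ℤ := fun i => dg α β x i

def cyl (J : Set ℝ) (β x : ℝ) (n : ℕ) (w : Fin n → ℤ) : Set ℝ := {α | α ∈ J ∧ wd β x n α = w}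

noncomputable def Lw (J : Set ℝ) (β x : ℝ) (n : ℕ) (w : Fin n → ℤ) : ℝ := (volume (cyl J β x n w)).toReal

noncomputable def Vw (J : Set ℝ) (β x : ℝ) (n : ℕ) (w : Fin n → ℤ) : ℝ := (sg β n * Lw J β x n w)⁻¹

lemma wd_eq_iff {β x : ℝ} {n : ℕ} {α α' : ℝ} :
    wd β x n α = wd β x n α' ↔ ∀ i < n, dg α β x i = dg α' β x i := by
  constructor
  · intro h i hi
    exact congrFun h ⟨i, hi⟩
  · intro h; funext i; exact h i i.2

lemma wd_mono {β x : ℝ} {n N : ℕ} (hn : n ≤ N) {α α' : ℝ} (h : wd β x N α = wd β x N α') :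
    wd β x n α = wd β x n α' := by
  rw [wd_eq_iff] at h ⊢
  exact fun i hi => h i (hi.trans_le hn)

lemma wd_meas (β x : ℝ) (n : ℕ) : Measurable (wd β x n) := by
  refine measurable_pi_lambda _ fun i => ?_
  refine Int.measurable_floor.comp ?_
  refine (Measurable.const_mul ?_ _).add measurable_id
  exact (meas_T i).comp (measurable_id.prodMk (measurable_const.prodMk measurable_const))

lemma cyl_meas {J : Set ℝ} (hJ : MeasurableSet J) (β x : ℝ) (n : ℕ) (w : Fin n → ℤ) :
    MeasurableSet (cyl J β x n w) :=
  hJ.inter ((wd_meas β x n) (measurableSet_singleton w))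

lemma cyl_fin {a0 b0 β x : ℝ} {n : ℕ} (w : Fin n → ℤ) :
    volume (cyl (Set.Ioo a0 b0) β x n w) ≠ ⊤ := by
  refine ne_top_of_le_ne_top ?_ (measure_mono (fun α h => h.1))
  simp

lemma refine_le {J : Set ℝ} (hJ : MeasurableSet J) {β x : ℝ} {n N : ℕ} (hn : n ≤ N) (w : Fin n → ℤ)
    {g h : ℝ → ENNReal}
    (H : ∀ w', ∫⁻ α in cyl J β x N w', g α ≤ ∫⁻ α in cyl J β x N w', h α) :
    ∫⁻ α in cyl J β x n w, g α ≤ ∫⁻ α in cyl J β x n w, h α := by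
  have hU : cyl J β x n w = ⋃ w' : Fin N → ℤ, (cyl J β x n w ∩ cyl J β x N w') := by
    ext α; simp only [Set.mem_iUnion, Set.mem_inter_iff]
    constructor
    · intro h; exact ⟨wd β x N α, h, h.1, rfl⟩
    · rintro ⟨_, h, _⟩; exact h
  have hd : Pairwise (Function.onFun Disjoint fun w' : Fin N → ℤ => (cyl J β x n w ∩ cyl J β x N w')) := by
    intro w1 w2 h12
    refine Set.disjoint_left.2 fun α h1 h2 => h12 ?_
    rw [← h1.2.2, ← h2.2.2]
  have hm : ∀ w', MeasurableSet (cyl J β x n w ∩ cyl J β x N w') := fun w' =>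
    (cyl_meas hJ ..).inter (cyl_meas hJ ..)
  rw [hU, lintegral_iUnion hm hd, lintegral_iUnion hm hd]
  refine ENNReal.tsum_le_tsum fun w' => ?_
  rcases Set.eq_empty_or_nonempty (cyl J β x n w ∩ cyl J β x N w') with he | ⟨α, h1, h2⟩
  · rw [he]; simp
  · have : cyl J β x n w ∩ cyl J β x N w' = cyl J β x N w' := by
      refine Set.inter_eq_right.2 fun α' h' => ⟨h'.1, ?_⟩
      rw [← h1.2]; exact wd_mono hn (h'.2.trans h2.2.symm)
    rw [this]; exact H w'

lemma dg_conv {β x : ℝ} (hβ : 1 < β) {α₁ α₂ α₃ : ℝ} (h12 : α₁ ≤ α₂) (h23 : α₂ ≤ α₃) {n : ℕ}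
    (h : ∀ i < n, dg α₁ β x i = dg α₃ β x i) : ∀ i < n, dg α₂ β x i = dg α₁ β x i := by
  intro i
  induction i using Nat.strong_induction_on with
  | _ i ih =>
    intro hi
    have e1 := T_diff (α := α₂) (α' := α₁) (β := β) (y := x) (y' := x) (n := i)
      (fun j hj => ih j hj (hj.trans hi))
    have e2 := T_diff (α := α₃) (α' := α₂) (β := β) (y := x) (y' := x) (n := i)
      (fun j hj => by rw [ih j hj (hj.trans hi), h j (hj.trans hi)])
    have hs := sg_nonneg hβ i
    have hi' := h i hi
    have p1 : 0 ≤ sg β i * (α₂ - α₁) := mul_nonneg hs (by linarith)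
    have p2 : 0 ≤ sg β i * (α₃ - α₂) := mul_nonneg hs (by linarith)
    refine le_antisymm ?_ ?_
    · rw [hi']
      refine Int.floor_le_floor ?_
      nlinarith
    · refine Int.floor_le_floor ?_
      nlinarith

lemma osc_sum {β x : ℝ} (hβ : 1 < β) (hx : x ∈ Set.Ico (0:ℝ) 1) {α α' : ℝ} {n : ℕ}
    (h : ∀ i < n, dg α β x i = dg α' β x i) :
    ∑ m ∈ Finset.range n, |(Tab α β)^[m] x - (Tab α' β)^[m] x| ≤ 1 / (β - 1) := by
  have hb : 0 < β - 1 := by linarith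
  have e : ∀ m ∈ Finset.range n, |(Tab α β)^[m] x - (Tab α' β)^[m] x| ≤ (1 / (β - 1)) * (β ^ m * |α - α'|) := by
    intro m hm
    rw [T_diff fun i hi => h i (hi.trans (Finset.mem_range.1 hm))]
    have : sg β m = (β ^ m - 1) / (β - 1) := by
      rw [sg, geom_sum_eq hβ.ne']
    rw [sub_self, mul_zero, zero_add, abs_mul, abs_of_nonneg (sg_nonneg hβ m), this]
    rw [← mul_assoc]
    refine mul_le_mul_of_nonneg_right ?_ (abs_nonneg _)
    rw [div_eq_mul_one_div, mul_comm]
    gcongr; linarith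
  refine (Finset.sum_le_sum e).trans ?_
  rw [← Finset.mul_sum, ← Finset.sum_mul]
  have hn := T_diff h
  have m1 := T_mem' α β x n hx
  have m2 := T_mem' α' β x n hx
  have : sg β n * |α - α'| ≤ 1 := by
    rw [← abs_of_nonneg (sg_nonneg hβ n), ← abs_mul]
    rw [sub_self, mul_zero, zero_add] at hn
    rw [← hn, abs_le]
    constructor <;> linarith [m1.1, m1.2, m2.1, m2.2]
  have h2 : (∑ i ∈ Finset.range n, β ^ i) * |α - α'| ≤ 1 := this
  calc _ ≤ 1 / (β - 1) * 1 := by gcongr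
    _ = _ := mul_one _

lemma cyl_struct {a0 b0 β x : ℝ} (hab : a0 < b0) (hβ : 1 < β) (hx : x ∈ Set.Ico (0:ℝ) 1) {n : ℕ}
    (w : Fin n → ℤ) : ∃ a b e : ℝ, a0 ≤ a ∧ a ≤ b ∧ b ≤ b0 ∧
      Set.Ioo a b ⊆ cyl (Set.Ioo a0 b0) β x n w ∧ cyl (Set.Ioo a0 b0) β x n w ⊆ Set.Icc a b ∧
      0 ≤ sg β n * a + e ∧ sg β n * b + e ≤ 1 ∧
      ∀ α ∈ cyl (Set.Ioo a0 b0) β x n w, (Tab α β)^[n] x = sg β n * α + e := by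
  rcases Set.eq_empty_or_nonempty (cyl (Set.Ioo a0 b0) β x n w) with he | ⟨α, hα⟩
  · refine ⟨a0, a0, -(sg β n * a0), le_rfl, le_rfl, hab.le, ?_, ?_, ?_, ?_, ?_⟩ <;> simp [he]
  · set S := cyl (Set.Ioo a0 b0) β x n w with hS
    have hbb : BddBelow S := ⟨a0, fun y hy => hy.1.1.le⟩
    have hba : BddAbove S := ⟨b0, fun y hy => hy.1.2.le⟩
    have hne : S.Nonempty := ⟨α, hα⟩
    have hf : ∀ y ∈ S, (Tab y β)^[n] x = sg β n * y + ((Tab α β)^[n] x - sg β n * α) := by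
      intro y hy
      have := T_diff (wd_eq_iff.1 (hy.2.trans hα.2.symm))
      linear_combination this
    have hsp : 0 ≤ sg β n := sg_nonneg hβ n
    refine ⟨sInf S, sSup S, (Tab α β)^[n] x - sg β n * α, le_csInf hne fun y hy => hy.1.1.le,
      csInf_le_csSup hne hbb hba, csSup_le hne fun y hy => hy.1.2.le, ?_, ?_, ?_, ?_, hf⟩
    · intro y hy
      obtain ⟨u, hu, hu'⟩ := exists_lt_of_csInf_lt hne hy.1
      obtain ⟨v, hv, hv'⟩ := exists_lt_of_lt_csSup hne hy.2
      refine ⟨⟨hu.1.1.trans hu', hv'.trans hv.1.2⟩, ?_⟩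
      rw [← hu.2]
      exact wd_eq_iff.2 (dg_conv hβ hu'.le hv'.le (wd_eq_iff.1 (hu.2.trans hv.2.symm)))
    · intro y hy; exact ⟨csInf_le hbb hy, le_csSup hba hy⟩
    · rcases hsp.eq_or_lt with h0 | h0
      · rw [← h0]; simpa using (T_mem' α β x n hx).1
      · have : -((Tab α β)^[n] x - sg β n * α) / sg β n ≤ sInf S := by
          refine le_csInf hne fun y hy => ?_
          rw [div_le_iff₀ h0]
          have := (T_mem' y β x n hx).1
          rw [hf y hy] at this; linarith
        rw [div_le_iff₀ h0] at this; linarith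
    · rcases hsp.eq_or_lt with h0 | h0
      · rw [← h0]; simpa using (T_mem' α β x n hx).2.le
      · have : sSup S ≤ (1 - ((Tab α β)^[n] x - sg β n * α)) / sg β n := by
          refine csSup_le hne fun y hy => ?_
          rw [le_div_iff₀ h0]
          have := (T_mem' y β x n hx).2
          rw [hf y hy] at this; linarith
        rw [le_div_iff₀ h0] at this; linarith

lemma two_word {β x α₀ : ℝ} (hβ : 1 < β)
    (h0 : ∀ j, (Tab α₀ β)^[j+1] 0 ≠ 0) (h1 : ∀ j, (Tab α₀ β)^[j+1] 1 ≠ 0) (m : ℕ) :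
    ∃ δ > 0, ∀ n ≥ 1, ∀ α₁ α₂ α₃ : ℝ, α₁ ≤ α₂ → α₂ ≤ α₃ → |α₁ - α₀| < δ → |α₂ - α₀| < δ →
      |α₃ - α₀| < δ → sg β n * (α₃ - α₁) < δ → wd β x n α₁ = wd β x n α₃ →
      wd β x (n+m) α₁ = wd β x (n+m) α₂ ∨ wd β x (n+m) α₂ = wd β x (n+m) α₃ := by
  have key : ∀ y₀ : ℝ, (∀ j, (Tab α₀ β)^[j+1] y₀ ≠ 0) → ∃ δ > 0, ∀ α y : ℝ, |α - α₀| < δ → |y - y₀| < δ →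
      ∀ i < m, dg α β y i = dg α₀ β y₀ i := by
    intro y₀ hy
    have h : ∀ᶠ q : ℝ × ℝ in nhds (α₀, y₀), ∀ i ∈ Finset.range m, dg q.1 β q.2 i = dg α₀ β y₀ i := by
      rw [Filter.eventually_all_finset]
      intro i hi
      exact dg_loc (n := m) (fun j _ => hy j) (Finset.mem_range.1 hi)
    obtain ⟨δ, hδ, h⟩ := Metric.eventually_nhds_iff.1 h
    refine ⟨δ, hδ, fun α y ha hyy i hi => h (y := (α, y)) ?_ i (Finset.mem_range.2 hi)⟩
    rw [Prod.dist_eq, max_lt_iff]; exact ⟨ha, hyy⟩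
  obtain ⟨δ0, hδ0, H0⟩ := key 0 h0
  obtain ⟨δ1, hδ1, H1⟩ := key 1 h1
  set d := min (min δ0 δ1) 1 with hd
  have hdp : 0 < d := by positivity
  have hA : 1 ≤ β ^ m + sg β m := by
    have := one_le_pow₀ (n := m) hβ.le
    linarith [sg_nonneg hβ m]
  have hd0 : d ≤ δ0 := (min_le_left _ _).trans (min_le_left _ _)
  have hd1 : d ≤ δ1 := (min_le_left _ _).trans (min_le_right _ _)
  have hd2 : d ≤ 1 := min_le_right _ _
  have hle : d / (β ^ m + sg β m) ≤ d := div_le_self hdp.le hA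
  refine ⟨d / (β ^ m + sg β m), by positivity, fun n hn α₁ α₂ α₃ h12 h23 p1 p2 p3 hs hw => ?_⟩
  rw [lt_div_iff₀ (by linarith)] at hs
  have hw := wd_eq_iff.1 hw
  rw [wd_eq_iff, wd_eq_iff]
  by_cases hall : ∀ i < n + m, dg α₁ β x i = dg α₃ β x i
  · left; intro i hi; exact (dg_conv hβ h12 h23 hall i hi).symm
  push Not at hall
  classical
  set i := Nat.find hall with hidef
  obtain ⟨hi1, hi2⟩ := Nat.find_spec hall
  rw [← hidef] at hi1 hi2
  have hi3 : ∀ j < i, dg α₁ β x j = dg α₃ β x j := by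
    intro j hj
    have := Nat.find_min hall hj
    push Not at this
    exact this (hj.trans hi1)
  have hni : n ≤ i := by
    by_contra hc
    exact hi2 (hw i (by omega))
  have hi4 := dg_conv hβ h12 h23 hi3
  have e1 := T_diff (α := α₂) (α' := α₁) (β := β) (y := x) (y' := x) (n := i) hi4
  have e2 := T_diff (α := α₃) (α' := α₂) (β := β) (y := x) (y' := x) (n := i)
      (fun j hj => by rw [hi4 j hj, hi3 j hj])
  have hs0 := sg_nonneg hβ i
  have hsn : sg β (i + 1) ≤ (β ^ m + sg β m) * sg β n := by
    have q1 : sg β (i+1) ≤ sg β (n + m) := by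
      unfold sg
      refine Finset.sum_le_sum_of_subset_of_nonneg ?_ fun _ _ _ => by positivity
      intro j hj; rw [Finset.mem_range] at hj ⊢; omega
    have q2 : sg β (n + m) = β ^ m * sg β n + sg β m := by
      have := geom_sum_eq hβ.ne' (n + m)
      have := geom_sum_eq hβ.ne' n
      have := geom_sum_eq hβ.ne' m
      unfold sg
      simp only [geom_sum_eq hβ.ne']
      rw [pow_add]; ring
    have q3 : 1 ≤ sg β n := by
      obtain ⟨k, rfl⟩ : ∃ k, n = k + 1 := ⟨n - 1, by omega⟩
      exact sg_ge_one hβ k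
    nlinarith [sg_nonneg hβ m]
  rw [sg_succ] at hsn
  set z₁ := β * (Tab α₁ β)^[i] x + α₁ with hz1
  set z₂ := β * (Tab α₂ β)^[i] x + α₂ with hz2
  set z₃ := β * (Tab α₃ β)^[i] x + α₃ with hz3
  have g12 : z₂ - z₁ = (β * sg β i + 1) * (α₂ - α₁) := by rw [hz1, hz2]; linear_combination β * e1
  have g23 : z₃ - z₂ = (β * sg β i + 1) * (α₃ - α₂) := by rw [hz3, hz2]; linear_combination β * e2
  have hbs : 0 ≤ β * sg β i + 1 := by positivity
  have l12 : z₁ ≤ z₂ := by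
    have := mul_nonneg hbs (sub_nonneg.2 h12); linarith
  have l23 : z₂ ≤ z₃ := by
    have := mul_nonneg hbs (sub_nonneg.2 h23); linarith
  have l13 : z₃ - z₁ < d := by
    have : (β * sg β i + 1) * (α₃ - α₁) ≤ (β ^ m + sg β m) * sg β n * (α₃ - α₁) :=
      mul_le_mul_of_nonneg_right hsn (by linarith)
    nlinarith
  have t1 : (Tab α₁ β)^[i+1] x = z₁ - dg α₁ β x i := by rw [T_succ]
  have t2 : (Tab α₂ β)^[i+1] x = z₂ - dg α₂ β x i := by rw [T_succ]
  have t3 : (Tab α₃ β)^[i+1] x = z₃ - dg α₃ β x i := by rw [T_succ]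
  have f1 : dg α₁ β x i = ⌊z₁⌋ := rfl
  have f2 : dg α₂ β x i = ⌊z₂⌋ := rfl
  have f3 : dg α₃ β x i = ⌊z₃⌋ := rfl
  have u1 := Int.floor_le z₁
  have u1' := Int.lt_floor_add_one z₁
  have u2 := Int.floor_le z₂
  have u2' := Int.lt_floor_add_one z₂
  have u3 := Int.floor_le z₃
  have u3' := Int.lt_floor_add_one z₃
  have v12 := Int.floor_le_floor l12
  have v23 := Int.floor_le_floor l23
  have v13 : ⌊z₃⌋ ≤ ⌊z₁⌋ + 1 := by
    have : (⌊z₃⌋ : ℝ) < ⌊z₁⌋ + 2 := by linarith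
    have : ⌊z₃⌋ < ⌊z₁⌋ + 2 := by exact_mod_cast this
    omega
  have hne : ⌊z₁⌋ ≠ ⌊z₃⌋ := hi2
  have v13' : ⌊z₃⌋ = ⌊z₁⌋ + 1 := by omega
  have v13r : (⌊z₃⌋ : ℝ) = ⌊z₁⌋ + 1 := by exact_mod_cast v13'
  have dgadd : ∀ α j, dg α β x (i + 1 + j) = dg α β ((Tab α β)^[i+1] x) j := by
    intro α j
    unfold dg
    rw [add_comm (i+1) j, Function.iterate_add_apply]
  rcases (show ⌊z₂⌋ = ⌊z₁⌋ ∨ ⌊z₂⌋ = ⌊z₃⌋ by omega) with hc | hc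
  · left
    intro j hj
    rcases lt_trichotomy j i with h | h | h
    · exact (hi4 j h).symm
    · rw [h, f1, f2, hc]
    · obtain ⟨k, rfl⟩ : ∃ k, j = i + 1 + k := ⟨j - (i + 1), by omega⟩
      have hcr : (⌊z₂⌋ : ℝ) = ⌊z₁⌋ := by exact_mod_cast hc
      rw [dgadd, dgadd, H1 α₁ _ (by linarith) _ k (by omega), H1 α₂ _ (by linarith) _ k (by omega)]
      · rw [t2, f2, hcr, abs_lt]; constructor <;> linarith
      · rw [t1, f1, abs_lt]; constructor <;> linarith
  · right
    intro j hj
    rcases lt_trichotomy j i with h | h | h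
    · rw [hi4 j h, hi3 j h]
    · rw [h, f3, f2, hc]
    · obtain ⟨k, rfl⟩ : ∃ k, j = i + 1 + k := ⟨j - (i + 1), by omega⟩
      have hcr : (⌊z₂⌋ : ℝ) = ⌊z₃⌋ := by exact_mod_cast hc
      rw [dgadd, dgadd, H0 α₂ _ (by linarith) _ k (by omega), H0 α₃ _ (by linarith) _ k (by omega)]
      · rw [t3, f3, abs_lt]; constructor <;> linarith
      · rw [t2, f2, hcr, abs_lt]; constructor <;> linarith


lemma Lw_nonneg (J : Set ℝ) (β x : ℝ) (n : ℕ) (w : Fin n → ℤ) : 0 ≤ Lw J β x n w := ENNReal.toReal_nonneg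

lemma Vw_nonneg {J : Set ℝ} {β x : ℝ} (hβ : 1 < β) {n : ℕ} (w : Fin n → ℤ) : 0 ≤ Vw J β x n w :=
  inv_nonneg.2 (mul_nonneg (sg_nonneg hβ n) (Lw_nonneg ..))

lemma ofReal_Lw {a0 b0 β x : ℝ} {n : ℕ} (w : Fin n → ℤ) :
    ENNReal.ofReal (Lw (Set.Ioo a0 b0) β x n w) = volume (cyl (Set.Ioo a0 b0) β x n w) :=
  ENNReal.ofReal_toReal (cyl_fin w)

lemma cyl_const {J : Set ℝ} (hJ : MeasurableSet J) {β x : ℝ} {n : ℕ} (w : Fin n → ℤ) (g : (Fin n → ℤ) → ENNReal) :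
    ∫⁻ α in cyl J β x n w, g (wd β x n α) = g w * volume (cyl J β x n w) := by
  rw [setLIntegral_congr_fun (g := fun _ => g w) (cyl_meas hJ ..) (fun α hα => by
    show g (wd β x n α) = g w
    rw [hα.2])]
  simp

lemma drift_count {a0 b0 β x : ℝ} (hβ : 1 < β) {n N : ℕ} (w : Fin n → ℤ) (F : Finset (Fin N → ℤ))
    (hF : ∀ α ∈ cyl (Set.Ioo a0 b0) β x n w, wd β x N α ∈ F) :
    ∫⁻ α in cyl (Set.Ioo a0 b0) β x n w, ENNReal.ofReal (Vw (Set.Ioo a0 b0) β x N (wd β x N α))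
      ≤ ENNReal.ofReal (F.card * (1 / sg β N)) := by
  have hsub : cyl (Set.Ioo a0 b0) β x n w ⊆ ⋃ w' ∈ F, cyl (Set.Ioo a0 b0) β x N w' := by
    intro α hα
    simp only [Set.mem_iUnion]
    exact ⟨wd β x N α, hF α hα, hα.1, rfl⟩
  refine (lintegral_mono_set hsub).trans ?_
  rw [lintegral_biUnion_finset]
  · calc _ ≤ ∑ w' ∈ F, ENNReal.ofReal (1 / sg β N) := by
          refine Finset.sum_le_sum fun w' _ => ?_
          rw [cyl_const measurableSet_Ioo w' (fun w' => ENNReal.ofReal (Vw (Set.Ioo a0 b0) β x N w')),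
            ← ofReal_Lw, ← ENNReal.ofReal_mul (Vw_nonneg hβ _)]
          refine ENNReal.ofReal_le_ofReal ?_
          unfold Vw
          rw [mul_inv, mul_assoc, one_div]
          refine mul_le_of_le_one_right (inv_nonneg.2 (sg_nonneg hβ N)) ?_
          exact inv_mul_le_one
      _ = _ := by
          rw [Finset.sum_const, ENNReal.ofReal_mul (by positivity)]
          simp
  · intro w1 _ w2 _ h12
    refine Set.disjoint_left.2 fun α h1 h2 => h12 ?_
    rw [← h1.2, ← h2.2]
  · intro w' _; exact cyl_meas measurableSet_Ioo ..

lemma dg_bd {α β y : ℝ} (hβ : 1 < β) (hα : α ∈ Set.Icc (0:ℝ) 1) (hy : y ∈ Set.Icc (0:ℝ) 1) (n : ℕ) :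
    dg α β y n ∈ Finset.Icc (0:ℤ) ⌊β + 1⌋ := by
  have := T_mem α β y n hy
  rw [Finset.mem_Icc]
  constructor
  · refine Int.floor_nonneg.2 ?_
    have := mul_nonneg (zero_le_one.trans hβ.le) this.1
    linarith [hα.1]
  · refine Int.floor_le_floor ?_
    nlinarith [this.2, hα.2]

lemma words_fin {a0 b0 β x : ℝ} (hβ : 1 < β) (ha0 : 0 ≤ a0) (hb0 : b0 ≤ 1) (hx : x ∈ Set.Ico (0:ℝ) 1) (n m : ℕ)
    (w : Fin n → ℤ) : ∃ F : Finset (Fin (n+m) → ℤ),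
      (∀ w', w' ∈ F ↔ ∃ α ∈ cyl (Set.Ioo a0 b0) β x n w, wd β x (n+m) α = w') ∧
      F.card ≤ (Fintype.piFinset fun _ : Fin m => Finset.Icc (0:ℤ) ⌊β + 1⌋).card := by
  have hfin : {w' | ∃ α ∈ cyl (Set.Ioo a0 b0) β x n w, wd β x (n+m) α = w'}.Finite := by
    refine Set.Finite.subset (Finset.finite_toSet (Fintype.piFinset fun _ : Fin (n+m) => Finset.Icc (0:ℤ) ⌊β + 1⌋)) ?_
    rintro w' ⟨α, hα, rfl⟩
    rw [Finset.mem_coe, Fintype.mem_piFinset]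
    intro i
    exact dg_bd hβ ⟨ha0.trans hα.1.1.le, hα.1.2.le.trans hb0⟩ ⟨hx.1, hx.2.le⟩ i
  refine ⟨hfin.toFinset, fun w' => by simp, ?_⟩
  refine Finset.card_le_card_of_injOn (fun w' i => w' (Fin.natAdd n i)) ?_ ?_
  · intro w' hw'
    obtain ⟨α, hα, rfl⟩ := hfin.mem_toFinset.1 hw'
    rw [Finset.mem_coe, Fintype.mem_piFinset]
    intro i
    exact dg_bd hβ ⟨ha0.trans hα.1.1.le, hα.1.2.le.trans hb0⟩ ⟨hx.1, hx.2.le⟩ _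
  · intro w1 h1 w2 h2 he
    obtain ⟨α1, hα1, rfl⟩ := hfin.mem_toFinset.1 h1
    obtain ⟨α2, hα2, rfl⟩ := hfin.mem_toFinset.1 h2
    rw [wd_eq_iff]
    intro i hi
    rcases lt_or_ge i n with h | h
    · exact wd_eq_iff.1 (hα1.2.trans hα2.2.symm) i h
    · have := congrFun he ⟨i - n, by omega⟩
      simp only [wd, Fin.natAdd] at this
      rwa [show n + (i - n) = i by omega] at this

/-- one-step drift -/
lemma drift1 {β x α₀ : ℝ} (hβ : 1 < β) (hx : x ∈ Set.Ico (0:ℝ) 1)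
    (h0 : ∀ j, (Tab α₀ β)^[j+1] 0 ≠ 0) (h1 : ∀ j, (Tab α₀ β)^[j+1] 1 ≠ 0) (m : ℕ) :
    ∃ δ > 0, ∃ C > 0, ∀ a0 b0 : ℝ, 0 ≤ a0 → b0 ≤ 1 → α₀ - δ < a0 → b0 < α₀ + δ → ∀ n ≥ 1, ∀ w : Fin n → ℤ,
      ∫⁻ α in cyl (Set.Ioo a0 b0) β x n w, ENNReal.ofReal (Vw (Set.Ioo a0 b0) β x (n+m) (wd β x (n+m) α))
      ≤ ENNReal.ofReal (2 / β ^ m * Vw (Set.Ioo a0 b0) β x n w + C) * volume (cyl (Set.Ioo a0 b0) β x n w) := by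
  obtain ⟨δ, hδ, H⟩ := two_word (x := x) hβ h0 h1 m
  set Kc := (Fintype.piFinset fun _ : Fin m => Finset.Icc (0:ℤ) ⌊β + 1⌋).card with hKc
  have hpm : 0 < β ^ m := by positivity
  refine ⟨δ, hδ, (Kc + 1) / β ^ m / δ, by positivity, fun a0 b0 ha0 hb0 ha hb n hn w => ?_⟩
  obtain ⟨F, hF, hc⟩ := words_fin (x := x) hβ ha0 hb0 hx n m w
  have hdc := drift_count (x := x) (a0 := a0) (b0 := b0) hβ w F (fun α hα => (hF _).2 ⟨α, hα, rfl⟩)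
  set J := Set.Ioo a0 b0 with hJ
  have hsn := sg_pos hβ hn
  have hsn' : 0 < sg β (n + m) := sg_pos hβ (by omega)
  have hge : 1 / sg β (n + m) ≤ 1 / (β ^ m * sg β n) := 
    one_div_le_one_div_of_le (by positivity) (sg_add_ge hβ n m)
  rcases (Lw_nonneg J β x n w).eq_or_lt with hL | hL
  · have : volume (cyl J β x n w) = 0 := by rw [← ofReal_Lw, ← hL]; simp
    rw [Measure.restrict_eq_zero.2 this]; simp
  refine hdc.trans ?_
  rw [← ofReal_Lw, ← ENNReal.ofReal_mul (add_nonneg (mul_nonneg (by positivity) (Vw_nonneg hβ w)) (by positivity))]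
  refine ENNReal.ofReal_le_ofReal ?_
  rw [← hJ]
  set ℓ := Lw J β x n w with hl
  rcases lt_or_ge (sg β n * ℓ) δ with hsm | hbig
  · have hsub : ∀ α₁ ∈ cyl J β x n w, ∀ α₂ ∈ cyl J β x n w, ∀ α₃ ∈ cyl J β x n w, α₁ ≤ α₂ → α₂ ≤ α₃ →
      wd β x (n+m) α₁ = wd β x (n+m) α₂ ∨ wd β x (n+m) α₂ = wd β x (n+m) α₃ := by
      intro α₁ m1 α₂ m2 α₃ m3 h12 h23
      have hd : ∀ α ∈ cyl J β x n w, |α - α₀| < δ := by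
        intro α hα
        have := hα.1
        rw [abs_lt]; constructor <;> linarith [this.1, this.2]
      refine H n hn α₁ α₂ α₃ h12 h23 (hd _ m1) (hd _ m2) (hd _ m3) ?_ (m1.2.trans m3.2.symm)
      refine lt_of_le_of_lt ?_ hsm
      refine mul_le_mul_of_nonneg_left ?_ hsn.le
      have hI : Set.Icc α₁ α₃ ⊆ cyl J β x n w := by
        intro y hy
        refine ⟨⟨m1.1.1.trans_le hy.1, hy.2.trans_lt m3.1.2⟩, ?_⟩
        rw [← m1.2]
        exact wd_eq_iff.2 (dg_conv hβ hy.1 hy.2 (wd_eq_iff.1 (m1.2.trans m3.2.symm)))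
      have := ENNReal.toReal_mono (cyl_fin w) (measure_mono (μ := volume) hI)
      rw [Real.volume_Icc, ENNReal.toReal_ofReal (by linarith)] at this
      exact this
    have hc2 : F.card ≤ 2 := by
      by_contra hcc
      obtain ⟨w1, m1, w2, m2, w3, m3, d12, d13, d23⟩ := Finset.two_lt_card.1 (not_le.1 hcc)
      obtain ⟨α1, k1, rfl⟩ := (hF _).1 m1
      obtain ⟨α2, k2, rfl⟩ := (hF _).1 m2
      obtain ⟨α3, k3, rfl⟩ := (hF _).1 m3
      rcases le_total α1 α2 with p | p <;> rcases le_total α2 α3 with q | q <;>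
        rcases le_total α1 α3 with r | r
      · exact (hsub _ k1 _ k2 _ k3 p q).elim d12 d23
      · exact (hsub _ k1 _ k2 _ k3 p q).elim d12 d23
      · exact (hsub _ k1 _ k3 _ k2 r q).elim d13 d23.symm
      · exact (hsub _ k3 _ k1 _ k2 r p).elim d13.symm d12
      · exact (hsub _ k2 _ k1 _ k3 p r).elim d12.symm d13
      · exact (hsub _ k2 _ k3 _ k1 q r).elim d23 d13.symm
      · exact (hsub _ k3 _ k2 _ k1 q p).elim d23.symm d12.symm
      · exact (hsub _ k3 _ k2 _ k1 q p).elim d23.symm d12.symm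
    have hc2' : (F.card : ℝ) ≤ 2 := by exact_mod_cast hc2
    have e1 : Vw J β x n w * ℓ = 1 / sg β n := by
      unfold Vw; rw [← hl]; field_simp
    calc (F.card : ℝ) * (1 / sg β (n+m)) ≤ 2 * (1 / (β ^ m * sg β n)) := by gcongr
      _ = 2 / β ^ m * (Vw J β x n w * ℓ) := by rw [e1]; field_simp
      _ ≤ _ := by
        rw [add_mul, mul_assoc]
        have : 0 ≤ ((Kc:ℝ) + 1) / β ^ m / δ * ℓ := by positivity
        linarith
  · have hc' : (F.card : ℝ) ≤ Kc := by exact_mod_cast hc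
    calc (F.card : ℝ) * (1 / sg β (n+m)) ≤ (Kc + 1) * (1 / (β ^ m * sg β n)) := by
          gcongr; linarith
      _ = (Kc + 1) / β ^ m * (1 / sg β n) := by field_simp
      _ ≤ (Kc + 1) / β ^ m * (ℓ / δ) := by
          refine mul_le_mul_of_nonneg_left ?_ (by positivity)
          rw [div_le_div_iff₀ hsn hδ]; linarith
      _ = (Kc + 1) / β ^ m / δ * ℓ := by ring
      _ ≤ _ := by
        rw [add_mul]
        have := mul_nonneg (mul_nonneg (show 0 ≤ 2 / β ^ m by positivity) (Vw_nonneg (J := J) (x := x) hβ w)) hL.le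
        linarith

lemma drift {β x α₀ : ℝ} (hβ : 1 < β) (hx : x ∈ Set.Ico (0:ℝ) 1)
    (h0 : ∀ j, (Tab α₀ β)^[j+1] 0 ≠ 0) (h1 : ∀ j, (Tab α₀ β)^[j+1] 1 ≠ 0) :
    ∃ m ≥ 1, ∃ δ > 0, ∃ C > 0, ∀ a0 b0 : ℝ, 0 ≤ a0 → b0 ≤ 1 → α₀ - δ < a0 → b0 < α₀ + δ →
      ∀ q, ∀ n ≥ 1, ∀ w : Fin n → ℤ,
      ∫⁻ α in cyl (Set.Ioo a0 b0) β x n w, ENNReal.ofReal (Vw (Set.Ioo a0 b0) β x (n+q*m) (wd β x (n+q*m) α))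
      ≤ ENNReal.ofReal ((1/2) ^ q * Vw (Set.Ioo a0 b0) β x n w + C) * volume (cyl (Set.Ioo a0 b0) β x n w) := by
  obtain ⟨m, hm⟩ := pow_unbounded_of_one_lt 4 hβ
  obtain ⟨δ, hδ, C, hC, H⟩ := drift1 hβ hx h0 h1 m
  have hm1 : 1 ≤ m := by
    rcases Nat.eq_zero_or_pos m with h | h
    · rw [h] at hm; norm_num at hm
    · exact h
  refine ⟨m, hm1, δ, hδ, 2 * C, by positivity, fun a0 b0 ha0 hb0 ha hb q => ?_⟩
  have hθ : 2 / β ^ m ≤ 1 / 2 := by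
    rw [div_le_div_iff₀ (by positivity) (by norm_num)]; linarith
  set J := Set.Ioo a0 b0 with hJ
  induction q with
  | zero =>
    intro n hn w
    have e0 : n + 0 * m = n := by omega
    rw [e0]
    rw [cyl_const measurableSet_Ioo w (fun w' => ENNReal.ofReal (Vw J β x n w'))]
    refine mul_le_mul_left ?_ _
    refine ENNReal.ofReal_le_ofReal ?_
    rw [pow_zero, one_mul]; linarith
  | succ q ih =>
    intro n hn w
    have e : n + (q + 1) * m = (n + q * m) + m := by ring
    rw [e]
    have step := refine_le (J := J) (β := β) (x := x) measurableSet_Ioo (show n ≤ n + q * m by omega) w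
      (g := fun α => ENNReal.ofReal (Vw J β x (n+q*m+m) (wd β x (n+q*m+m) α)))
      (h := fun α => ENNReal.ofReal ((1/2) * Vw J β x (n+q*m) (wd β x (n+q*m) α) + C)) (fun w' => by
        rw [cyl_const measurableSet_Ioo w' (fun w' => ENNReal.ofReal ((1/2) * Vw J β x (n+q*m) w' + C))]
        refine (H a0 b0 ha0 hb0 ha hb (n+q*m) (by omega) w').trans ?_
        gcongr
        exact Vw_nonneg hβ _)
    refine step.trans ?_
    have e2 : ∀ α, ENNReal.ofReal ((1/2) * Vw J β x (n+q*m) (wd β x (n+q*m) α) + C) =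
        ENNReal.ofReal (1/2) * ENNReal.ofReal (Vw J β x (n+q*m) (wd β x (n+q*m) α)) + ENNReal.ofReal C := by
      intro α
      rw [ENNReal.ofReal_add (mul_nonneg (by norm_num) (Vw_nonneg hβ _)) hC.le, ENNReal.ofReal_mul (by norm_num)]
    simp only [e2]
    rw [lintegral_add_right _ measurable_const, lintegral_const_mul' _ _ ENNReal.ofReal_ne_top, setLIntegral_const]
    calc _ ≤ ENNReal.ofReal (1/2) * (ENNReal.ofReal ((1/2) ^ q * Vw J β x n w + 2 * C) * volume (cyl J β x n w))
            + ENNReal.ofReal C * volume (cyl J β x n w) := by gcongr; exact ih n hn w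
      _ = _ := by
        have hV := Vw_nonneg (J := J) (x := x) hβ w
        rw [← mul_assoc, ← add_mul, ← ENNReal.ofReal_mul (by norm_num), ← ENNReal.ofReal_add (by positivity) hC.le]
        congr 2; ring


noncomputable def rp (J : Set ℝ) (β x : ℝ) (N : ℕ) (w : Fin N → ℤ) : ℝ := by
  classical
  exact if h : (cyl J β x N w).Nonempty then h.some else 0

lemma rp_mem {J : Set ℝ} {β x : ℝ} {N : ℕ} {w : Fin N → ℤ} (h : (cyl J β x N w).Nonempty) :
    rp J β x N w ∈ cyl J β x N w := by
  unfold rp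
  rw [dif_pos h]; exact h.some_mem

noncomputable def av (β x : ℝ) (f : ℝ → ℝ) (n M : ℕ) (α : ℝ) : ℝ :=
  (M:ℝ)⁻¹ * ∑ j ∈ Finset.range M, f ((Tab α β)^[n+j] x)

lemma av_bd {β x : ℝ} {f : ℝ → ℝ} (hb : ∀ y, |f y| ≤ 1) (n : ℕ) {M : ℕ} (hM : 1 ≤ M) (α : ℝ) :
    |av β x f n M α| ≤ 1 := by
  unfold av
  have hM' : (0:ℝ) < M := by exact_mod_cast hM
  rw [abs_mul, abs_of_pos (inv_pos.2 hM'), inv_mul_le_iff₀ hM', mul_one]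
  refine (Finset.abs_sum_le_sum_abs _ _).trans ((Finset.sum_le_sum fun j _ => hb _).trans ?_)
  simp

lemma av_meas {β x : ℝ} {f : ℝ → ℝ} (hf : Continuous f) (n M : ℕ) : Measurable (av β x f n M) := by
  unfold av
  refine Measurable.const_mul (Finset.measurable_sum _ fun j _ => ?_) _
  exact hf.measurable.comp ((meas_T (n+j)).comp (measurable_id.prodMk (measurable_const.prodMk measurable_const)))

lemma av_close {β x : ℝ} (hβ : 1 < β) (hx : x ∈ Set.Ico (0:ℝ) 1) {f : ℝ → ℝ} {K : ℝ} (hK : 0 ≤ K)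
    (hl : ∀ y z, |f y - f z| ≤ K * |y - z|) (n : ℕ) {M : ℕ} (hM : 1 ≤ M) {α α' : ℝ}
    (h : wd β x (n+M) α = wd β x (n+M) α') :
    |av β x f n M α - av β x f n M α'| ≤ K / (β - 1) / M := by
  unfold av
  have hM' : (0:ℝ) < M := by exact_mod_cast hM
  rw [← mul_sub, ← Finset.sum_sub_distrib, abs_mul, abs_of_pos (inv_pos.2 hM'), inv_mul_eq_div]
  refine div_le_div_of_nonneg_right ?_ hM'.le
  refine (Finset.abs_sum_le_sum_abs _ _).trans ((Finset.sum_le_sum fun j _ => hl _ _).trans ?_)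
  rw [← Finset.mul_sum, div_eq_mul_one_div]
  refine mul_le_mul_of_nonneg_left ?_ hK
  refine le_trans ?_ (osc_sum hβ hx (wd_eq_iff.1 h))
  rw [Finset.sum_range_add]
  have : 0 ≤ ∑ m ∈ Finset.range n, |(Tab α β)^[m] x - (Tab α' β)^[m] x| :=
    Finset.sum_nonneg fun _ _ => abs_nonneg _
  linarith

lemma av_int {α₀ β x a0 b0 : ℝ} (hβ : 1 < β) (hx : x ∈ Set.Ico (0:ℝ) 1) (hab : a0 < b0) {f : ℝ → ℝ}
    {M n : ℕ} (hM : 1 ≤ M) (hn : 1 ≤ n) {η C ρ c : ℝ}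
    (hB : ∀ s a b e : ℝ, 0 < s → 1 / s < ρ → |a - α₀| < ρ → a ≤ b →
    0 ≤ s * a + e → s * b + e ≤ 1 →
    |(∫ α in a..b, ∑ j ∈ Finset.range M, f ((Tab α β)^[j] (s * α + e))) - (b - a) * (M * c)|
      ≤ 1 / s * (M * η + C)) (ha : α₀ - ρ < a0) (hb0 : b0 < α₀ + ρ) (hs : 1 / sg β n < ρ) (w : Fin n → ℤ) :
    ∫ α in cyl (Set.Ioo a0 b0) β x n w, av β x f n M α ≤
      Lw (Set.Ioo a0 b0) β x n w * c + 1 / sg β n * (η + C / M) := by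
  obtain ⟨a, b, e, h1, h2, h3, h4, h5, h6, h7, h8⟩ := cyl_struct (x := x) hab hβ hx w
  have hM' : (0:ℝ) < M := by exact_mod_cast hM
  have hH := hB (sg β n) a b e (sg_pos hβ hn) hs (by rw [abs_lt]; constructor <;> linarith) h2 h6 h7
  have hae : cyl (Set.Ioo a0 b0) β x n w =ᵐ[volume] Set.Ioc a b := by
    refine EventuallyLE.antisymm ?_ ?_
    · exact (LE.le.eventuallyLE h5).trans Ioc_ae_eq_Icc.symm.le
    · exact Ioo_ae_eq_Ioc.symm.le.trans (LE.le.eventuallyLE h4)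
  have hvol : Lw (Set.Ioo a0 b0) β x n w = b - a := by
    unfold Lw
    rw [measure_congr hae, Real.volume_Ioc, ENNReal.toReal_ofReal (by linarith)]
  have hint : ∫ α in cyl (Set.Ioo a0 b0) β x n w, av β x f n M α =
      (M:ℝ)⁻¹ * ∫ α in a..b, ∑ j ∈ Finset.range M, f ((Tab α β)^[j] (sg β n * α + e)) := by
    rw [setIntegral_congr_fun (g := fun α => (M:ℝ)⁻¹ * ∑ j ∈ Finset.range M, f ((Tab α β)^[j] (sg β n * α + e)))
      (cyl_meas measurableSet_Ioo ..)]
    · rw [setIntegral_congr_set hae, integral_const_mul, intervalIntegral.integral_of_le h2]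
    · intro α hα
      simp only [av]
      congr 1
      refine Finset.sum_congr rfl fun j _ => ?_
      rw [add_comm n j, Function.iterate_add_apply, h8 α hα]
  rw [hint, hvol]
  have := (abs_le.1 hH).2
  rw [inv_mul_le_iff₀ hM']
  have e1 : (M:ℝ) * ((b - a) * c + 1 / sg β n * (η + C / M)) = (b-a) * (M * c) + 1 / sg β n * (M * η + C) := by
    field_simp
  rw [e1]; linarith

lemma key_step {α₀ β x a0 b0 : ℝ} (hβ : 1 < β) (hx : x ∈ Set.Ico (0:ℝ) 1) (hab : a0 < b0) {f : ℝ → ℝ}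
    (hf : Continuous f) (hb : ∀ y, |f y| ≤ 1) {K : ℝ} (hK : 0 ≤ K)
    (hl : ∀ y z, |f y - f z| ≤ K * |y - z|) {M n : ℕ} (hM : 1 ≤ M) (hn : 1 ≤ n) {η C Cb ρ c ε t κ : ℝ}
    (hB : ∀ s a b e : ℝ, 0 < s → 1 / s < ρ → |a - α₀| < ρ → a ≤ b →
    0 ≤ s * a + e → s * b + e ≤ 1 →
    |(∫ α in a..b, ∑ j ∈ Finset.range M, f ((Tab α β)^[j] (s * α + e))) - (b - a) * (M * c)|
      ≤ 1 / s * (M * η + Cb)) (ha : α₀ - ρ < a0) (hb0 : b0 < α₀ + ρ) (hs : 1 / sg β n < ρ)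
    (hε : 0 < ε) (hε1 : ε ≤ 1) (ht : t = ε / 36) (hC : 0 < C) (hκ : κ = t * ε / (8 * C)) (hc : |c| ≤ 1)
    (hKM : K / (β - 1) / M ≤ ε / 4) (hR : (2 + 4 * κ * C) / κ * (η + Cb / M) ≤ ε / 4)
    (hηC : 0 ≤ η + Cb / M) (w : Fin n → ℤ)
    (hD : ∫⁻ α in cyl (Set.Ioo a0 b0) β x n w, ENNReal.ofReal (Vw (Set.Ioo a0 b0) β x (n+M) (wd β x (n+M) α))
      ≤ ENNReal.ofReal (1/4 * Vw (Set.Ioo a0 b0) β x n w + C) * volume (cyl (Set.Ioo a0 b0) β x n w)) :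
    ∫⁻ α in cyl (Set.Ioo a0 b0) β x n w,
      ENNReal.ofReal ((1 + κ * Vw (Set.Ioo a0 b0) β x (n+M) (wd β x (n+M) α)) *
        Real.exp (t * (av β x f n M (rp (Set.Ioo a0 b0) β x (n+M) (wd β x (n+M) α)) - c - ε)))
      ≤ ENNReal.ofReal (1 + κ * Vw (Set.Ioo a0 b0) β x n w) * volume (cyl (Set.Ioo a0 b0) β x n w) := by
  have hInt := av_int (x := x) hβ hx hab hM hn hB ha hb0 hs w
  set J := Set.Ioo a0 b0 with hJ
  have ht0 : 0 < t := by rw [ht]; positivity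
  have hκ0 : 0 < κ := by rw [hκ]; positivity
  have ht1 : t ≤ 1/36 := by rw [ht]; linarith
  have hκC : 2 * κ * C = t * ε / 4 := by rw [hκ]; field_simp; norm_num
  have hV := Vw_nonneg (J := J) (x := x) hβ w
  rcases (Lw_nonneg J β x n w).eq_or_lt with hL | hL
  · have : volume (cyl J β x n w) = 0 := by rw [← ofReal_Lw, ← hL]; simp
    rw [Measure.restrict_eq_zero.2 this]; simp
  have hVL : Vw J β x n w * Lw J β x n w = 1 / sg β n := by
    have := sg_pos hβ hn
    unfold Vw; field_simp
  have hY3 : ∀ α, |av β x f n M α - c - ε| ≤ 3 := by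
    intro α
    have h1 := abs_le.1 (av_bd (β := β) (x := x) hb n hM α)
    have h2 := abs_le.1 hc
    rw [abs_le]; constructor <;> linarith [h1.1, h1.2, h2.1, h2.2]
  have hexp : ∀ y, |y| ≤ 3 → Real.exp (t * y) ≤ 1 + t * y + 9 * t ^ 2 ∧ Real.exp (t * y) ≤ 2 := by
    intro y hy
    have hty : |t * y| ≤ t * 3 := by
      rw [abs_mul, abs_of_pos ht0]; gcongr
    have h1 := Real.abs_exp_sub_one_sub_id_le (x := t * y) (by linarith)
    have h2 : (t * y) ^ 2 ≤ 9 * t ^ 2 := by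
      have := sq_le_sq' (by linarith [(abs_le.1 hty).1]) (abs_le.1 hty).2
      linarith
    have h3 := (abs_le.1 h1).2
    refine ⟨by linarith, ?_⟩
    have := (abs_le.1 hty).2
    nlinarith
  -- second part bound
  have hD2 : ENNReal.ofReal (2 * κ) * ∫⁻ α in cyl J β x n w, ENNReal.ofReal (Vw J β x (n+M) (wd β x (n+M) α))
      ≤ ENNReal.ofReal (2 * κ * (1/4 * Vw J β x n w + C) * Lw J β x n w) := by
    refine (mul_le_mul_right hD _).trans ?_
    rw [← ofReal_Lw, ← ENNReal.ofReal_mul (by positivity), ← ENNReal.ofReal_mul (by positivity), ← mul_assoc]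
  rcases le_or_gt (Vw J β x n w) ((2 + 4 * κ * C) / κ) with hVR | hVR
  · set G : ℝ → ℝ := fun α => 1 + t * (av β x f n M α - c - 3 / 4 * ε) + 9 * t ^ 2 with hG
    have hpt : ∀ α ∈ cyl J β x n w, ENNReal.ofReal ((1 + κ * Vw J β x (n+M) (wd β x (n+M) α)) *
        Real.exp (t * (av β x f n M (rp J β x (n+M) (wd β x (n+M) α)) - c - ε))) ≤
        ENNReal.ofReal (G α) + ENNReal.ofReal (2 * κ) * ENNReal.ofReal (Vw J β x (n+M) (wd β x (n+M) α)) := by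
      intro α hα
      have hV' := Vw_nonneg (J := J) (x := x) hβ (wd β x (n+M) α)
      rw [← ENNReal.ofReal_mul (by positivity)]
      refine le_trans ?_ ENNReal.ofReal_add_le
      refine ENNReal.ofReal_le_ofReal ?_
      have hmem : α ∈ cyl J β x (n+M) (wd β x (n+M) α) := ⟨hα.1, rfl⟩
      have hr := rp_mem ⟨α, hmem⟩
      have hcl := (abs_le.1 ((av_close hβ hx hK hl n hM hr.2).trans hKM)).2
      obtain ⟨k1, k2⟩ := hexp _ (hY3 (rp J β x (n+M) (wd β x (n+M) α)))
      set Y := av β x f n M (rp J β x (n+M) (wd β x (n+M) α)) - c - ε with hY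
      have : t * Y ≤ t * (av β x f n M α - c - 3 / 4 * ε) := by
        refine mul_le_mul_of_nonneg_left ?_ ht0.le
        rw [hY]; linarith
      have h3 := mul_le_mul_of_nonneg_left k2 (mul_nonneg hκ0.le hV')
      rw [hG]; dsimp only
      rw [add_mul, one_mul]
      linarith
    refine (setLIntegral_mono' (cyl_meas measurableSet_Ioo ..) hpt).trans ?_
    have hGm : Measurable G := by
      have := av_meas (β := β) (x := x) hf n M
      rw [hG]; fun_prop
    rw [lintegral_add_left hGm.ennreal_ofReal, lintegral_const_mul' _ _ ENNReal.ofReal_ne_top]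
    have hG0 : ∀ α, 0 ≤ G α := by
      intro α
      have h1 := (abs_le.1 (hY3 α)).1
      have h2 : t * (-3) ≤ t * (av β x f n M α - c - 3 / 4 * ε) := by
        refine mul_le_mul_of_nonneg_left ?_ ht0.le
        linarith
      rw [hG]; dsimp only
      nlinarith [sq_nonneg t]
    have hfinm : IsFiniteMeasure (volume.restrict (cyl J β x n w)) := ⟨by
      rw [Measure.restrict_apply_univ]; exact (cyl_fin w).lt_top⟩
    have hai : Integrable (av β x f n M) (volume.restrict (cyl J β x n w)) := by
      refine Integrable.of_bound (av_meas hf n M).aestronglyMeasurable 1 (Eventually.of_forall fun α => ?_)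
      exact av_bd hb n hM α
    have hGe : G = fun α => t * av β x f n M α + (1 - t * (c + 3 / 4 * ε) + 9 * t ^ 2) := by
      funext α; rw [hG]; ring
    have hGi : Integrable G (volume.restrict (cyl J β x n w)) := by
      rw [hGe]; exact (hai.const_mul t).add (integrable_const _)
    have hGI : ∫ α in cyl J β x n w, G α = t * (∫ α in cyl J β x n w, av β x f n M α) +
        Lw J β x n w * (1 - t * (c + 3 / 4 * ε) + 9 * t ^ 2) := by
      rw [hGe, integral_add (hai.const_mul t) (integrable_const _), integral_const_mul, setIntegral_const]
      rfl
    rw [← ofReal_integral_eq_lintegral_ofReal hGi (Eventually.of_forall hG0)]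
    have hGI0 : 0 ≤ ∫ α in cyl J β x n w, G α := integral_nonneg hG0
    refine (add_le_add le_rfl hD2).trans ?_
    rw [← ofReal_Lw, ← ENNReal.ofReal_add hGI0 (by positivity), ← ENNReal.ofReal_mul (by positivity)]
    refine ENNReal.ofReal_le_ofReal ?_
    rw [hGI, ← hJ]
    set ℓ := Lw J β x n w with hℓ
    have b1 : 1 / sg β n * (η + Cb / M) ≤ ℓ * (ε / 4) := by
      rw [← hVL]
      calc Vw J β x n w * ℓ * (η + Cb / M) = ℓ * (Vw J β x n w * (η + Cb / M)) := by ring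
        _ ≤ ℓ * ((2 + 4 * κ * C) / κ * (η + Cb / M)) := by gcongr
        _ ≤ _ := by gcongr
    have b2 : t * (∫ α in cyl J β x n w, av β x f n M α) ≤ t * (ℓ * c + ℓ * (ε / 4)) := by
      gcongr; linarith
    have b3 : ℓ * (9 * t ^ 2) = ℓ * (t * ε / 4) := by rw [ht]; ring
    have b4 : 2 * κ * C * ℓ = t * ε / 4 * ℓ := by rw [hκC]
    have b5 : 0 ≤ κ * Vw J β x n w * ℓ := by positivity
    nlinarith
  · have hpt : ∀ α ∈ cyl J β x n w, ENNReal.ofReal ((1 + κ * Vw J β x (n+M) (wd β x (n+M) α)) *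
        Real.exp (t * (av β x f n M (rp J β x (n+M) (wd β x (n+M) α)) - c - ε))) ≤
        ENNReal.ofReal 2 + ENNReal.ofReal (2 * κ) * ENNReal.ofReal (Vw J β x (n+M) (wd β x (n+M) α)) := by
      intro α hα
      have hV' := Vw_nonneg (J := J) (x := x) hβ (wd β x (n+M) α)
      rw [← ENNReal.ofReal_mul (by positivity)]
      refine le_trans ?_ ENNReal.ofReal_add_le
      refine ENNReal.ofReal_le_ofReal ?_
      obtain ⟨k1, k2⟩ := hexp _ (hY3 (rp J β x (n+M) (wd β x (n+M) α)))
      have h3 := mul_le_mul_of_nonneg_left k2 (mul_nonneg hκ0.le hV')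
      rw [add_mul, one_mul]
      linarith
    refine (setLIntegral_mono' (cyl_meas measurableSet_Ioo ..) hpt).trans ?_
    rw [lintegral_add_left measurable_const, lintegral_const_mul' _ _ ENNReal.ofReal_ne_top, setLIntegral_const]
    refine (add_le_add le_rfl hD2).trans ?_
    rw [← ofReal_Lw, ← ENNReal.ofReal_mul (by positivity), ← ENNReal.ofReal_mul (by positivity), 
      ← ENNReal.ofReal_add (by positivity) (by positivity)]
    refine ENNReal.ofReal_le_ofReal ?_
    rw [← hJ]
    set ℓ := Lw J β x n w with hℓ
    rw [div_lt_iff₀ hκ0] at hVR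
    rw [← add_mul]
    refine mul_le_mul_of_nonneg_right ?_ hL.le
    nlinarith


lemma sg_ge_n {β : ℝ} (hβ : 1 < β) (n : ℕ) : (n:ℝ) ≤ sg β n := by
  unfold sg
  calc (n:ℝ) = ∑ i ∈ Finset.range n, (1:ℝ) := by simp
    _ ≤ _ := Finset.sum_le_sum fun i _ => one_le_pow₀ hβ.le

lemma key {α₀ β x : ℝ} (hβ : 1 < β) (hx : x ∈ Set.Ico (0:ℝ) 1)
    (h0 : ∀ j, (Tab α₀ β)^[j+1] 0 ≠ 0) (h1 : ∀ j, (Tab α₀ β)^[j+1] 1 ≠ 0) {f : ℝ → ℝ}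
    (hf : Continuous f) (hb : ∀ y, |f y| ≤ 1) {K : ℝ} (hK : 0 ≤ K)
    (hl : ∀ y z, |f y - f z| ≤ K * |y - z|) {ε : ℝ} (hε : 0 < ε) (hε1 : ε ≤ 1) :
    ∃ M ≥ 1, ∃ κ > 0, ∃ t > 0, ∃ δ > 0, ∃ n0 ≥ 1, K / (β - 1) / (M:ℕ) ≤ ε / 4 ∧
    ∀ a0 b0 : ℝ, a0 < b0 → 0 ≤ a0 → b0 ≤ 1 → α₀ - δ < a0 → b0 < α₀ + δ → ∀ n ≥ n0, ∀ w : Fin n → ℤ,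
    ∫⁻ α in cyl (Set.Ioo a0 b0) β x n w,
      ENNReal.ofReal ((1 + κ * Vw (Set.Ioo a0 b0) β x (n+M) (wd β x (n+M) α)) *
        Real.exp (t * (av β x f n M (rp (Set.Ioo a0 b0) β x (n+M) (wd β x (n+M) α)) - cc α₀ β f - ε)))
      ≤ ENNReal.ofReal (1 + κ * Vw (Set.Ioo a0 b0) β x n w) * volume (cyl (Set.Ioo a0 b0) β x n w) := by
  obtain ⟨m, hm, δ, hδ, C, hC, hD⟩ := drift hβ hx h0 h1
  obtain ⟨Cb, hCb, hB⟩ := block (α₀ := α₀) hβ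
  have hβ1 : 0 < β - 1 := by linarith
  set t := ε / 36 with ht
  have ht0 : 0 < t := by positivity
  set κ := t * ε / (8 * C) with hκ
  have hκ0 : 0 < κ := by positivity
  set R := (2 + 4 * κ * C) / κ with hR
  have hR0 : 0 < R := by positivity
  set q := 2 + ⌈8 * R * Cb / ε⌉₊ + ⌈4 * K / ((β - 1) * ε)⌉₊ with hq
  have hq1 : 8 * R * Cb / ε ≤ q := by
    have := Nat.le_ceil (8 * R * Cb / ε)
    rw [hq]; push_cast
    have h2 : (0:ℝ) ≤ (⌈4 * K / ((β - 1) * ε)⌉₊ : ℝ) := by positivity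
    linarith
  have hq2 : 4 * K / ((β - 1) * ε) ≤ q := by
    have := Nat.le_ceil (4 * K / ((β - 1) * ε))
    rw [hq]; push_cast
    have h2 : (0:ℝ) ≤ (⌈8 * R * Cb / ε⌉₊ : ℝ) := by positivity
    linarith
  have hq3 : 2 ≤ q := by omega
  have hqM : q ≤ q * m := Nat.le_mul_of_pos_right _ hm
  have hqM' : (q:ℝ) ≤ ((q * m : ℕ) : ℝ) := by exact_mod_cast hqM
  have hM0 : (0:ℝ) < ((q * m : ℕ) : ℝ) := by
    have : 0 < q * m := by omega
    exact_mod_cast this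
  have hη : 0 < ε / (8 * R) := by positivity
  obtain ⟨ρ, hρ, hB⟩ := hB f hf hb (q * m) (ε / (8 * R)) hη
  have hKM : K / (β - 1) / ((q * m : ℕ) : ℝ) ≤ ε / 4 := by
    have := hq2.trans hqM'
    rw [div_le_iff₀ (by positivity)] at this
    rw [div_div, div_le_div_iff₀ (by positivity) (by norm_num)]
    linarith
  refine ⟨q * m, by omega, κ, hκ0, t, ht0, min δ ρ, by positivity, ⌈1 / ρ⌉₊ + 1, by omega, hKM, 
    fun a0 b0 hab ha0 hb0 ha hb' n hn w => ?_⟩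
  have hn1 : 1 ≤ n := by omega
  have hs : 1 / sg β n < ρ := by
    have h3 : 1 / ρ < n := by
      have := Nat.le_ceil (1 / ρ)
      have h4 : ((⌈1 / ρ⌉₊ + 1 : ℕ) : ℝ) ≤ n := by exact_mod_cast hn
      push_cast at h4; linarith
    have h5 := h3.trans_le (sg_ge_n hβ n)
    have h6 := sg_pos hβ hn1
    rw [div_lt_iff₀ hρ] at h5
    rw [div_lt_iff₀ h6]; linarith
  have m1 := min_le_left δ ρ
  have m2 := min_le_right δ ρ
  refine key_step hβ hx hab hf hb hK hl (by omega) hn1 hB (by linarith) (by linarith) hs hε hε1 ht hC hκ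
    (cc_abs hβ hf.measurable hb) hKM ?_ (by positivity) w ?_
  · rw [← hR]
    have h7 : R * (Cb / ((q * m : ℕ) : ℝ)) ≤ ε / 8 := by
      have := hq1.trans hqM'
      rw [div_le_iff₀ hε] at this
      rw [← mul_div_assoc, div_le_div_iff₀ hM0 (by norm_num)]
      linarith
    have h8 : R * (ε / (8 * R)) = ε / 8 := by field_simp
    rw [mul_add]; linarith
  · refine (hD a0 b0 ha0 hb0 (by linarith) (by linarith) q n hn1 w).trans ?_
    refine mul_le_mul_left (ENNReal.ofReal_le_ofReal ?_) _
    have : (1/2:ℝ) ^ q ≤ (1/2) ^ 2 := pow_le_pow_of_le_one (by norm_num) (by norm_num) hq3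
    have h9 := mul_le_mul_of_nonneg_right this (Vw_nonneg (J := Set.Ioo a0 b0) (x := x) hβ w)
    norm_num at h9 ⊢
    linarith

noncomputable def nk (n0 M : ℕ) : ℕ → ℕ
  | 0 => n0
  | k + 1 => nk n0 M k + M

lemma nk_eq (n0 M k : ℕ) : nk n0 M k = n0 + k * M := by
  induction k with
  | zero => simp [nk]
  | succ k ih => rw [nk, ih]; ring

noncomputable def SS (J : Set ℝ) (β x : ℝ) (f : ℝ → ℝ) (n0 M : ℕ) (c : ℝ) (k : ℕ) (α : ℝ) : ℝ :=
  ∑ i ∈ Finset.range k, (av β x f (nk n0 M i) M (rp J β x (nk n0 M i + M) (wd β x (nk n0 M i + M) α)) - c)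

lemma SS_meas (J : Set ℝ) (β x : ℝ) (f : ℝ → ℝ) (n0 M : ℕ) (c : ℝ) (k : ℕ) : Measurable (SS J β x f n0 M c k) := by
  unfold SS
  refine Finset.measurable_sum _ fun i _ => ?_
  refine Measurable.sub_const ?_ _
  exact (measurable_of_countable (fun w : Fin (nk n0 M i + M) → ℤ => av β x f (nk n0 M i) M (rp J β x (nk n0 M i + M) w))).comp
    (wd_meas β x _)

lemma SS_const {J : Set ℝ} {β x : ℝ} {f : ℝ → ℝ} {n0 M : ℕ} {c : ℝ} {k : ℕ} {α α' : ℝ}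
    (h : wd β x (nk n0 M k) α = wd β x (nk n0 M k) α') : SS J β x f n0 M c k α = SS J β x f n0 M c k α' := by
  unfold SS
  refine Finset.sum_congr rfl fun i hi => ?_
  have hi := Finset.mem_range.1 hi
  have hle : nk n0 M i + M ≤ nk n0 M k := by
    rw [nk_eq, nk_eq]
    have : (i + 1) * M ≤ k * M := Nat.mul_le_mul_right _ hi
    linarith [add_mul i 1 M]
  rw [wd_mono hle h]

lemma super {J : Set ℝ} (hJ : MeasurableSet J) {β x : ℝ} (hβ : 1 < β) {f : ℝ → ℝ} {n0 M : ℕ} {κ t c : ℝ} (hκ : 0 < κ)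
    (H : ∀ n ≥ n0, ∀ w : Fin n → ℤ,
    ∫⁻ α in cyl J β x n w,
      ENNReal.ofReal ((1 + κ * Vw J β x (n+M) (wd β x (n+M) α)) *
        Real.exp (t * (av β x f n M (rp J β x (n+M) (wd β x (n+M) α)) - c)))
      ≤ ENNReal.ofReal (1 + κ * Vw J β x n w) * volume (cyl J β x n w)) (k : ℕ) :
    ∫⁻ α in J, ENNReal.ofReal ((1 + κ * Vw J β x (nk n0 M k) (wd β x (nk n0 M k) α)) *
      Real.exp (t * SS J β x f n0 M c k α)) ≤
    ∫⁻ α in J, ENNReal.ofReal (1 + κ * Vw J β x n0 (wd β x n0 α)) := by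
  induction k with
  | zero => simp [nk, SS]
  | succ k ih =>
    refine le_trans ?_ ih
    have hJ0 : J = cyl J β x 0 (fun i => i.elim0) := by
      ext α; simp only [cyl, Set.mem_ofPred_eq]
      exact ⟨fun h => ⟨h, Subsingleton.elim _ _⟩, fun h => h.1⟩
    suffices main : ∀ w, ∫⁻ α in cyl J β x (nk n0 M k) w,
        ENNReal.ofReal ((1 + κ * Vw J β x (nk n0 M (k+1)) (wd β x (nk n0 M (k+1)) α)) *
      Real.exp (t * SS J β x f n0 M c (k+1) α)) ≤ ∫⁻ α in cyl J β x (nk n0 M k) w,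
        ENNReal.ofReal ((1 + κ * Vw J β x (nk n0 M k) (wd β x (nk n0 M k) α)) *
      Real.exp (t * SS J β x f n0 M c k α)) by
      have := refine_le hJ (Nat.zero_le (nk n0 M k)) (fun i : Fin 0 => i.elim0) main
      rwa [← hJ0] at this
    intro w
    rcases Set.eq_empty_or_nonempty (cyl J β x (nk n0 M k) w) with he | ⟨α₁, hα₁⟩
    · rw [he]; simp
    set E := ENNReal.ofReal (Real.exp (t * SS J β x f n0 M c k α₁)) with hE
    have hV := fun n (w : Fin n → ℤ) => Vw_nonneg (J := J) (x := x) hβ w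
    have e1 : ∀ α ∈ cyl J β x (nk n0 M k) w,
        ENNReal.ofReal ((1 + κ * Vw J β x (nk n0 M (k+1)) (wd β x (nk n0 M (k+1)) α)) *
      Real.exp (t * SS J β x f n0 M c (k+1) α)) = E * ENNReal.ofReal ((1 + κ * Vw J β x (nk n0 M k+M) (wd β x (nk n0 M k+M) α)) *
        Real.exp (t * (av β x f (nk n0 M k) M (rp J β x (nk n0 M k+M) (wd β x (nk n0 M k+M) α)) - c))) := by
      intro α hα
      rw [hE, ← ENNReal.ofReal_mul (Real.exp_pos _).le]
      congr 1
      rw [← SS_const (hα.2.trans hα₁.2.symm)]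
      have : SS J β x f n0 M c (k+1) α = SS J β x f n0 M c k α + 
        (av β x f (nk n0 M k) M (rp J β x (nk n0 M k+M) (wd β x (nk n0 M k+M) α)) - c) := by
        unfold SS; rw [Finset.sum_range_succ]
      rw [this, mul_add, Real.exp_add]
      show (1 + κ * Vw J β x (nk n0 M k+M) (wd β x (nk n0 M k+M) α)) * _ = _
      ring
    have e2 : ∀ α ∈ cyl J β x (nk n0 M k) w,
        ENNReal.ofReal ((1 + κ * Vw J β x (nk n0 M k) (wd β x (nk n0 M k) α)) *
      Real.exp (t * SS J β x f n0 M c k α)) = E * ENNReal.ofReal (1 + κ * Vw J β x (nk n0 M k) w) := by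
      intro α hα
      rw [hE, ← ENNReal.ofReal_mul (Real.exp_pos _).le, ← SS_const (hα.2.trans hα₁.2.symm), hα.2, mul_comm]
    rw [setLIntegral_congr_fun (cyl_meas hJ ..) e1, setLIntegral_congr_fun (cyl_meas hJ ..) e2,
      lintegral_const_mul' _ _ ENNReal.ofReal_ne_top, setLIntegral_const, mul_assoc]
    refine mul_le_mul_right ?_ _
    exact H _ (by rw [nk_eq]; omega) w

lemma SS_ev {a0 b0 β x : ℝ} (hβ : 1 < β) (hx : x ∈ Set.Ico (0:ℝ) 1) (ha0 : 0 ≤ a0) (hb0 : b0 ≤ 1)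
    {f : ℝ → ℝ} {n0 M : ℕ} {κ t c ε : ℝ} (hκ : 0 < κ) (ht : 0 < t) (hε : 0 < ε)
    (H : ∀ n ≥ n0, ∀ w : Fin n → ℤ,
    ∫⁻ α in cyl (Set.Ioo a0 b0) β x n w,
      ENNReal.ofReal ((1 + κ * Vw (Set.Ioo a0 b0) β x (n+M) (wd β x (n+M) α)) *
        Real.exp (t * (av β x f n M (rp (Set.Ioo a0 b0) β x (n+M) (wd β x (n+M) α)) - c)))
      ≤ ENNReal.ofReal (1 + κ * Vw (Set.Ioo a0 b0) β x n w) * volume (cyl (Set.Ioo a0 b0) β x n w)) :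
    ∀ᵐ α ∂(volume.restrict (Set.Ioo a0 b0)), ∀ᶠ k : ℕ in atTop, SS (Set.Ioo a0 b0) β x f n0 M c k α ≤ ε * k := by
  set J := Set.Ioo a0 b0 with hJ
  have hV := fun n (w : Fin n → ℤ) => Vw_nonneg (J := J) (x := x) hβ w
  set A := ∫⁻ α in J, ENNReal.ofReal (1 + κ * Vw J β x n0 (wd β x n0 α)) with hA
  have hAfin : A ≠ ⊤ := by
    have hJ0 : J = cyl J β x 0 (fun i => i.elim0) := by
      ext α; simp only [cyl, Set.mem_ofPred_eq]
      exact ⟨fun h => ⟨h, Subsingleton.elim _ _⟩, fun h => h.1⟩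
    have hd := drift_count (a0 := a0) (b0 := b0) (x := x) hβ (N := n0) (n := 0) (fun i => i.elim0)
      (Fintype.piFinset fun _ : Fin n0 => Finset.Icc (0:ℤ) ⌊β + 1⌋) (fun α hα => by
        rw [Fintype.mem_piFinset]
        intro i
        exact dg_bd hβ ⟨ha0.trans hα.1.1.le, hα.1.2.le.trans hb0⟩ ⟨hx.1, hx.2.le⟩ i)
    rw [← hJ, ← hJ0] at hd
    have e : ∀ α, ENNReal.ofReal (1 + κ * Vw J β x n0 (wd β x n0 α)) = 
        1 + ENNReal.ofReal κ * ENNReal.ofReal (Vw J β x n0 (wd β x n0 α)) := by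
      intro α
      rw [ENNReal.ofReal_add zero_le_one (mul_nonneg hκ.le (hV _ _)), ENNReal.ofReal_one, ENNReal.ofReal_mul hκ.le]
    rw [hA]; simp only [e]
    rw [lintegral_add_left measurable_const, lintegral_const_mul' _ _ ENNReal.ofReal_ne_top, setLIntegral_const]
    refine ENNReal.add_ne_top.2 ⟨?_, ?_⟩
    · rw [hJ]; simp
    · exact ENNReal.mul_ne_top ENNReal.ofReal_ne_top (ne_top_of_le_ne_top ENNReal.ofReal_ne_top hd)
  set W : ℕ → ℝ → ENNReal := fun k α => ENNReal.ofReal ((1 + κ * Vw J β x (nk n0 M k) (wd β x (nk n0 M k) α)) *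
      Real.exp (t * SS J β x f n0 M c k α)) with hW
  have hWm : ∀ k, Measurable (W k) := by
    intro k
    refine Measurable.ennreal_ofReal (Measurable.mul ?_ ?_)
    · exact (measurable_of_countable (fun w : Fin (nk n0 M k) → ℤ => 1 + κ * Vw J β x (nk n0 M k) w)).comp (wd_meas β x _)
    · exact ((SS_meas J β x f n0 M c k).const_mul t).exp
  set r := Real.exp (- (t * ε)) with hr
  have hr1 : r < 1 := by
    rw [hr, Real.exp_lt_one_iff]; nlinarith
  have hthr : ∀ k : ℕ, volume.restrict J {α | ENNReal.ofReal (Real.exp (t * ε * k)) ≤ W k α} ≤ A * ENNReal.ofReal r ^ k := by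
    intro k
    refine (meas_ge_le_lintegral_div (hWm k).aemeasurable (by simp [Real.exp_pos]) ENNReal.ofReal_ne_top).trans ?_
    rw [div_eq_mul_inv]
    refine mul_le_mul' (super measurableSet_Ioo hβ hκ H k) (le_of_eq ?_)
    rw [← ENNReal.ofReal_inv_of_pos (Real.exp_pos _), ← Real.exp_neg, ← ENNReal.ofReal_pow (Real.exp_pos _).le, ← Real.exp_nat_mul]
    congr 2; ring
  have hsum : ∑' k : ℕ, volume.restrict J {α | ENNReal.ofReal (Real.exp (t * ε * k)) ≤ W k α} ≠ ⊤ := by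
    refine ne_top_of_le_ne_top ?_ (ENNReal.tsum_le_tsum hthr)
    rw [ENNReal.tsum_mul_left, ENNReal.tsum_geometric]
    refine ENNReal.mul_ne_top hAfin (ENNReal.inv_ne_top.2 ?_)
    rw [← ENNReal.ofReal_one, ← ENNReal.ofReal_sub _ (Real.exp_pos _).le]
    have : 0 < 1 - r := by linarith
    exact (ENNReal.ofReal_pos.2 this).ne'
  filter_upwards [ae_eventually_notMem hsum] with α hα
  filter_upwards [hα] with k hk
  rw [not_le] at hk
  have h1 := (ENNReal.ofReal_lt_ofReal_iff (Real.exp_pos _)).1 hk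
  have h2 : Real.exp (t * SS J β x f n0 M c k α) < Real.exp (t * ε * k) := by
    refine lt_of_le_of_lt ?_ h1
    refine le_mul_of_one_le_left (Real.exp_pos _).le ?_
    have := mul_nonneg hκ.le (hV _ (wd β x (nk n0 M k) α))
    linarith
  have h3 := Real.exp_lt_exp.1 h2
  rw [mul_assoc] at h3
  exact (lt_of_mul_lt_mul_left h3 ht.le).le


lemma det {J : Set ℝ} {β x : ℝ} (hβ : 1 < β) (hx : x ∈ Set.Ico (0:ℝ) 1) {f : ℝ → ℝ}
    (hb : ∀ y, |f y| ≤ 1) {K : ℝ} (hK : 0 ≤ K)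
    (hl : ∀ y z, |f y - f z| ≤ K * |y - z|) {ε : ℝ} (hε : 0 < ε) (hε1 : ε ≤ 1) {n0 M : ℕ} (hM : 1 ≤ M) {c : ℝ} (hc : |c| ≤ 1)
    (hKM : K / (β - 1) / (M:ℕ) ≤ ε / 4) {α : ℝ} (hα : α ∈ J)
    (h : ∀ᶠ k : ℕ in atTop, SS J β x f n0 M (c + ε) k α ≤ ε / 4 * k) :
    ∀ᶠ n : ℕ in atTop, (n:ℝ)⁻¹ * ∑ m ∈ Finset.range n, f ((Tab α β)^[m] x) ≤ c + 2 * ε := by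
  set F : ℕ → ℝ := fun n => ∑ m ∈ Finset.range n, f ((Tab α β)^[m] x) with hF
  have hM' : (0:ℝ) < M := by exact_mod_cast hM
  have hgrow : ∀ n r, F (n + r) ≤ F n + r := by
    intro n r
    rw [hF]; dsimp only
    rw [Finset.sum_range_add]
    have : ∑ j ∈ Finset.range r, f ((Tab α β)^[n+j] x) ≤ ∑ j ∈ Finset.range r, (1:ℝ) :=
      Finset.sum_le_sum fun j _ => (abs_le.1 (hb _)).2
    simp at this
    linarith
  have hblk : ∀ k, F (nk n0 M k) ≤ n0 + M * (SS J β x f n0 M (c + ε) k α + k * (c + ε + ε / 4)) := by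
    intro k
    induction k with
    | zero => 
      have := hgrow 0 n0
      simpa [nk, SS, hF] using this
    | succ k ih =>
      have e1 : F (nk n0 M (k+1)) = F (nk n0 M k) + M * av β x f (nk n0 M k) M α := by
        rw [nk, hF]; dsimp only
        rw [Finset.sum_range_add, av, mul_inv_cancel_left₀ hM'.ne']
      have hmem : α ∈ cyl J β x (nk n0 M k+M) (wd β x (nk n0 M k+M) α) := ⟨hα, rfl⟩
      have hr := rp_mem ⟨α, hmem⟩
      have hcl := (abs_le.1 ((av_close hβ hx hK hl (nk n0 M k) hM hr.2).trans hKM)).1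
      have e2 : SS J β x f n0 M (c+ε) (k+1) α = SS J β x f n0 M (c+ε) k α + 
        (av β x f (nk n0 M k) M (rp J β x (nk n0 M k+M) (wd β x (nk n0 M k+M) α)) - (c+ε)) := by
        unfold SS; rw [Finset.sum_range_succ]
      rw [e1, e2]
      have e3 : (M:ℝ) * av β x f (nk n0 M k) M α ≤ M * (av β x f (nk n0 M k) M (rp J β x (nk n0 M k+M) (wd β x (nk n0 M k+M) α)) + ε / 4) := by
        refine mul_le_mul_of_nonneg_left ?_ hM'.le
        linarith
      push_cast
      nlinarith
  obtain ⟨k0, hk0⟩ := eventually_atTop.1 h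
  have hbig : ∀ᶠ n : ℕ in atTop, 8 * ((n0:ℝ) + M) / ε ≤ n := 
    tendsto_natCast_atTop_atTop.eventually_ge_atTop _
  filter_upwards [hbig, eventually_ge_atTop (n0 + k0 * M), eventually_ge_atTop 1] with n h1 h2 h3
  have hn' : (0:ℝ) < n := by exact_mod_cast h3
  rw [inv_mul_le_iff₀ hn']
  set k := (n - n0) / M with hk
  set r := (n - n0) % M with hr
  have hdm : M * k + r = n - n0 := Nat.div_add_mod _ _
  have hrM : r < M := Nat.mod_lt _ hM
  have hkk : k0 ≤ k := by
    rw [hk, Nat.le_div_iff_mul_le hM]; omega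
  have hn : n = nk n0 M k + r := by
    rw [nk_eq, mul_comm k M]
    omega
  have hnr : (n:ℝ) = n0 + M * k + r := by
    have : n = n0 + M * k + r := by omega
    exact_mod_cast this
  have hrM' : (r:ℝ) ≤ M := by exact_mod_cast hrM.le
  have hr0 : (0:ℝ) ≤ r := by positivity
  have hn00 : (0:ℝ) ≤ n0 := by positivity
  have g1 := hgrow (nk n0 M k) r
  rw [← hn] at g1
  have g2 := hblk k
  have g3 : (M:ℝ) * SS J β x f n0 M (c + ε) k α ≤ M * (ε / 4 * k) := mul_le_mul_of_nonneg_left (hk0 k hkk) hM'.le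
  rw [div_le_iff₀ hε] at h1
  have hc' := abs_le.1 hc
  show F n ≤ n * (c + 2 * ε)
  have g4 : F n ≤ n0 + M + (M * k) * (c + 3 / 2 * ε) := by nlinarith
  have g5 : (M * k : ℝ) * (c + 3 / 2 * ε) = n * (c + 3 / 2 * ε) - (n0 + r) * (c + 3 / 2 * ε) := by
    rw [hnr]; ring
  have g6 : -((n0 + r) * (c + 3 / 2 * ε)) ≤ (n0 + M) * 3 := by
    have : -((n0 + r) * (c + 3 / 2 * ε)) = (n0 + r) * (-(c + 3 / 2 * ε)) := by ring
    rw [this]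
    calc ((n0:ℝ) + r) * (-(c + 3 / 2 * ε)) ≤ (n0 + r) * 3 := by
          refine mul_le_mul_of_nonneg_left ?_ (by positivity)
          linarith [hc'.1]
      _ ≤ _ := by nlinarith
  nlinarith

lemma local_thm {α₀ β x : ℝ} (hβ : 1 < β) (hx : x ∈ Set.Ico (0:ℝ) 1) (hα₀ : α₀ ∈ Set.Ioo (0:ℝ) 1)
    (h0 : ∀ j, (Tab α₀ β)^[j+1] 0 ≠ 0) (h1 : ∀ j, (Tab α₀ β)^[j+1] 1 ≠ 0) {f : ℝ → ℝ}
    (hf : Continuous f) (hb : ∀ y, |f y| ≤ 1) {K : ℝ} (hK : 0 ≤ K)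
    (hl : ∀ y z, |f y - f z| ≤ K * |y - z|) {ε : ℝ} (hε : 0 < ε) (hε1 : ε ≤ 1) :
    ∃ U ∈ nhds α₀, volume {α | α ∈ U ∧
      ¬ ∀ᶠ n : ℕ in atTop, (n:ℝ)⁻¹ * ∑ m ∈ Finset.range n, f ((Tab α β)^[m] x) ≤ cc α β f + 3 * ε} = 0 := by
  obtain ⟨M, hM, κ, hκ, t, ht, δ, hδ, n0, hn0, hKM, H⟩ := key hβ hx h0 h1 hf hb hK hl hε hε1
  have hcont := cc_cont hβ h0 h1 hf hb
  obtain ⟨δ₂, hδ₂, hcc⟩ := Metric.continuousAt_iff.1 hcont ε hε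
  set d := min (min (δ/2) δ₂) (min α₀ (1 - α₀)) with hd
  have hd0 : 0 < d := by
    have h3 := hα₀.1
    have h4 : 0 < 1 - α₀ := by linarith [hα₀.2]
    positivity
  have d1 : d ≤ δ / 2 := (min_le_left _ _).trans (min_le_left _ _)
  have d2 : d ≤ δ₂ := (min_le_left _ _).trans (min_le_right _ _)
  have d3 : d ≤ α₀ := (min_le_right _ _).trans (min_le_left _ _)
  have d4 : d ≤ 1 - α₀ := (min_le_right _ _).trans (min_le_right _ _)
  have H' := H (α₀ - d) (α₀ + d) (by linarith) (by linarith) (by linarith) (by linarith) (by linarith)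
  simp only [sub_sub] at H'
  have hev := SS_ev (x := x) (a0 := α₀ - d) (b0 := α₀ + d) hβ hx (by linarith) (by linarith) hκ ht
    (show 0 < ε / 4 by positivity) H'
  refine ⟨Set.Ioo (α₀ - d) (α₀ + d), Ioo_mem_nhds (by linarith) (by linarith), ?_⟩
  rw [ae_restrict_iff' measurableSet_Ioo, ae_iff] at hev
  refine measure_mono_null ?_ hev
  rintro α ⟨hα, hn⟩ hcon
  apply hn
  have hs : ∀ᶠ k : ℕ in atTop, SS (Set.Ioo (α₀ - d) (α₀ + d)) β x f n0 M (cc α₀ β f + ε) k α ≤ ε / 4 * k := hcon hα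
  have := det hβ hx hb hK hl hε hε1 hM (cc_abs hβ hf.measurable hb) hKM hα hs
  have hclose : |cc α β f - cc α₀ β f| < ε := by
    refine hcc ?_
    rw [Real.dist_eq, abs_lt]
    constructor <;> linarith [hα.1, hα.2]
  filter_upwards [this] with n hn
  linarith [(abs_lt.1 hclose).1]

lemma cc_neg (α β : ℝ) (f : ℝ → ℝ) : cc α β (fun y => - f y) = - cc α β f := by
  unfold cc Lam II
  rw [← neg_div]
  congr 1
  rw [← tsum_neg]
  congr 1; funext i
  rw [intervalIntegral.integral_neg, intervalIntegral.integral_neg]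
  ring

lemma glob {β x : ℝ} (hβ : 1 < β) (hx : x ∈ Set.Ico (0:ℝ) 1) {f : ℝ → ℝ}
    (hf : Continuous f) (hb : ∀ y, |f y| ≤ 1) {K : ℝ} (hK : 0 ≤ K)
    (hl : ∀ y z, |f y - f z| ≤ K * |y - z|) : 
    ∀ᵐ α ∂(volume : Measure ℝ), α ∈ Set.Ico (0:ℝ) 1 →
      Tendsto (fun n : ℕ => (n:ℝ)⁻¹ * ∑ m ∈ Finset.range n, f ((Tab α β)^[m] x)) atTop (nhds (cc α β f)) := by
  have one : ∀ g : ℝ → ℝ, Continuous g → (∀ y, |g y| ≤ 1) → (∀ y z, |g y - g z| ≤ K * |y - z|) → ∀ i : ℕ,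
      ∀ᵐ α ∂(volume : Measure ℝ), α ∈ Set.Ico (0:ℝ) 1 → ∀ᶠ n : ℕ in atTop,
        (n:ℝ)⁻¹ * ∑ m ∈ Finset.range n, g ((Tab α β)^[m] x) ≤ cc α β g + 3 * (1 / ((i:ℝ) + 1)) := by
    intro g hg hgb hgl i
    have hN0 : ∀ᵐ α ∂(volume : Measure ℝ), ∀ j, (Tab α β)^[j+1] 0 ≠ 0 :=
      ae_all_iff.2 fun j => (count_a hβ 0 j 0).ae_notMem volume
    have hN1 : ∀ᵐ α ∂(volume : Measure ℝ), ∀ j, (Tab α β)^[j+1] 1 ≠ 0 :=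
      ae_all_iff.2 fun j => (count_a hβ 1 j 0).ae_notMem volume
    have hz : ∀ᵐ α ∂(volume : Measure ℝ), α ≠ 0 := (Set.countable_singleton (0:ℝ)).ae_notMem volume
    set B : Set ℝ := {α | (α ∈ Set.Ioo (0:ℝ) 1 ∧ (∀ j, (Tab α β)^[j+1] 0 ≠ 0) ∧ (∀ j, (Tab α β)^[j+1] 1 ≠ 0)) ∧
      ¬ ∀ᶠ n : ℕ in atTop, (n:ℝ)⁻¹ * ∑ m ∈ Finset.range n, g ((Tab α β)^[m] x) ≤ cc α β g + 3 * (1 / ((i:ℝ) + 1))} with hBdef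
    have hB : volume B = 0 := by
      refine measure_null_of_locally_null _ fun α₀ h => ?_
      obtain ⟨U, hU, hU0⟩ := local_thm hβ hx h.1.1 h.1.2.1 h.1.2.2 hg hgb hK hgl (ε := 1 / ((i:ℝ) + 1)) (by positivity) (by
        rw [div_le_one (by positivity)]
        have : (0:ℝ) ≤ i := by positivity
        linarith)
      refine ⟨U ∩ B, inter_mem (mem_nhdsWithin_of_mem_nhds hU) self_mem_nhdsWithin, measure_mono_null ?_ hU0⟩
      rintro α ⟨h1, h2⟩
      exact ⟨h1, h2.2⟩
    have hB' : ∀ᵐ α ∂(volume : Measure ℝ), α ∉ B := measure_eq_zero_iff_ae_notMem.1 hB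
    filter_upwards [hN0, hN1, hz, hB'] with α a0 a1 az ab hα
    by_contra hc
    exact ab ⟨⟨⟨lt_of_le_of_ne hα.1 (Ne.symm az), hα.2⟩, a0, a1⟩, hc⟩
  have up := ae_all_iff.2 (one f hf hb hl)
  have dn := ae_all_iff.2 (one (fun y => - f y) hf.neg (fun y => by rw [abs_neg]; exact hb y)
    (fun y z => by rw [neg_sub_neg, abs_sub_comm]; exact hl y z))
  filter_upwards [up, dn] with α hu hd hα
  rw [Metric.tendsto_atTop']
  intro ε hε
  obtain ⟨i, hi⟩ := exists_nat_one_div_lt (show 0 < ε / 3 by positivity)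
  have h1 := hu i hα
  have h2 := hd i hα
  rw [cc_neg] at h2
  obtain ⟨N, hN⟩ := eventually_atTop.1 (h1.and h2)
  refine ⟨N, fun n hn => ?_⟩
  obtain ⟨k1, k2⟩ := hN n hn.le
  rw [Finset.sum_neg_distrib, mul_neg] at k2
  rw [Real.dist_eq, abs_lt]
  constructor <;> linarith


noncomputable def clp (k : ℕ) (y : ℝ) : ℝ := (max 0 (min 1 y)) ^ k

lemma clp_cont (k : ℕ) : Continuous (clp k) := by
  unfold clp; fun_prop

lemma clp_mem (y : ℝ) : max 0 (min 1 y) ∈ Set.Icc (0:ℝ) 1 :=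
  ⟨le_max_left _ _, max_le zero_le_one (min_le_left _ _)⟩

lemma clp_bd (k : ℕ) (y : ℝ) : |clp k y| ≤ 1 := by
  obtain ⟨h1, h2⟩ := clp_mem y
  unfold clp
  rw [abs_of_nonneg (pow_nonneg h1 k)]
  exact pow_le_one₀ h1 h2

lemma clp_eq (k : ℕ) {y : ℝ} (hy : y ∈ Set.Icc (0:ℝ) 1) : clp k y = y ^ k := by
  unfold clp
  rw [min_eq_right hy.2, max_eq_right hy.1]

lemma pow_lip (k : ℕ) {u v : ℝ} (hu : u ∈ Set.Icc (0:ℝ) 1) (hv : v ∈ Set.Icc (0:ℝ) 1) :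
    |u ^ k - v ^ k| ≤ k * |u - v| := by
  induction k with
  | zero => simp
  | succ k ih =>
    have e : u ^ (k+1) - v ^ (k+1) = u * (u ^ k - v ^ k) + (u - v) * v ^ k := by ring
    rw [e]
    refine (abs_add_le _ _).trans ?_
    rw [abs_mul, abs_mul, abs_of_nonneg hu.1, abs_of_nonneg (pow_nonneg hv.1 k)]
    have h1 : u * |u ^ k - v ^ k| ≤ 1 * |u ^ k - v ^ k| := mul_le_mul_of_nonneg_right hu.2 (abs_nonneg _)
    have h2 : |u - v| * v ^ k ≤ |u - v| * 1 := mul_le_mul_of_nonneg_left (pow_le_one₀ hv.1 hv.2) (abs_nonneg _)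
    push_cast
    linarith

lemma clp_lip (k : ℕ) (y z : ℝ) : |clp k y - clp k z| ≤ k * |y - z| := by
  refine (pow_lip k (clp_mem y) (clp_mem z)).trans ?_
  refine mul_le_mul_of_nonneg_left ?_ (by positivity)
  have := ((LipschitzWith.id (α := ℝ)).const_min 1).const_max 0 |>.dist_le_mul y z
  simpa [Real.dist_eq] using this

lemma bad_null {x : ℝ} (hx : x ∈ Set.Ico (0:ℝ) 1) (k : ℕ) :
    volume {p : ℝ × ℝ | (p.1 ∈ Set.Ico (0 : ℝ) 1 ∧ p.2 ∈ Set.Ioi (1 : ℝ)) ∧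
      ¬ Tendsto (fun n : ℕ => (n:ℝ)⁻¹ * ∑ m ∈ Finset.range n, clp k ((Tab p.1 p.2)^[m] x)) atTop
        (nhds (cc p.1 p.2 (clp k)))} = 0 := by
  set g : ℕ → ℝ × ℝ → ℝ := fun n p => (n:ℝ)⁻¹ * ∑ m ∈ Finset.range n, clp k ((Tab p.1 p.2)^[m] x) -
    (n:ℝ)⁻¹ * ∑ j ∈ Finset.range n, II p.1 p.2 (clp k) j 1 with hg
  have hset : {p : ℝ × ℝ | (p.1 ∈ Set.Ico (0 : ℝ) 1 ∧ p.2 ∈ Set.Ioi (1 : ℝ)) ∧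
      ¬ Tendsto (fun n : ℕ => (n:ℝ)⁻¹ * ∑ m ∈ Finset.range n, clp k ((Tab p.1 p.2)^[m] x)) atTop
        (nhds (cc p.1 p.2 (clp k)))} = (Set.Ico (0:ℝ) 1 ×ˢ Set.Ioi (1:ℝ)) ∩
        {p | Tendsto (fun n => g n p) atTop (nhds 0)}ᶜ := by
    ext p
    simp only [Set.mem_ofPred_eq, Set.mem_inter_iff, Set.mem_prod, Set.mem_compl_iff]
    refine and_congr_right fun hp => not_congr ?_
    have hl := cc_lim (α := p.1) (β := p.2) hp.2 (clp_cont k).measurable (clp_bd k)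
    constructor
    · intro h
      have := h.sub hl
      rw [sub_self] at this
      exact this
    · intro h
      have := h.add hl
      rw [zero_add] at this
      refine this.congr fun n => ?_
      rw [hg]; ring
  have hII : ∀ j, Measurable fun p : ℝ × ℝ => II p.1 p.2 (clp k) j 1 := by
    intro j
    have h1 : Measurable (fun q : (ℝ × ℝ) × ℝ => clp k ((Tab q.1.1 q.1.2)^[j] q.2)) :=
      (clp_cont k).measurable.comp ((meas_T j).comp ((measurable_fst.comp measurable_fst).prodMk
        ((measurable_snd.comp measurable_fst).prodMk measurable_snd)))
    have h2 := (StronglyMeasurable.integral_prod_right (ν := volume.restrict (Set.Ioc (0:ℝ) 1))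
      (f := fun (p : ℝ × ℝ) (y : ℝ) => clp k ((Tab p.1 p.2)^[j] y)) h1.stronglyMeasurable).measurable
    convert h2 using 2 with p
    rw [II, intervalIntegral.integral_of_le zero_le_one]
  have hgm : ∀ n, Measurable (g n) := by
    intro n
    refine Measurable.sub ?_ ?_
    · refine Measurable.const_mul (Finset.measurable_sum _ fun m _ => ?_) _
      exact (clp_cont k).measurable.comp ((meas_T m).comp (measurable_fst.prodMk (measurable_snd.prodMk measurable_const)))
    · exact Measurable.const_mul (Finset.measurable_sum _ fun m _ => hII m) _
  have hmeas : MeasurableSet ((Set.Ico (0:ℝ) 1 ×ˢ Set.Ioi (1:ℝ)) ∩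
        {p : ℝ × ℝ | Tendsto (fun n => g n p) atTop (nhds 0)}ᶜ) :=
    (measurableSet_Ico.prod measurableSet_Ioi).inter (measurableSet_tendsto (nhds 0) hgm).compl
  rw [← hset] at hmeas
  rw [Measure.volume_eq_prod, Measure.prod_apply_symm hmeas]
  rw [lintegral_eq_zero_iff' (measurable_measure_prodMk_right hmeas).aemeasurable]
  refine Eventually.of_forall fun β => ?_
  by_cases hβ : 1 < β
  · have := glob hβ hx (clp_cont k) (clp_bd k) (Nat.cast_nonneg k) (clp_lip k)
    rw [ae_iff] at this
    refine measure_mono_null ?_ this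
    rintro α ⟨⟨h1, h2⟩, h3⟩ hcon
    exact h3 (hcon h1)
  · have : (fun α : ℝ => (α, β)) ⁻¹' {p : ℝ × ℝ | (p.1 ∈ Set.Ico (0 : ℝ) 1 ∧ p.2 ∈ Set.Ioi (1 : ℝ)) ∧
      ¬ Tendsto (fun n : ℕ => (n:ℝ)⁻¹ * ∑ m ∈ Finset.range n, clp k ((Tab p.1 p.2)^[m] x)) atTop
        (nhds (cc p.1 p.2 (clp k)))} = ∅ := by
      ext α
      simp only [Set.mem_preimage, Set.mem_ofPred_eq, Set.mem_empty_iff_false, iff_false]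
      rintro ⟨⟨_, h⟩, _⟩
      exact hβ h
    simp only [this, measure_empty, Pi.zero_apply]

lemma normal_of_mono {α β x : ℝ} (hβ : 1 < β) (hx : x ∈ Set.Ico (0:ℝ) 1)
    (h : ∀ k, Tendsto (fun n : ℕ => (n:ℝ)⁻¹ * ∑ m ∈ Finset.range n, clp k ((Tab α β)^[m] x)) atTop
        (nhds (cc α β (clp k)))) : IsNormalOrbit (Tab α β) (parryMeasure α β) x := by
  have hprob := parry_prob (α := α) hβ
  have hae := parry_ae α β
  set μ := parryMeasure α β with hμ
  have horb : ∀ m, (Tab α β)^[m] x ∈ Set.Icc (0:ℝ) 1 := fun m => T_mem α β x m ⟨hx.1, hx.2.le⟩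
  have hint : ∀ f : ℝ → ℝ, ContinuousOn f (Set.Icc 0 1) → Integrable f μ := by
    intro f hf
    have := hf.integrableOn_compact (μ := μ) isCompact_Icc
    rwa [IntegrableOn, Measure.restrict_eq_self_of_ae_mem hae] at this
  have hmono : ∀ k : ℕ, Tendsto (fun n : ℕ => (n:ℝ)⁻¹ * ∑ m ∈ Finset.range n, ((Tab α β)^[m] x) ^ k) atTop
      (nhds (∫ y, y ^ k ∂μ)) := by
    intro k
    have e : ∫ y, y ^ k ∂μ = cc α β (clp k) := by
      rw [← int_parry_cc hβ (clp_cont k).measurable (clp_bd k)]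
      refine integral_congr_ae ?_
      filter_upwards [hae] with y hy
      exact (clp_eq k hy).symm
    rw [e]
    refine (h k).congr fun n => ?_
    congr 1
    exact Finset.sum_congr rfl fun m _ => clp_eq k (horb m)
  have hpoly : ∀ P : Polynomial ℝ, Tendsto (fun n : ℕ => (n:ℝ)⁻¹ * ∑ m ∈ Finset.range n, P.eval ((Tab α β)^[m] x)) atTop
      (nhds (∫ y, P.eval y ∂μ)) := by
    intro P
    have e1 : ∫ y, P.eval y ∂μ = ∑ i ∈ Finset.range (P.natDegree + 1), P.coeff i * ∫ y, y ^ i ∂μ := by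
      simp only [Polynomial.eval_eq_sum_range]
      rw [integral_finset_sum _ fun i _ => (hint (fun y => P.coeff i * y ^ i) (by fun_prop))]
      exact Finset.sum_congr rfl fun i _ => integral_const_mul _ _
    rw [e1]
    have h2 := tendsto_finset_sum (Finset.range (P.natDegree + 1)) fun i _ => (hmono i).const_mul (P.coeff i)
    refine h2.congr fun n => ?_
    simp only [Polynomial.eval_eq_sum_range]
    rw [Finset.sum_comm, Finset.mul_sum]
    refine Finset.sum_congr rfl fun i _ => ?_
    rw [← Finset.mul_sum]; ring
  intro f hf
  rw [Metric.tendsto_atTop]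
  intro ε hε
  obtain ⟨P, hP⟩ := exists_polynomial_near_of_continuousOn 0 1 f hf (ε / 4) (by positivity)
  obtain ⟨N, hN⟩ := Metric.tendsto_atTop.1 (hpoly P) (ε / 4) (by positivity)
  refine ⟨N, fun n hn => ?_⟩
  have h1 := hN n hn
  have h2 : |∫ y, P.eval y ∂μ - ∫ y, f y ∂μ| ≤ ε / 4 := by
    rw [← integral_sub (hint _ (by fun_prop)) (hint f hf)]
    have := norm_integral_le_of_norm_le_const (μ := μ) (f := fun y => P.eval y - f y) (C := ε / 4) (by
      filter_upwards [hae] with y hy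
      exact (hP y hy).le)
    simpa using this
  have h3 : |(n:ℝ)⁻¹ * ∑ m ∈ Finset.range n, f ((Tab α β)^[m] x) - 
      (n:ℝ)⁻¹ * ∑ m ∈ Finset.range n, P.eval ((Tab α β)^[m] x)| ≤ ε / 4 := by
    rw [← mul_sub, ← Finset.sum_sub_distrib, abs_mul]
    have h4 : |∑ m ∈ Finset.range n, (f ((Tab α β)^[m] x) - P.eval ((Tab α β)^[m] x))| ≤ n * (ε / 4) := by
      refine (Finset.abs_sum_le_sum_abs _ _).trans ((Finset.sum_le_sum (g := fun _ => ε / 4) fun m _ => ?_).trans ?_)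
      · rw [abs_sub_comm]; exact (hP _ (horb m)).le
      · simp
    rcases Nat.eq_zero_or_pos n with h0 | h0
    · subst h0; simp; positivity
    · have h0' : (0:ℝ) < n := by exact_mod_cast h0
      rw [abs_of_pos (inv_pos.2 h0'), inv_mul_le_iff₀ h0']
      exact h4
  rw [Real.dist_eq] at h1 ⊢
  rw [abs_lt] at h1 ⊢
  rw [abs_le] at h2 h3
  constructor <;> linarith [h1.1, h1.2, h2.1, h2.2, h3.1, h3.2]

/-- For every `x ∈ [0,1)`, the set of `(α,β) ∈ [0,1) × (1,∞)` for which the orbit of `x` under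
`T_{α,β}` is `μ_{α,β}`-normal has full two-dimensional Lebesgue measure. -/
theorem normal_for_ae_alpha_beta (x : ℝ) (hx : x ∈ Set.Ico (0 : ℝ) 1) :
    volume {p : ℝ × ℝ | (p.1 ∈ Set.Ico (0 : ℝ) 1 ∧ p.2 ∈ Set.Ioi (1 : ℝ)) ∧
      ¬ IsNormalOrbit (Tab p.1 p.2) (parryMeasure p.1 p.2) x} = 0 := by
  refine measure_mono_null ?_ (measure_iUnion_null (bad_null hx))
  rintro p ⟨hp, hn⟩
  rw [Set.mem_iUnion]
  by_contra hc
  push Not at hc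
  refine hn (normal_of_mono hp.2 hx fun k => ?_)
  by_contra hk
  exact hc k ⟨hp, hk⟩
end

section
/- Let α ∈ [0,1), β > 1, and let u = i^{α,β}(0) ∈ ℕ^ℕ be the coding sequence of 0 under T_{α,β}. For β' > β set α' := (β'−1)·Σ_{j≥0} u_j·β'^{-(j+1)}. Then α' ∈ [0,1), and for every β' > β the orbit of 0 under T_{α',β'} is NOT μ_{α',β'}-normal: there exists a continuous function f : [0,1] → ℝ such that (1/n)·Σ_{m=0}^{n−1} f(T_{α',β'}^m(0)) does not converge to ∫ f dμ_{α',β'} as n → ∞. -/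
open MeasureTheory Filter

/-! ### Auxiliary notions -/

noncomputable def cd (α β x : ℝ) : ℤ := ⌊β * x + α⌋
noncomputable def cdm (α β x : ℝ) : ℤ := ⌈β * x + α⌉ - 1
noncomputable def Tm (α β x : ℝ) : ℝ := β * x + α - cdm α β x
noncomputable def sm (b : ℝ) (d : ℕ → ℤ) : ℝ := ∑' j : ℕ, (d j : ℝ) / b ^ (j + 1)
noncomputable def Ph (α β b x : ℝ) : ℝ := sm b (fun j => cd α β ((Tab α β)^[j] x))
noncomputable def Lh (α β b x : ℝ) : ℝ := sm b (fun j => cdm α β ((Tm α β)^[j] x))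

lemma Tab_eq (α β x : ℝ) : Tab α β x = β * x + α - cd α β x := by
  unfold Tab cd; rw [Int.fract]

lemma Tab_mem (α β x : ℝ) : Tab α β x ∈ Set.Ico (0 : ℝ) 1 :=
  ⟨Int.fract_nonneg _, Int.fract_lt_one _⟩

lemma Tab_iter_mem (α β : ℝ) {x : ℝ} (hx : x ∈ Set.Ico (0 : ℝ) 1) (n : ℕ) :
    (Tab α β)^[n] x ∈ Set.Ico (0 : ℝ) 1 := by
  cases n with
  | zero => exact hx
  | succ n => rw [Function.iterate_succ_apply']; exact Tab_mem _ _ _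

lemma Tm_mem (α β x : ℝ) : Tm α β x ∈ Set.Ioc (0 : ℝ) 1 := by
  unfold Tm cdm
  have h1 := Int.ceil_lt_add_one (β * x + α)
  have h2 := Int.le_ceil (β * x + α)
  push_cast
  constructor <;> linarith

lemma Tm_iter_mem (α β : ℝ) {x : ℝ} (hx : x ∈ Set.Ioc (0 : ℝ) 1) (n : ℕ) :
    (Tm α β)^[n] x ∈ Set.Ioc (0 : ℝ) 1 := by
  cases n with
  | zero => exact hx
  | succ n => rw [Function.iterate_succ_apply']; exact Tm_mem _ _ _

lemma cd_bd {α β x : ℝ} (hα : α ∈ Set.Ico (0 : ℝ) 1) (hβ : 1 < β) (hx : x ∈ Set.Ico (0 : ℝ) 1) :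
    (0 : ℝ) ≤ cd α β x ∧ (cd α β x : ℝ) ≤ β + 1 := by
  unfold cd
  obtain ⟨h1, h2⟩ := hα
  obtain ⟨h3, h4⟩ := hx
  have h5 : 0 ≤ β * x := by positivity
  have h6 : β * x ≤ β := by nlinarith
  constructor
  · exact_mod_cast Int.floor_nonneg.2 (by linarith)
  · have := Int.floor_le (β * x + α); linarith

lemma cdm_bd {α β x : ℝ} (hα : α ∈ Set.Ico (0 : ℝ) 1) (hβ : 1 < β) (hx : x ∈ Set.Ioc (0 : ℝ) 1) :
    (0 : ℝ) ≤ cdm α β x ∧ (cdm α β x : ℝ) ≤ β + 1 := by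
  unfold cdm
  obtain ⟨h1, h2⟩ := hα
  obtain ⟨h3, h4⟩ := hx
  have h5 : 0 < β * x := by positivity
  have h6 : β * x ≤ β := by nlinarith
  constructor
  · have : 0 < ⌈β * x + α⌉ := Int.ceil_pos.2 (by linarith)
    have h : (0 : ℤ) ≤ ⌈β * x + α⌉ - 1 := by omega
    exact_mod_cast h
  · have := Int.ceil_lt_add_one (β * x + α); push_cast; linarith

lemma sm_summable {b B : ℝ} (hb : 1 < b) {d : ℕ → ℤ}
    (hd : ∀ j, (0 : ℝ) ≤ d j ∧ (d j : ℝ) ≤ B) : Summable (fun j : ℕ => (d j : ℝ) / b ^ (j + 1)) := by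
  have hb0 : 0 < b := by linarith
  have hg : Summable (fun j : ℕ => B * (1 / b) ^ j) :=
    (summable_geometric_of_lt_one (by positivity) (by rw [div_lt_one hb0]; exact hb)).mul_left B
  refine Summable.of_nonneg_of_le (fun j => div_nonneg (hd j).1 (by positivity)) (fun j => ?_) hg
  have hB : 0 ≤ B := (hd j).1.trans (hd j).2
  rw [one_div, inv_pow, ← div_eq_mul_inv]
  apply div_le_div₀ hB (hd j).2 (by positivity)
  exact pow_le_pow_right₀ hb.le (by omega)

lemma sm_succ {b B : ℝ} (hb : 1 < b) {d : ℕ → ℤ}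
    (hd : ∀ j, (0 : ℝ) ≤ d j ∧ (d j : ℝ) ≤ B) :
    sm b d = b⁻¹ * (d 0 + sm b (fun j => d (j + 1))) := by
  have hb0 : b ≠ 0 := by positivity
  unfold sm
  rw [(sm_summable hb hd).tsum_eq_zero_add, mul_add, ← tsum_mul_left]
  congr 1
  · simp; field_simp
  · congr 1; ext j; rw [pow_succ b (j + 1)]; field_simp

lemma sm_bd {b B : ℝ} (hb : 1 < b) {d : ℕ → ℤ}
    (hd : ∀ j, (0 : ℝ) ≤ d j ∧ (d j : ℝ) ≤ B) :
    0 ≤ sm b d ∧ sm b d ≤ ∑' j : ℕ, B * (1 / b) ^ j := by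
  have hb0 : 0 < b := by linarith
  have hg : Summable (fun j : ℕ => B * (1 / b) ^ j) :=
    (summable_geometric_of_lt_one (by positivity) (by rw [div_lt_one hb0]; exact hb)).mul_left B
  constructor
  · exact tsum_nonneg (fun j => div_nonneg (hd j).1 (by positivity))
  · refine (sm_summable hb hd).tsum_le_tsum (fun j => ?_) hg
    have hB : 0 ≤ B := (hd j).1.trans (hd j).2
    rw [one_div, inv_pow, ← div_eq_mul_inv]
    apply div_le_div₀ hB (hd j).2 (by positivity)
    exact pow_le_pow_right₀ hb.le (by omega)

section
variable {α β b : ℝ}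

lemma Ph_succ (hα : α ∈ Set.Ico (0 : ℝ) 1) (hβ : 1 < β) (hb : 1 < b)
    {x : ℝ} (hx : x ∈ Set.Ico (0 : ℝ) 1) :
    Ph α β b x = b⁻¹ * (cd α β x + Ph α β b (Tab α β x)) := by
  unfold Ph
  rw [sm_succ (B := β + 1) hb (fun j => cd_bd hα hβ (Tab_iter_mem α β hx j))]
  simp

lemma Lh_succ (hα : α ∈ Set.Ico (0 : ℝ) 1) (hβ : 1 < β) (hb : 1 < b)
    {x : ℝ} (hx : x ∈ Set.Ioc (0 : ℝ) 1) :
    Lh α β b x = b⁻¹ * (cdm α β x + Lh α β b (Tm α β x)) := by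
  unfold Lh
  rw [sm_succ (B := β + 1) hb (fun j => cdm_bd hα hβ (Tm_iter_mem α β hx j))]
  simp

lemma exists_bd (hα : α ∈ Set.Ico (0 : ℝ) 1) (hβ : 1 < β) (hb : 1 < b) :
    ∃ C : ℝ, 0 ≤ C ∧ (∀ x ∈ Set.Ico (0 : ℝ) 1, 0 ≤ Ph α β b x ∧ Ph α β b x ≤ C) ∧
      ∀ x ∈ Set.Ioc (0 : ℝ) 1, 0 ≤ Lh α β b x ∧ Lh α β b x ≤ C := by
  have h1 : ∀ x ∈ Set.Ico (0 : ℝ) 1, 0 ≤ Ph α β b x ∧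
      Ph α β b x ≤ ∑' j : ℕ, (β + 1) * (1 / b) ^ j := fun x hx =>
    sm_bd (B := β + 1) hb (fun j => cd_bd hα hβ (Tab_iter_mem α β hx j))
  have h2 : ∀ x ∈ Set.Ioc (0 : ℝ) 1, 0 ≤ Lh α β b x ∧
      Lh α β b x ≤ ∑' j : ℕ, (β + 1) * (1 / b) ^ j := fun x hx =>
    sm_bd (B := β + 1) hb (fun j => cdm_bd hα hβ (Tm_iter_mem α β hx j))
  exact ⟨_, (h1 0 (by simp)).1.trans (h1 0 (by simp)).2, h1, h2⟩

end

/-! ### One-sided limits -/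

lemma cd_left {α β : ℝ} (hβ : 1 < β) (p : ℝ) :
    ∀ᶠ x in nhdsWithin p (Set.Iio p), cd α β x = cdm α β p := by
  have hcont : Tendsto (fun x => β * x + α) (nhdsWithin p (Set.Iio p)) (nhds (β * p + α)) := by
    have : Continuous (fun x => β * x + α) := by fun_prop
    exact (this.tendsto p).mono_left nhdsWithin_le_nhds
  have hlt : ((cdm α β p : ℤ) : ℝ) < β * p + α := by
    have := (Tm_mem α β p).1; unfold Tm at this; linarith
  filter_upwards [hcont.eventually (lt_mem_nhds hlt), self_mem_nhdsWithin] with x h1 h2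
  have h2' : x < p := h2
  unfold cd
  rw [Int.floor_eq_iff]
  refine ⟨h1.le, ?_⟩
  have := (Tm_mem α β p).2; unfold Tm at this
  nlinarith

lemma cd_right {α β : ℝ} (hβ : 1 < β) (p : ℝ) :
    ∀ᶠ x in nhdsWithin p (Set.Ici p), cd α β x = cd α β p := by
  have hcont : Tendsto (fun x => β * x + α) (nhdsWithin p (Set.Ici p)) (nhds (β * p + α)) := by
    have : Continuous (fun x => β * x + α) := by fun_prop
    exact (this.tendsto p).mono_left nhdsWithin_le_nhds
  have hlt : β * p + α < cd α β p + 1 := Int.lt_floor_add_one _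
  filter_upwards [hcont.eventually (gt_mem_nhds hlt), self_mem_nhdsWithin] with x h1 h2
  have h2' : p ≤ x := h2
  conv_lhs => unfold cd
  rw [Int.floor_eq_iff]
  refine ⟨?_, h1⟩
  have : (cd α β p : ℝ) ≤ β * p + α := Int.floor_le _
  nlinarith

lemma Tab_left {α β : ℝ} (hβ : 1 < β) (p : ℝ) :
    Tendsto (Tab α β) (nhdsWithin p (Set.Iio p)) (nhdsWithin (Tm α β p) (Set.Iio (Tm α β p))) := by
  have hcont : Tendsto (fun x => β * x + α - cdm α β p) (nhdsWithin p (Set.Iio p))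
      (nhds (Tm α β p)) := by
    have : Continuous (fun x => β * x + α - cdm α β p) := by fun_prop
    exact (this.tendsto p).mono_left nhdsWithin_le_nhds
  have heq : ∀ᶠ x in nhdsWithin p (Set.Iio p), Tab α β x = β * x + α - cdm α β p := by
    filter_upwards [cd_left (α := α) hβ p] with x hx
    rw [Tab_eq, hx]
  apply tendsto_nhdsWithin_of_tendsto_nhds_of_eventually_within
  · exact hcont.congr' (heq.mono fun x hx => hx.symm)
  · filter_upwards [heq, self_mem_nhdsWithin] with x hx h2
    have h2' : x < p := h2
    rw [hx]; unfold Tm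
    simp only [Set.mem_Iio]; nlinarith

lemma Tab_right {α β : ℝ} (hβ : 1 < β) (p : ℝ) :
    Tendsto (Tab α β) (nhdsWithin p (Set.Ici p)) (nhdsWithin (Tab α β p) (Set.Ici (Tab α β p))) := by
  have hcont : Tendsto (fun x => β * x + α - cd α β p) (nhdsWithin p (Set.Ici p))
      (nhds (Tab α β p)) := by
    have : Continuous (fun x => β * x + α - cd α β p) := by fun_prop
    rw [Tab_eq]
    exact (this.tendsto p).mono_left nhdsWithin_le_nhds
  have heq : ∀ᶠ x in nhdsWithin p (Set.Ici p), Tab α β x = β * x + α - cd α β p := by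
    filter_upwards [cd_right (α := α) hβ p] with x hx
    rw [Tab_eq, hx]
  apply tendsto_nhdsWithin_of_tendsto_nhds_of_eventually_within
  · exact hcont.congr' (heq.mono fun x hx => hx.symm)
  · filter_upwards [heq, self_mem_nhdsWithin] with x hx h2
    have h2' : p ≤ x := h2
    rw [hx, Tab_eq]
    simp only [Set.mem_Ici]; nlinarith

lemma word_left {α β : ℝ} (hβ : 1 < β) (N : ℕ) (p : ℝ) :
    ∀ᶠ x in nhdsWithin p (Set.Iio p), ∀ j ∈ Finset.range N,
      cd α β ((Tab α β)^[j] x) = cdm α β ((Tm α β)^[j] p) := by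
  have hT : ∀ j : ℕ, Tendsto ((Tab α β)^[j]) (nhdsWithin p (Set.Iio p))
      (nhdsWithin ((Tm α β)^[j] p) (Set.Iio ((Tm α β)^[j] p))) := by
    intro j
    induction j with
    | zero => exact tendsto_id
    | succ j ih =>
      rw [Function.iterate_succ', Function.iterate_succ']
      exact (Tab_left hβ _).comp ih
  rw [Filter.eventually_all_finset]
  intro j _
  exact (hT j).eventually (cd_left hβ _)

lemma word_right {α β : ℝ} (hβ : 1 < β) (N : ℕ) (p : ℝ) :
    ∀ᶠ x in nhdsWithin p (Set.Ici p), ∀ j ∈ Finset.range N,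
      cd α β ((Tab α β)^[j] x) = cd α β ((Tab α β)^[j] p) := by
  have hT : ∀ j : ℕ, Tendsto ((Tab α β)^[j]) (nhdsWithin p (Set.Ici p))
      (nhdsWithin ((Tab α β)^[j] p) (Set.Ici ((Tab α β)^[j] p))) := by
    intro j
    induction j with
    | zero => exact tendsto_id
    | succ j ih =>
      rw [Function.iterate_succ']
      exact (Tab_right hβ _).comp ih
  rw [Filter.eventually_all_finset]
  intro j _
  exact (hT j).eventually (cd_right hβ _)

lemma exists_delta {α β : ℝ} (hβ : 1 < β) (N : ℕ) : ∃ δ : ℝ, 0 < δ ∧ ∀ a : ℝ, ∃ p : ℝ,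
    ∀ x ∈ Set.Icc a (a + δ) ∩ Set.Ico (0 : ℝ) 1, ∀ y ∈ Set.Icc a (a + δ) ∩ Set.Ico (0 : ℝ) 1,
      (x < p ∧ y < p ∨ p ≤ x ∧ p ≤ y) →
      ∀ j < N, cd α β ((Tab α β)^[j] x) = cd α β ((Tab α β)^[j] y) := by
  have key : ∀ p : ℝ, ∃ ε > 0, ∀ x ∈ Metric.ball p ε, ∀ y ∈ Metric.ball p ε,
      (x < p ∧ y < p ∨ p ≤ x ∧ p ≤ y) →
      ∀ j < N, cd α β ((Tab α β)^[j] x) = cd α β ((Tab α β)^[j] y) := by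
    intro p
    have h1 := word_left (α := α) hβ N p
    have h2 := word_right (α := α) hβ N p
    rw [eventually_nhdsWithin_iff] at h1 h2
    obtain ⟨ε, hε, h⟩ := Metric.eventually_nhds_iff_ball.1 (h1.and h2)
    refine ⟨ε, hε, fun x hx y hy hxy j hj => ?_⟩
    rcases hxy with ⟨hx', hy'⟩ | ⟨hx', hy'⟩
    · rw [(h x hx).1 hx' j (Finset.mem_range.2 hj), (h y hy).1 hy' j (Finset.mem_range.2 hj)]
    · rw [(h x hx).2 hx' j (Finset.mem_range.2 hj), (h y hy).2 hy' j (Finset.mem_range.2 hj)]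
  choose ε hε hk using key
  obtain ⟨δ, hδ, hcov⟩ := lebesgue_number_lemma_of_metric (isCompact_Icc (a := (0 : ℝ)) (b := 1))
    (c := fun p : ℝ => Metric.ball p (ε p)) (fun _ => Metric.isOpen_ball)
    (fun x _ => Set.mem_iUnion.2 ⟨x, Metric.mem_ball_self (hε x)⟩)
  refine ⟨δ / 2, by linarith, fun a => ?_⟩
  by_cases ha1 : 1 < a
  · refine ⟨0, fun x hx => ?_⟩
    have := hx.1.1; have := hx.2.2; linarith
  · obtain ⟨p, hp⟩ := hcov (max a 0) ⟨le_max_right _ _, max_le (not_lt.1 ha1) zero_le_one⟩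
    have hsub : ∀ x ∈ Set.Icc a (a + δ / 2) ∩ Set.Ico (0 : ℝ) 1, x ∈ Metric.ball p (ε p) := by
      intro x hx
      apply hp
      have h1 := hx.1.1
      have h2 := hx.1.2
      have h3 := hx.2.1
      have h4 : max a 0 ≤ x := max_le h1 h3
      have h5 := le_max_left a 0
      rw [Metric.mem_ball, Real.dist_eq, abs_of_nonneg (by linarith)]
      linarith
    exact ⟨p, fun x hx y hy => hk p x (hsub x hx) y (hsub y hy)⟩

lemma Ph_left {α β b : ℝ} (hα : α ∈ Set.Ico (0 : ℝ) 1) (hβ : 1 < β) (hb : 1 < b)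
    {p : ℝ} (hp : p ∈ Set.Ioc (0 : ℝ) 1) :
    Tendsto (Ph α β b) (nhdsWithin p (Set.Iio p)) (nhds (Lh α β b p)) := by
  obtain ⟨C, hC, hP, hL⟩ := exists_bd hα hβ hb
  have hb0 : 0 < b := by linarith
  have key : ∀ n : ℕ, ∀ p ∈ Set.Ioc (0 : ℝ) 1, ∀ᶠ x in nhdsWithin p (Set.Iio p),
      |Ph α β b x - Lh α β b p| ≤ (b⁻¹) ^ n * C := by
    intro n
    induction n with
    | zero =>
      intro p hp
      filter_upwards [Ioo_mem_nhdsLT hp.1] with x hx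
      have h1 := hP x ⟨hx.1.le, hx.2.trans_le hp.2⟩
      have h2 := hL p hp
      rw [abs_le]; constructor <;> simp <;> linarith
    | succ n ih =>
      intro p hp
      filter_upwards [Ioo_mem_nhdsLT hp.1, cd_left (α := α) hβ p,
        (Tab_left (α := α) hβ p).eventually (ih _ (Tm_mem α β p))] with x hx hc hi
      rw [Ph_succ hα hβ hb ⟨hx.1.le, hx.2.trans_le hp.2⟩, Lh_succ hα hβ hb hp, hc, ← mul_sub,
        add_sub_add_left_eq_sub, abs_mul, abs_of_pos (inv_pos.2 hb0), pow_succ']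
      rw [mul_assoc]
      exact mul_le_mul_of_nonneg_left hi (inv_pos.2 hb0).le
  rw [Metric.tendsto_nhds]
  intro e he
  have hlim : Tendsto (fun n : ℕ => (b⁻¹) ^ n * C) atTop (nhds (0 * C)) :=
    (tendsto_pow_atTop_nhds_zero_of_lt_one (inv_pos.2 hb0).le (inv_lt_one_of_one_lt₀ hb)).mul_const C
  rw [zero_mul] at hlim
  obtain ⟨n, hn⟩ := (hlim.eventually (gt_mem_nhds he)).exists
  filter_upwards [key n p hp] with x hx
  rw [Real.dist_eq]; linarith

/-! ### Iterates on a common cylinder -/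

lemma iter_diff {α β : ℝ} (N : ℕ) {x y : ℝ}
    (h : ∀ j < N, cd α β ((Tab α β)^[j] x) = cd α β ((Tab α β)^[j] y)) :
    (Tab α β)^[N] y - (Tab α β)^[N] x = β ^ N * (y - x) := by
  induction N with
  | zero => simp
  | succ N ih =>
    have := ih (fun j hj => h j (by omega))
    rw [Function.iterate_succ_apply', Function.iterate_succ_apply', Tab_eq, Tab_eq,
      h N (by omega), pow_succ']
    linear_combination β * this

lemma Ph_diff {α β b : ℝ} (hα : α ∈ Set.Ico (0 : ℝ) 1) (hβ : 1 < β) (hb : 1 < b) (N : ℕ) {x y : ℝ}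
    (hx : x ∈ Set.Ico (0 : ℝ) 1) (hy : y ∈ Set.Ico (0 : ℝ) 1)
    (h : ∀ j < N, cd α β ((Tab α β)^[j] x) = cd α β ((Tab α β)^[j] y)) :
    Ph α β b y - Ph α β b x
      = (b⁻¹) ^ N * (Ph α β b ((Tab α β)^[N] y) - Ph α β b ((Tab α β)^[N] x)) := by
  induction N with
  | zero => simp
  | succ N ih =>
    have := ih (fun j hj => h j (by omega))
    rw [this, Ph_succ hα hβ hb (Tab_iter_mem α β hx N), Ph_succ hα hβ hb (Tab_iter_mem α β hy N),
      h N (by omega), Function.iterate_succ_apply', Function.iterate_succ_apply', pow_succ']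
    ring

lemma exists_N {β b : ℝ} (hβ : 1 < β) (hb : β < b) : ∃ N k : ℕ, 0 < k ∧ β ^ N ≤ k ∧
    2 * k * (b⁻¹) ^ N < 1 := by
  have hb0 : 0 < b := by linarith
  have h1 : Tendsto (fun n : ℕ => 2 * ((β / b) ^ n + (b⁻¹) ^ n)) atTop (nhds (2 * (0 + 0))) := by
    refine Tendsto.const_mul _ (Tendsto.add ?_ ?_)
    · exact tendsto_pow_atTop_nhds_zero_of_lt_one (by positivity) (by rwa [div_lt_one hb0])
    · exact tendsto_pow_atTop_nhds_zero_of_lt_one (by positivity)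
        (inv_lt_one_of_one_lt₀ (by linarith))
  obtain ⟨N, hN⟩ := (h1.eventually_lt_const (u := 1) (by norm_num)).exists
  have hk := Nat.ceil_lt_add_one (a := β ^ N) (by positivity)
  refine ⟨N, ⌈β ^ N⌉₊, Nat.ceil_pos.2 (by positivity), Nat.le_ceil _, ?_⟩
  refine lt_of_le_of_lt ?_ hN
  rw [div_eq_mul_inv, mul_pow]
  have : 0 < (b⁻¹) ^ N := by positivity
  nlinarith

lemma chunk_le {F : ℝ → ℝ} {δ D : ℝ} {k : ℕ} (hk : 0 < k)
    (hF : ∀ x ∈ Set.Ico (0 : ℝ) 1, ∀ y ∈ Set.Ico (0 : ℝ) 1, x ≤ y → y - x ≤ δ → F y - F x ≤ D)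
    {x y : ℝ} (hx : x ∈ Set.Ico (0 : ℝ) 1) (hy : y ∈ Set.Ico (0 : ℝ) 1) (hxy : x ≤ y)
    (hd : y - x ≤ k * δ) : F y - F x ≤ k * D := by
  have hk' : (0 : ℝ) < k := by exact_mod_cast hk
  set p : ℕ → ℝ := fun i => x + i * ((y - x) / k) with hp
  have hs : 0 ≤ (y - x) / k := div_nonneg (by linarith) hk'.le
  have hs' : (y - x) / k ≤ δ := by rw [div_le_iff₀ hk']; linarith
  have hpk : p k = y := by simp only [hp]; field_simp; ring
  have hp0 : p 0 = x := by simp [hp]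
  have hmem : ∀ i ≤ k, p i ∈ Set.Ico (0 : ℝ) 1 := by
    intro i hi
    have hi' : (i : ℝ) ≤ k := by exact_mod_cast hi
    have h1 : p i ≤ p k := by simp only [hp]; gcongr
    have h2 : x ≤ p i := by simp only [hp]; have : 0 ≤ (i : ℝ) * ((y - x) / k) := by positivity
                            linarith
    exact ⟨hx.1.trans h2, lt_of_le_of_lt (h1.trans_eq hpk) hy.2⟩
  have hstep : ∀ i, p (i + 1) - p i = (y - x) / k := by
    intro i; simp only [hp]; push_cast; ring
  calc F y - F x = ∑ i ∈ Finset.range k, (F (p (i + 1)) - F (p i)) := by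
        rw [Finset.sum_range_sub (fun i => F (p i)), hpk, hp0]
    _ ≤ ∑ i ∈ Finset.range k, D := by
        refine Finset.sum_le_sum fun i hi => ?_
        have hi := Finset.mem_range.1 hi
        have := hstep i
        exact hF _ (hmem i hi.le) _ (hmem (i + 1) hi) (by linarith) (by linarith)
    _ = k * D := by simp

/-- jumps have the right sign -/
lemma jump_le {α β b σ : ℝ} (hα : α ∈ Set.Ico (0 : ℝ) 1) (hβ : 1 < β) (hb : 1 < b)
    (hσ : σ * (1 + Ph α β b 0 - Lh α β b 1) ≤ 0) {p : ℝ} (hp : p ∈ Set.Ioo (0 : ℝ) 1) :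
    σ * (Ph α β b p - Lh α β b p) ≤ 0 := by
  obtain ⟨C, hC, hP, hL⟩ := exists_bd hα hβ hb
  have hb0 : 0 < b := by linarith
  have key : ∀ n : ℕ, ∀ p ∈ Set.Ioo (0 : ℝ) 1,
      σ * (Ph α β b p - Lh α β b p) ≤ (b⁻¹) ^ n * (|σ| * C) := by
    intro n
    induction n with
    | zero =>
      intro p hp
      have h1 := hP p ⟨hp.1.le, hp.2⟩
      have h2 := hL p ⟨hp.1, hp.2.le⟩
      rw [pow_zero, one_mul]
      refine (le_abs_self _).trans ?_
      rw [abs_mul]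
      refine mul_le_mul_of_nonneg_left ?_ (abs_nonneg _)
      rw [abs_le]; constructor <;> linarith
    | succ n ih =>
      intro p hp
      rw [Ph_succ hα hβ hb ⟨hp.1.le, hp.2⟩, Lh_succ hα hβ hb ⟨hp.1, hp.2.le⟩]
      by_cases hT : Tab α β p = 0
      · have h1 : β * p + α = cd α β p := by rw [Tab_eq] at hT; linarith
        have h2 : cdm α β p = cd α β p - 1 := by
          conv_lhs => unfold cdm
          rw [h1, Int.ceil_intCast]
        have h3 : Tm α β p = 1 := by unfold Tm; rw [h2, h1]; push_cast; ring
        rw [hT, h2, h3]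
        push_cast
        have h4 : 0 ≤ (b⁻¹) ^ (n + 1) * (|σ| * C) := by positivity
        refine le_trans ?_ h4
        have : 0 < b⁻¹ := inv_pos.2 hb0
        nlinarith
      · have hmem := Tab_mem α β p
        have h0 : 0 < Tab α β p := lt_of_le_of_ne hmem.1 (Ne.symm hT)
        have h2 : cdm α β p = cd α β p := by
          have e := Tab_eq α β p
          have : ⌈β * p + α⌉ = cd α β p + 1 := by
            rw [Int.ceil_eq_iff]; push_cast
            have := hmem.2
            constructor <;> linarith
          unfold cdm; omega
        have h3 : Tm α β p = Tab α β p := by rw [Tab_eq]; unfold Tm; rw [h2]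
        rw [h2, h3]
        have := ih _ ⟨h0, hmem.2⟩
        have hb' : 0 < b⁻¹ := inv_pos.2 hb0
        calc _ = b⁻¹ * (σ * (Ph α β b (Tab α β p) - Lh α β b (Tab α β p))) := by ring
          _ ≤ b⁻¹ * ((b⁻¹) ^ n * (|σ| * C)) := by gcongr
          _ = _ := by ring
  have hlim : Tendsto (fun n : ℕ => (b⁻¹) ^ n * (|σ| * C)) atTop (nhds (0 * (|σ| * C))) :=
    (tendsto_pow_atTop_nhds_zero_of_lt_one (inv_pos.2 hb0).le (inv_lt_one_of_one_lt₀ hb)).mul_const _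
  rw [zero_mul] at hlim
  exact ge_of_tendsto' hlim fun n => key n p hp

lemma anti {α β b σ : ℝ} (hα : α ∈ Set.Ico (0 : ℝ) 1) (hβ : 1 < β) (hb : β < b)
    (hσ : σ * (1 + Ph α β b 0 - Lh α β b 1) ≤ 0) {x y : ℝ}
    (hx : x ∈ Set.Ico (0 : ℝ) 1) (hy : y ∈ Set.Ico (0 : ℝ) 1) (hxy : x ≤ y) :
    σ * Ph α β b y ≤ σ * Ph α β b x := by
  have hb1 : 1 < b := hβ.trans hb
  have hb0 : 0 < b := by linarith
  obtain ⟨C, hC, hP, hL⟩ := exists_bd hα hβ hb1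
  obtain ⟨N, k, hk, hNk, hθ⟩ := exists_N hβ hb
  obtain ⟨δ, hδ, hdel⟩ := exists_delta (α := α) hβ N
  set θ : ℝ := 2 * k * (b⁻¹) ^ N with hθd
  have hθ0 : 0 ≤ θ := by positivity
  set F : ℝ → ℝ := fun x => σ * Ph α β b x with hF
  have key : ∀ n : ℕ, ∀ x ∈ Set.Ico (0 : ℝ) 1, ∀ y ∈ Set.Ico (0 : ℝ) 1, x ≤ y → y - x ≤ δ →
      F y - F x ≤ θ ^ n * (|σ| * C) := by
    intro n
    induction n with
    | zero =>
      intro x hx y hy _ _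
      have h1 := hP x hx
      have h2 := hP y hy
      rw [pow_zero, one_mul]
      simp only [hF]
      rw [← mul_sub]
      refine (le_abs_self _).trans ?_
      rw [abs_mul]
      refine mul_le_mul_of_nonneg_left ?_ (abs_nonneg _)
      rw [abs_le]; constructor <;> linarith
    | succ n ih =>
      set D := θ ^ n * (|σ| * C) with hD
      have hD0 : 0 ≤ D := by positivity
      have hpow : θ ^ (n + 1) * (|σ| * C) = 2 * ((b⁻¹) ^ N * (k * D)) := by
        rw [hD, pow_succ, hθd]; ring
      have hE : 0 ≤ (b⁻¹) ^ N * (k * D) := by positivity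
      have piece : ∀ x ∈ Set.Ico (0 : ℝ) 1, ∀ y ∈ Set.Ico (0 : ℝ) 1, x ≤ y → y - x ≤ δ →
          (∀ j < N, cd α β ((Tab α β)^[j] x) = cd α β ((Tab α β)^[j] y)) →
          F y - F x ≤ (b⁻¹) ^ N * (k * D) := by
        intro x hx y hy hxy hd hw
        have h1 := Ph_diff hα hβ hb1 N hx hy hw
        have h2 := iter_diff N hw
        have h3 : F y - F x = (b⁻¹) ^ N * (F ((Tab α β)^[N] y) - F ((Tab α β)^[N] x)) := by
          simp only [hF]; linear_combination σ * h1
        rw [h3]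
        refine mul_le_mul_of_nonneg_left ?_ (by positivity)
        have h4 : 0 ≤ β ^ N * (y - x) := mul_nonneg (by positivity) (by linarith)
        refine chunk_le hk ih (Tab_iter_mem α β hx N) (Tab_iter_mem α β hy N) (by linarith) ?_
        rw [h2]
        exact mul_le_mul hNk hd (by linarith) (by positivity)
      intro x hx y hy hxy hd
      rw [hpow]
      obtain ⟨p, hp⟩ := hdel x
      have hxm : x ∈ Set.Icc x (x + δ) ∩ Set.Ico (0 : ℝ) 1 := ⟨⟨le_rfl, by linarith⟩, hx⟩
      have hym : y ∈ Set.Icc x (x + δ) ∩ Set.Ico (0 : ℝ) 1 := ⟨⟨hxy, by linarith⟩, hy⟩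
      rcases lt_or_ge y p with hyp | hyp
      · have := piece x hx y hy hxy hd (hp x hxm y hym (Or.inl ⟨by linarith, hyp⟩))
        linarith
      rcases le_or_gt p x with hxp | hxp
      · have := piece x hx y hy hxy hd (hp x hxm y hym (Or.inr ⟨hxp, hyp⟩))
        linarith
      have hp01 : p ∈ Set.Ioo (0 : ℝ) 1 := ⟨hx.1.trans_lt hxp, hyp.trans_lt hy.2⟩
      have hpm : p ∈ Set.Icc x (x + δ) ∩ Set.Ico (0 : ℝ) 1 :=
        ⟨⟨hxp.le, by linarith⟩, ⟨hp01.1.le, hp01.2⟩⟩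
      have e1 := piece p hpm.2 y hy hyp (by linarith) (hp p hpm y hym (Or.inr ⟨le_rfl, hyp⟩))
      have e2 := jump_le hα hβ hb1 hσ hp01
      have e3 : σ * Lh α β b p - F x ≤ (b⁻¹) ^ N * (k * D) := by
        have hlim : Tendsto (fun w => F w - F x) (nhdsWithin p (Set.Iio p))
            (nhds (σ * Lh α β b p - F x)) :=
          ((Ph_left hα hβ hb1 ⟨hp01.1, hp01.2.le⟩).const_mul σ).sub_const _
        refine le_of_tendsto hlim ?_
        filter_upwards [Ioo_mem_nhdsLT hxp] with w hw
        have hwm : w ∈ Set.Icc x (x + δ) ∩ Set.Ico (0 : ℝ) 1 :=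
          ⟨⟨hw.1.le, by linarith [hw.2]⟩, ⟨hx.1.trans hw.1.le, hw.2.trans hp01.2⟩⟩
        exact piece x hx w hwm.2 hw.1.le (by linarith [hw.2])
          (hp x hxm w hwm (Or.inl ⟨hxp, hw.2⟩))
      have e4 : F p = σ * Ph α β b p := rfl
      linarith
  have hlim : Tendsto (fun n : ℕ => θ ^ n * (|σ| * C)) atTop (nhds (0 * (|σ| * C))) :=
    (tendsto_pow_atTop_nhds_zero_of_lt_one hθ0 hθ).mul_const _
  rw [zero_mul] at hlim
  have key0 : ∀ x ∈ Set.Ico (0 : ℝ) 1, ∀ y ∈ Set.Ico (0 : ℝ) 1, x ≤ y → y - x ≤ δ →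
      F y - F x ≤ 0 := fun x hx y hy h1 h2 => ge_of_tendsto' hlim fun n => key n x hx y hy h1 h2
  obtain ⟨m, hm⟩ := exists_nat_gt (1 / δ)
  have hm0 : (0 : ℝ) < m := lt_trans (by positivity) hm
  have := chunk_le (k := m) (by exact_mod_cast hm0) key0 hx hy hxy (by
    rw [div_lt_iff₀ hδ] at hm
    linarith [hx.1, hy.2])
  simp only [hF] at this
  linarith

lemma Ph_range {α β b : ℝ} (hα : α ∈ Set.Ico (0 : ℝ) 1) (hβ : 1 < β) (hb : β < b) {x : ℝ}
    (hx : x ∈ Set.Ico (0 : ℝ) 1) :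
    Ph α β b x - Ph α β b 0 ∈ Set.Ico (0 : ℝ) 1 := by
  have hb1 : 1 < b := hβ.trans hb
  have h0 : (0 : ℝ) ∈ Set.Ico (0 : ℝ) 1 := by simp
  have hlim := Ph_left hα hβ hb1 (p := 1) (by simp)
  have hG : 0 < 1 + Ph α β b 0 - Lh α β b 1 := by
    by_contra hcon
    have hanti : ∀ y ∈ Set.Ico (0 : ℝ) 1, Ph α β b y ≤ Ph α β b 0 := fun y hy => by
      have := anti (σ := 1) hα hβ hb (by linarith) h0 hy hy.1
      linarith
    have : Lh α β b 1 ≤ Ph α β b 0 := by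
      refine le_of_tendsto hlim ?_
      filter_upwards [Ioo_mem_nhdsLT (zero_lt_one (α := ℝ))] with w hw
      exact hanti w ⟨hw.1.le, hw.2⟩
    linarith
  have hmono : ∀ x ∈ Set.Ico (0 : ℝ) 1, ∀ y ∈ Set.Ico (0 : ℝ) 1, x ≤ y →
      Ph α β b x ≤ Ph α β b y := fun x hx y hy hxy => by
    have := anti (σ := -1) hα hβ hb (by linarith) hx hy hxy
    linarith
  have h1 : Ph α β b x ≤ Lh α β b 1 := by
    refine ge_of_tendsto hlim ?_
    filter_upwards [Ioo_mem_nhdsLT hx.2] with w hw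
    exact hmono x hx w ⟨hx.1.trans hw.1.le, hw.2⟩ hw.1.le
  have h2 := hmono 0 h0 x hx hx.1
  constructor <;> linarith

/-! ### The closure of the image is a null set -/

lemma vol_chunks {F : ℝ → ℝ} {δ D : ℝ} {k : ℕ} (hδ : 0 < δ)
    (hF : ∀ a : ℝ, volume (closure (F '' (Set.Icc a (a + δ) ∩ Set.Ico (0 : ℝ) 1))) ≤ ENNReal.ofReal D)
    (hD : 0 ≤ D) (hk : 0 < k) {s : ℝ} {B : Set ℝ} (hB : B ⊆ Set.Icc s (s + k * δ))
    (hB1 : B ⊆ Set.Ico (0 : ℝ) 1) :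
    volume (closure (F '' B)) ≤ ENNReal.ofReal (k * D) := by
  have hsub : F '' B ⊆ ⋃ i ∈ Finset.range k,
      F '' (Set.Icc (s + i * δ) (s + i * δ + δ) ∩ Set.Ico (0 : ℝ) 1) := by
    rintro _ ⟨x, hx, rfl⟩
    have h1 := hB hx
    have h2 := hB1 hx
    have h3 : 0 ≤ (x - s) / δ := div_nonneg (by linarith [h1.1]) hδ.le
    rw [Set.mem_iUnion₂]
    by_cases hfl : ⌊(x - s) / δ⌋₊ < k
    · refine ⟨⌊(x - s) / δ⌋₊, Finset.mem_range.2 hfl, x, ⟨⟨?_, ?_⟩, h2⟩, rfl⟩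
      · have := Nat.floor_le h3
        rw [le_div_iff₀ hδ] at this; linarith
      · have := Nat.lt_floor_add_one ((x - s) / δ)
        rw [div_lt_iff₀ hδ] at this; linarith
    · have h4 : (k : ℝ) ≤ (x - s) / δ := (Nat.le_floor_iff h3).1 (not_lt.1 hfl)
      rw [le_div_iff₀ hδ] at h4
      have hk1 : ((k - 1 : ℕ) : ℝ) = k - 1 := by rw [Nat.cast_sub hk]; simp
      refine ⟨k - 1, Finset.mem_range.2 (by omega), x, ⟨⟨?_, ?_⟩, h2⟩, rfl⟩
      · rw [hk1]; nlinarith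
      · rw [hk1]; have := h1.2; nlinarith
  calc volume (closure (F '' B))
      ≤ volume (⋃ i ∈ Finset.range k,
          closure (F '' (Set.Icc (s + i * δ) (s + i * δ + δ) ∩ Set.Ico (0 : ℝ) 1))) := by
        refine measure_mono ?_
        rw [← Finset.closure_biUnion]
        exact closure_mono hsub
    _ ≤ ∑ i ∈ Finset.range k,
          volume (closure (F '' (Set.Icc (s + i * δ) (s + i * δ + δ) ∩ Set.Ico (0 : ℝ) 1))) :=
        measure_biUnion_finset_le _ _
    _ ≤ ∑ i ∈ Finset.range k, ENNReal.ofReal D := Finset.sum_le_sum fun i _ => hF _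
    _ = ENNReal.ofReal (k * D) := by
        rw [Finset.sum_const, Finset.card_range, nsmul_eq_mul, ENNReal.ofReal_mul (by positivity),
          ENNReal.ofReal_natCast]

lemma null_image {α β b : ℝ} (hα : α ∈ Set.Ico (0 : ℝ) 1) (hβ : 1 < β) (hb : β < b) :
    volume (closure (Ph α β b '' Set.Ico (0 : ℝ) 1)) = 0 := by
  have hb1 : 1 < b := hβ.trans hb
  have hb0 : 0 < b := by linarith
  obtain ⟨C, hC, hP, hL⟩ := exists_bd hα hβ hb1
  obtain ⟨N, k, hk, hNk, hθ⟩ := exists_N hβ hb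
  obtain ⟨δ, hδ, hdel⟩ := exists_delta (α := α) hβ N
  set θ : ℝ := 2 * k * (b⁻¹) ^ N with hθd
  have hθ0 : 0 ≤ θ := by positivity
  have key : ∀ n : ℕ, ∀ a : ℝ,
      volume (closure (Ph α β b '' (Set.Icc a (a + δ) ∩ Set.Ico (0 : ℝ) 1)))
        ≤ ENNReal.ofReal (θ ^ n * C) := by
    intro n
    induction n with
    | zero =>
      intro a
      have : closure (Ph α β b '' (Set.Icc a (a + δ) ∩ Set.Ico (0 : ℝ) 1)) ⊆ Set.Icc 0 C := by
        refine closure_minimal ?_ isClosed_Icc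
        rintro _ ⟨x, hx, rfl⟩
        exact hP x hx.2
      refine (measure_mono this).trans ?_
      simp
    | succ n ih =>
      set D := θ ^ n * C with hD
      have hD0 : 0 ≤ D := by positivity
      have piece : ∀ a : ℝ, ∀ A : Set ℝ, A ⊆ Set.Icc a (a + δ) ∩ Set.Ico (0 : ℝ) 1 →
          (∀ x ∈ A, ∀ y ∈ A, ∀ j < N, cd α β ((Tab α β)^[j] x) = cd α β ((Tab α β)^[j] y)) →
          volume (closure (Ph α β b '' A)) ≤ ENNReal.ofReal ((b⁻¹) ^ N * (k * D)) := by
        intro a A hA hw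
        rcases A.eq_empty_or_nonempty with rfl | ⟨x0, hx0⟩
        · simp
        set S := (Tab α β)^[N] with hS
        have hv := vol_chunks (B := S '' A) (s := S x0 + β ^ N * (a - x0)) hδ ih hD0 hk (by
          rintro _ ⟨x, hx, rfl⟩
          have h1 := iter_diff N (hw x0 hx0 x hx)
          have h2 := (hA hx).1
          have h3 : 0 < β ^ N := by positivity
          have h5 : β ^ N * δ ≤ k * δ := by gcongr
          have h6 : 0 ≤ β ^ N * (x - a) := mul_nonneg h3.le (by linarith [h2.1])
          have h7 : β ^ N * (x - a) ≤ β ^ N * δ := mul_le_mul_of_nonneg_left (by linarith [h2.2]) h3.le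
          constructor <;> nlinarith) (by
          rintro _ ⟨x, hx, rfl⟩
          exact Tab_iter_mem α β (hA hx).2 N)
        set X := closure (Ph α β b '' (S '' A)) with hX
        set c : ℝ := Ph α β b (S x0) - b ^ N * Ph α β b x0 with hc
        have hsub : closure (Ph α β b '' A) ⊆ (fun t => b ^ N * t) ⁻¹' ((fun t => t + c) ⁻¹' X) := by
          refine closure_minimal ?_ ?_
          · rintro _ ⟨x, hx, rfl⟩
            have h1 := Ph_diff hα hβ hb1 N (hA hx0).2 (hA hx).2 (hw x0 hx0 x hx)
            simp only [Set.mem_preimage]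
            have : b ^ N * Ph α β b x + c = Ph α β b (S x) := by
              have h2 : b ^ N * (b⁻¹) ^ N = 1 := by rw [← mul_pow, mul_inv_cancel₀ hb0.ne', one_pow]
              rw [hc]
              linear_combination b ^ N * h1 + (Ph α β b (S x) - Ph α β b (S x0)) * h2
            rw [this]
            exact subset_closure ⟨_, ⟨x, hx, rfl⟩, rfl⟩
          · exact (isClosed_closure.preimage (by fun_prop)).preimage (by fun_prop)
        refine (measure_mono hsub).trans ?_
        rw [Real.volume_preimage_mul_left (by positivity), measure_preimage_add_right,
          ENNReal.ofReal_mul (by positivity), abs_of_pos (by positivity), inv_pow]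
        gcongr
      intro a
      obtain ⟨p, hp⟩ := hdel a
      set J := Set.Icc a (a + δ) ∩ Set.Ico (0 : ℝ) 1 with hJ
      have e1 := piece a (J ∩ Set.Iio p) Set.inter_subset_left
        (fun x hx y hy => hp x hx.1 y hy.1 (Or.inl ⟨hx.2, hy.2⟩))
      have e2 := piece a (J ∩ Set.Ici p) Set.inter_subset_left
        (fun x hx y hy => hp x hx.1 y hy.1 (Or.inr ⟨hx.2, hy.2⟩))
      have hJu : J = (J ∩ Set.Iio p) ∪ (J ∩ Set.Ici p) := by
        rw [← Set.inter_union_distrib_left, Set.Iio_union_Ici, Set.inter_univ]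
      rw [hJu, Set.image_union, closure_union]
      refine (measure_union_le _ _).trans ((add_le_add e1 e2).trans ?_)
      rw [← ENNReal.ofReal_add (by positivity) (by positivity)]
      apply ENNReal.ofReal_le_ofReal
      apply le_of_eq
      rw [hD, pow_succ, hθd]; ring
  have hlim : Tendsto (fun n : ℕ => θ ^ n * C) atTop (nhds (0 * C)) :=
    (tendsto_pow_atTop_nhds_zero_of_lt_one hθ0 hθ).mul_const _
  have hlim2 := ENNReal.tendsto_ofReal hlim
  rw [zero_mul] at hlim2
  have key0 : ∀ a : ℝ,
      volume (closure (Ph α β b '' (Set.Icc a (a + δ) ∩ Set.Ico (0 : ℝ) 1))) ≤ ENNReal.ofReal 0 :=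
    fun a => ge_of_tendsto' hlim2 fun n => key n a
  obtain ⟨m, hm⟩ := exists_nat_gt (1 / δ)
  have hm0 : (0 : ℝ) < m := lt_trans (by positivity) hm
  rw [div_lt_iff₀ hδ] at hm
  have := vol_chunks (k := m) (s := 0) (B := Set.Ico (0 : ℝ) 1) hδ key0 le_rfl
    (by exact_mod_cast hm0) (fun x hx => ⟨hx.1, by linarith [hx.2]⟩) subset_rfl
  simpa using this

/-! ### Non-normality from a null orbit closure -/

lemma not_normal_of_null {T : ℝ → ℝ} {μ : Measure ℝ} {x : ℝ} {K : Set ℝ} (hK : IsClosed K)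
    (hmem : ∀ n, T^[n] x ∈ K) (hμ : μ K = 0) : ¬ IsNormalOrbit T μ x := by
  intro h
  have hKne : K.Nonempty := ⟨_, hmem 0⟩
  have key : ∀ f : ℝ → ℝ, Continuous f → (∀ y ∈ K, f y = 1) → ∫ y, f y ∂μ = 1 := by
    intro f hf h1
    refine tendsto_nhds_unique (h f hf.continuousOn) ?_
    refine tendsto_const_nhds.congr' ?_
    filter_upwards [eventually_gt_atTop 0] with n hn
    rw [Finset.sum_congr rfl (fun m _ => h1 _ (hmem m))]
    simp only [Finset.sum_const, Finset.card_range, nsmul_eq_mul, mul_one]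
    rw [inv_mul_cancel₀]
    exact_mod_cast hn.ne'
  have hone := key (fun _ => 1) continuous_const (fun _ _ => rfl)
  have hint : Integrable (fun _ : ℝ => (1 : ℝ)) μ := by
    by_contra hc
    rw [integral_undef hc] at hone
    exact zero_ne_one hone
  set f : ℕ → ℝ → ℝ := fun k y => max 0 (1 - k * Metric.infDist y K) with hf
  have hfc : ∀ k, Continuous (f k) := fun k => by
    have := Metric.continuous_infDist_pt K
    simp only [hf]; fun_prop
  have hf1 : ∀ k, ∫ y, f k y ∂μ = 1 := fun k => key _ (hfc k) (fun y hy => by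
    simp [hf, Metric.infDist_zero_of_mem hy])
  have hlim : Tendsto (fun k => ∫ y, f k y ∂μ) atTop (nhds (∫ y, (0 : ℝ) ∂μ)) := by
    refine tendsto_integral_of_dominated_convergence (fun _ => 1)
      (fun k => (hfc k).aestronglyMeasurable) hint (fun k => ?_) ?_
    · refine Eventually.of_forall fun y => ?_
      have h0 : 0 ≤ (k : ℝ) * Metric.infDist y K := mul_nonneg (by positivity) Metric.infDist_nonneg
      simp only [hf]
      rw [Real.norm_eq_abs, abs_of_nonneg (le_max_left _ _)]
      exact max_le zero_le_one (by linarith)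
    · have : ∀ᵐ y ∂μ, y ∉ K := measure_eq_zero_iff_ae_notMem.1 hμ
      filter_upwards [this] with y hy
      have hpos : 0 < Metric.infDist y K := (hK.notMem_iff_infDist_pos hKne).1 hy
      refine tendsto_const_nhds.congr' ?_
      obtain ⟨m, hm⟩ := exists_nat_gt (1 / Metric.infDist y K)
      filter_upwards [eventually_ge_atTop m] with k hk
      have hk' : (m : ℝ) ≤ k := by exact_mod_cast hk
      rw [div_lt_iff₀ hpos] at hm
      simp only [hf]
      rw [max_eq_left]
      nlinarith
  simp only [hf1, integral_zero] at hlim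
  exact one_ne_zero (tendsto_nhds_unique tendsto_const_nhds hlim)

/-- Along the curve `β' ↦ α(β') = (β'-1)·Σ_j u_j·β'^{-(j+1)}`, where `u = i^{α,β}(0)`,
the orbit of `0` under `T_{α(β'),β'}` is not `μ_{α(β'),β'}`-normal for any `β' > β`. -/
theorem not_normal_along_curve (α β : ℝ) (hα : α ∈ Set.Ico (0 : ℝ) 1) (hβ : 1 < β) :
    ∀ β' : ℝ, β < β' →
      ((β' - 1) * ∑' j : ℕ, (code α β 0 j : ℝ) / β' ^ (j + 1)) ∈ Set.Ico (0 : ℝ) 1 ∧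
      ¬ IsNormalOrbit
        (Tab ((β' - 1) * ∑' j : ℕ, (code α β 0 j : ℝ) / β' ^ (j + 1)) β')
        (parryMeasure ((β' - 1) * ∑' j : ℕ, (code α β 0 j : ℝ) / β' ^ (j + 1)) β') 0 := by
  intro b hb
  have hb1 : 1 < b := hβ.trans hb
  have hb0 : 0 < b := by linarith
  have h0 : (0 : ℝ) ∈ Set.Ico (0 : ℝ) 1 := by simp
  have hsum : ∑' j : ℕ, (code α β 0 j : ℝ) / b ^ (j + 1) = Ph α β b 0 := by
    unfold Ph sm
    congr 1; ext j
    have h1 := (cd_bd hα hβ (Tab_iter_mem α β h0 j)).1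
    have h2 : (code α β 0 j : ℤ) = cd α β ((Tab α β)^[j] 0) := by
      have h3 : 0 ≤ cd α β ((Tab α β)^[j] 0) := by exact_mod_cast h1
      unfold code
      exact Int.toNat_of_nonneg h3
    simp only [← h2]; simp
  rw [hsum]
  set a := (b - 1) * Ph α β b 0 with ha
  have hrec : ∀ x ∈ Set.Ico (0 : ℝ) 1, b * (Ph α β b x - Ph α β b 0) + a - cd α β x
      = Ph α β b (Tab α β x) - Ph α β b 0 := by
    intro x hx
    have h1 := Ph_succ hα hβ hb1 hx
    have h2 : b * Ph α β b x = cd α β x + Ph α β b (Tab α β x) := by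
      rw [h1, ← mul_assoc, mul_inv_cancel₀ hb0.ne', one_mul]
    rw [ha]; linear_combination h2
  have hcd0 : cd α β 0 = 0 := by
    unfold cd; rw [mul_zero, zero_add]; exact Int.floor_eq_zero_iff.2 hα
  have ha01 : a ∈ Set.Ico (0 : ℝ) 1 := by
    have h1 := hrec 0 h0
    rw [hcd0] at h1
    simp only [sub_self, mul_zero, zero_add, Int.cast_zero, sub_zero] at h1
    rw [h1]
    exact Ph_range hα hβ hb (Tab_mem α β 0)
  refine ⟨ha01, ?_⟩
  have horb : ∀ n : ℕ, (Tab a b)^[n] 0 = Ph α β b ((Tab α β)^[n] 0) - Ph α β b 0 := by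
    intro n
    induction n with
    | zero => simp
    | succ n ih =>
      rw [Function.iterate_succ_apply', Function.iterate_succ_apply', ih]
      have hm := Tab_iter_mem α β h0 n
      have h1 := hrec _ hm
      have h2 := Ph_range hα hβ hb (Tab_mem α β ((Tab α β)^[n] 0))
      rw [← h1] at h2 ⊢
      rw [Tab_eq a b]
      congr 2
      conv_lhs => unfold cd
      rw [Int.floor_eq_iff]
      constructor
      · linarith [h2.1]
      · linarith [h2.2]
  refine not_normal_of_null
    (K := (fun t => t + Ph α β b 0) ⁻¹' closure (Ph α β b '' Set.Ico (0 : ℝ) 1))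
    (isClosed_closure.preimage (by fun_prop)) (fun n => ?_) ?_
  · rw [horb]
    simp only [Set.mem_preimage, sub_add_cancel]
    exact subset_closure ⟨_, Tab_iter_mem α β h0 n, rfl⟩
  · have hv : volume ((fun t => t + Ph α β b 0) ⁻¹' closure (Ph α β b '' Set.Ico (0 : ℝ) 1)) = 0 := by
      rw [measure_preimage_add_right]; exact null_image hα hβ hb
    have hac : parryMeasure a b ≪ volume :=
      (withDensity_absolutelyContinuous _ _).trans Measure.absolutelyContinuous_restrict
    exact hac hv
end

section
/- Let x ∈ (0,1), α ∈ [0,1), and 1 < β₁ ≤ β₂. If for some l ∈ ℕ the coding sequences agree up to index l, i.e., i^{α,β₁}_n(x) = i^{α,β₂}_n(x) for all n < l, then β₂ − β₁ ≤ β₂^{-l+1}/x. -/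
open MeasureTheory Filter

/-- Exponential separation of codings: if `x ∈ (0,1)`, `α ∈ [0,1)`, `1 < β₁ ≤ β₂` and the coding
sequences of `x` under `T_{α,β₁}` and `T_{α,β₂}` agree up to index `l`, then
`β₂ - β₁ ≤ β₂^{-l+1}/x`. -/
theorem coding_separation (x α β₁ β₂ : ℝ) (hx : x ∈ Set.Ioo (0 : ℝ) 1)
    (hα : α ∈ Set.Ico (0 : ℝ) 1) (hβ₁ : 1 < β₁) (hβ : β₁ ≤ β₂) (l : ℕ)
    (h : ∀ n < l, code α β₁ x n = code α β₂ x n) :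
    β₂ - β₁ ≤ β₂ ^ (1 - (l : ℤ)) / x := by
  obtain ⟨hx0, hx1⟩ := hx
  obtain ⟨ha0, ha1⟩ := hα
  have hb2 : 1 < β₂ := lt_of_lt_of_le hβ₁ hβ
  have hb2p : 0 < β₂ := by linarith
  have hnn : ∀ β : ℝ, ∀ n, 0 ≤ (Tab α β)^[n] x := by
    intro β n
    cases n with
    | zero => simpa using hx0.le
    | succ k => rw [Function.iterate_succ_apply']; exact Int.fract_nonneg _
  have hstep : ∀ n < l, (Tab α β₂)^[n+1] x - (Tab α β₁)^[n+1] x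
      = β₂ * ((Tab α β₂)^[n] x - (Tab α β₁)^[n] x) + (β₂ - β₁) * (Tab α β₁)^[n] x := by
    intro n hn
    have hc := h n hn
    unfold code at hc
    have h1 : 0 ≤ ⌊β₁ * (Tab α β₁)^[n] x + α⌋ := by
      apply Int.floor_nonneg.mpr
      have := mul_nonneg (by linarith : (0:ℝ) ≤ β₁) (hnn β₁ n)
      linarith
    have h2 : 0 ≤ ⌊β₂ * (Tab α β₂)^[n] x + α⌋ := by
      apply Int.floor_nonneg.mpr
      have := mul_nonneg hb2p.le (hnn β₂ n)
      linarith
    have h3 : ⌊β₁ * (Tab α β₁)^[n] x + α⌋ = ⌊β₂ * (Tab α β₂)^[n] x + α⌋ := by omega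
    have e1 : (Tab α β₁)^[n+1] x
        = β₁ * (Tab α β₁)^[n] x + α - (⌊β₁ * (Tab α β₁)^[n] x + α⌋ : ℝ) := by
      rw [Function.iterate_succ_apply']; rfl
    have e2 : (Tab α β₂)^[n+1] x
        = β₂ * (Tab α β₂)^[n] x + α - (⌊β₂ * (Tab α β₂)^[n] x + α⌋ : ℝ) := by
      rw [Function.iterate_succ_apply']; rfl
    rw [e1, e2, h3]; ring
  have hlow : ∀ n, n < l → β₂ ^ n * ((β₂ - β₁) * x)
      ≤ (Tab α β₂)^[n+1] x - (Tab α β₁)^[n+1] x := by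
    intro n
    induction n with
    | zero => intro hn; rw [hstep 0 hn]; simp
    | succ k ih =>
      intro hn
      rw [hstep (k+1) hn]
      have i1 := mul_le_mul_of_nonneg_left (ih (by omega)) hb2p.le
      have i2 := mul_nonneg (by linarith : (0:ℝ) ≤ β₂ - β₁) (hnn β₁ (k+1))
      rw [pow_succ]
      linarith
  rw [le_div_iff₀ hx0]
  cases l with
  | zero =>
    simp only [Nat.cast_zero, sub_zero, zpow_one]
    nlinarith
  | succ k =>
    have h1 := hlow k (by omega)
    have h2 : (Tab α β₂)^[k+1] x < 1 := by
      rw [Function.iterate_succ_apply']; exact Int.fract_lt_one _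
    have h3 := hnn β₁ (k+1)
    have e : (1 - ((k+1 : ℕ) : ℤ)) = -(k : ℤ) := by push_cast; ring
    rw [e, zpow_neg, zpow_natCast, ← one_div, le_div_iff₀ (pow_pos hb2p k)]
    linarith
end

section
/- Let α ∈ (0,1) and 1 < β₁ ≤ β₂. If for some l ∈ ℕ the coding sequences of the point 0 agree up to index l, i.e., i^{α,β₁}_n(0) = i^{α,β₂}_n(0) for all n < l, then β₂ − β₁ ≤ β₂^{-l+2}/α. -/
open MeasureTheory Filter

/-- Exponential separation of codings of `0`: if `α ∈ (0,1)`, `1 < β₁ ≤ β₂` and the coding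
sequences of `0` under `T_{α,β₁}` and `T_{α,β₂}` agree up to index `l`, then
`β₂ - β₁ ≤ β₂^{-l+2}/α`. -/
theorem coding_separation_zero (α β₁ β₂ : ℝ) (hα : α ∈ Set.Ioo (0 : ℝ) 1)
    (hβ₁ : 1 < β₁) (hβ : β₁ ≤ β₂) (l : ℕ)
    (h : ∀ n < l, code α β₁ 0 n = code α β₂ 0 n) :
    β₂ - β₁ ≤ β₂ ^ (2 - (l : ℤ)) / α := by
  obtain ⟨hα0, hα1⟩ := hα
  have hx : ∀ (β : ℝ) (n : ℕ), 0 ≤ (Tab α β)^[n] 0 ∧ (Tab α β)^[n] 0 < 1 := by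
    intro β n
    cases n with
    | zero => simp
    | succ n =>
      rw [Function.iterate_succ_apply']
      exact ⟨Int.fract_nonneg _, Int.fract_lt_one _⟩
  have hrec : ∀ (β : ℝ), 1 < β → ∀ n : ℕ,
      (Tab α β)^[n+1] 0 = β * (Tab α β)^[n] 0 + α - (code α β 0 n : ℝ) := by
    intro β hb n
    rw [Function.iterate_succ_apply']
    have h0 : 0 ≤ ⌊β * (Tab α β)^[n] 0 + α⌋ := by
      apply Int.floor_nonneg.mpr
      have := (hx β n).1
      positivity
    have h1 : ((code α β 0 n : ℕ) : ℝ) = (⌊β * (Tab α β)^[n] 0 + α⌋ : ℝ) := by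
      unfold code
      exact_mod_cast congrArg (Int.cast (R := ℝ)) (Int.toNat_of_nonneg h0)
    rw [h1]
    rfl
  have hβ₂ : 1 < β₂ := lt_of_lt_of_le hβ₁ hβ
  have hone : ∀ β : ℝ, (Tab α β)^[1] 0 = α := by
    intro β
    simp [Tab, Int.fract_eq_self.mpr ⟨hα0.le, hα1⟩]
  rw [le_div_iff₀ hα0]
  have hsmall : (β₂ - β₁) * α ≤ β₂ := by nlinarith
  rcases l with _ | _ | k
  · simp only [Nat.cast_zero, sub_zero]
    have : β₂ ^ (2:ℤ) = β₂ * β₂ := by rw [zpow_ofNat]; ring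
    rw [this]; nlinarith
  · simpa using hsmall
  · have key : ∀ m ≤ k, β₂ ^ m * ((β₂ - β₁) * α) ≤
        (Tab α β₂)^[m+2] 0 - (Tab α β₁)^[m+2] 0 := by
      intro m
      induction m with
      | zero =>
        intro _
        rw [hrec β₂ hβ₂ (0+1), hrec β₁ hβ₁ (0+1), h (0+1) (by omega), zero_add, hone, hone]
        apply le_of_eq; ring
      | succ m ih =>
        intro hm
        have ih := ih (by omega)
        rw [hrec β₂ hβ₂ (m+2), hrec β₁ hβ₁ (m+2), h (m+2) (by omega)] 
        have h1 := mul_le_mul_of_nonneg_left ih (by linarith : (0:ℝ) ≤ β₂)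
        have h2 := mul_nonneg (sub_nonneg.mpr hβ) (hx β₁ (m+2)).1
        rw [pow_succ]
        linarith
    have h1 := key k le_rfl
    have h2 := (hx β₂ (k+2)).2
    have h3 := (hx β₁ (k+2)).1
    have hp : 0 < β₂ ^ k := by positivity
    have he : (2 - ((k + 1 + 1 : ℕ) : ℤ)) = -(k:ℤ) := by push_cast; ring
    rw [he, zpow_neg, zpow_natCast, ← one_div, le_div_iff₀ hp]
    linarith
end
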